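/- arXiv:2507.02885 — 3 statements merged into one kernel-verified Lean document; each statement's English description precedes it below -/
import Mathlib

section
/- (Browning–Lichtman–Teräväinen bound.) For every λ with 0 < λ < 1.001 there is a constant C such that for all X ≥ 2, N_λ(X) ≤ C · X^(33/50). -/
open Finset

/-- The radical of a positive integer: the product of its distinct prime factors. -/
def rad (n : ℕ) : ℕ := ∏ p ∈ n.primeFactors, p

/-- `(a,b,c)` is an abc triple of exponent `lam`: positive coprime integers with
`a + b = c` and `rad (a*b*c) < c ^ lam`. -/
def IsABCTriple (lam : ℝ) (a b c : ℕ) : Prop :=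
  0 < a ∧ 0 < b ∧ 0 < c ∧ Nat.gcd a b = 1 ∧ a + b = c ∧
    (rad (a * b * c) : ℝ) < (c : ℝ) ^ lam

/-- `NabcCount lam X` is the number of abc triples of exponent `lam` with all entries
at most `X`. -/
noncomputable def NabcCount (lam X : ℝ) : ℕ :=
  Set.ncard {t : ℕ × ℕ × ℕ | IsABCTriple lam t.1 t.2.1 t.2.2 ∧
    (t.1 : ℝ) ≤ X ∧ (t.2.1 : ℝ) ≤ X ∧ (t.2.2 : ℝ) ≤ X}

lemma rad_pos (n : ℕ) : 0 < rad n :=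
  Finset.prod_pos fun _ hp => (Nat.prime_of_mem_primeFactors hp).pos

lemma one_le_rad (n : ℕ) : (1 : ℝ) ≤ rad n := by exact_mod_cast rad_pos n

lemma rad_le_self {n : ℕ} (hn : n ≠ 0) : rad n ≤ n :=
  Nat.le_of_dvd (Nat.pos_of_ne_zero hn) (Nat.prod_primeFactors_dvd n)

lemma rad_mul_of_coprime {m n : ℕ} (h : m.Coprime n) : rad (m * n) = rad m * rad n := by
  unfold rad
  rw [h.primeFactors_mul, Finset.prod_union h.disjoint_primeFactors]

lemma rad_prime_pow {p k : ℕ} (hp : p.Prime) (hk : k ≠ 0) : rad (p ^ k) = p := by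
  simp [rad, Nat.primeFactors_prime_pow hk hp]

/-- The tail of the Euler factor at `p` of the Dirichlet series of `1 / rad`. -/
lemma hasSum_rpow_div_rad_prime_pow {e : ℝ} (he : 0 < e) {p : ℕ} (hp : p.Prime) :
    HasSum (fun k : ℕ => ((p ^ k : ℕ) : ℝ) ^ (-e) / rad (p ^ k))
      (1 + (p : ℝ) ^ (-e) / (1 - (p : ℝ) ^ (-e)) / p) := by
  have hp1 : (1 : ℝ) < p := by exact_mod_cast hp.one_lt
  have hq0 : 0 ≤ (p : ℝ) ^ (-e) := by positivity
  have hq1 : (p : ℝ) ^ (-e) < 1 := Real.rpow_lt_one_of_one_lt_of_neg hp1 (by linarith)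
  rw [← hasSum_nat_add_iff' 1]
  have h := ((hasSum_geometric_of_lt_one hq0 hq1).mul_left ((p : ℝ) ^ (-e))).div_const (p : ℝ)
  have hf : ∀ k : ℕ, ((p ^ (k + 1) : ℕ) : ℝ) ^ (-e) / rad (p ^ (k + 1)) =
      (p : ℝ) ^ (-e) * ((p : ℝ) ^ (-e)) ^ k / p := by
    intro k
    rw [rad_prime_pow hp (by omega)]
    push_cast
    rw [← Real.rpow_natCast, ← Real.rpow_mul (by positivity), mul_comm,
      Real.rpow_mul (by positivity), Real.rpow_natCast, pow_succ]
    ring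
  have hc : 1 + (p : ℝ) ^ (-e) / (1 - (p : ℝ) ^ (-e)) / p -
      ∑ i ∈ Finset.range 1, ((p ^ i : ℕ) : ℝ) ^ (-e) / rad (p ^ i) =
      (p : ℝ) ^ (-e) * (1 - (p : ℝ) ^ (-e))⁻¹ / p := by
    simp [rad]
    ring
  rw [hc]
  simp only [hf]
  exact h

lemma exists_sum_inv_rad_le {e : ℝ} (he : 0 < e) :
    ∃ C : ℝ, ∀ N : ℕ, ∑ n ∈ Finset.Icc 1 N, (1 / rad n : ℝ) ≤ C * (N : ℝ) ^ e := by
  set A : ℝ := 1 / (1 - (2 : ℝ) ^ (-e)) with hA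
  have h2 : (2 : ℝ) ^ (-e) < 1 := Real.rpow_lt_one_of_one_lt_of_neg (by norm_num) (by linarith)
  have hA0 : 0 < A := by rw [hA]; apply one_div_pos.2; linarith
  have hsum : Summable fun n : ℕ => A * (n : ℝ) ^ (-1 - e) :=
    (Real.summable_nat_rpow.2 (by linarith)).mul_left A
  refine ⟨Real.exp (∑' n : ℕ, A * (n : ℝ) ^ (-1 - e)), fun N => ?_⟩
  set f : ℕ → ℝ := fun n => (n : ℝ) ^ (-e) / rad n with hf
  have hf0 : ∀ n, 0 ≤ f n := fun n => by positivity
  have hE := EulerProduct.summable_and_hasSum_smoothNumbers_prod_primesBelow_tsum (f := f)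
    (by simp [hf, rad])
    (by
      intro m n hmn
      simp only [hf]
      rw [rad_mul_of_coprime hmn]
      push_cast
      rw [Real.mul_rpow (by positivity) (by positivity)]
      field_simp)
    (by
      intro p hp
      have := (hasSum_rpow_div_rad_prime_pow he hp).summable
      refine this.congr fun k => ?_
      rw [Real.norm_of_nonneg (hf0 _)]) (N + 1)
  have hfac : ∀ p ∈ (N + 1).primesBelow, ∑' k : ℕ, f (p ^ k) ≤
      Real.exp (A * (p : ℝ) ^ (-1 - e)) := by
    intro p hp
    have hpp := Nat.prime_of_mem_primesBelow hp
    rw [show ∑' k : ℕ, f (p ^ k) = _ from (hasSum_rpow_div_rad_prime_pow he hpp).tsum_eq]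
    refine le_trans ?_ (Real.add_one_le_exp _)
    have hp0 : (0 : ℝ) < p := by exact_mod_cast hpp.pos
    have hp2 : (2 : ℝ) ≤ p := by exact_mod_cast hpp.two_le
    have h3 : (p : ℝ) ^ (-e) ≤ (2 : ℝ) ^ (-e) :=
      Real.rpow_le_rpow_of_nonpos (by norm_num) hp2 (by linarith)
    rw [show (p : ℝ) ^ (-1 - e) = (p : ℝ) ^ (-e) / p by
      rw [show -1 - e = -e - 1 by ring, Real.rpow_sub_one hp0.ne']]
    have h4 : (p : ℝ) ^ (-e) / (1 - (p : ℝ) ^ (-e)) ≤ A * (p : ℝ) ^ (-e) := by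
      rw [hA, div_mul_eq_mul_div, one_mul]
      apply div_le_div_of_nonneg_left (by positivity) <;> linarith
    have h5 := div_le_div_of_nonneg_right h4 hp0.le
    rw [mul_div_assoc] at h5
    linarith
  have hprod : ∏ p ∈ (N + 1).primesBelow, ∑' k : ℕ, f (p ^ k) ≤
      Real.exp (∑' n : ℕ, A * (n : ℝ) ^ (-1 - e)) := by
    refine (Finset.prod_le_prod (fun p _ => tsum_nonneg fun k => hf0 _) hfac).trans ?_
    rw [← Real.exp_sum]
    exact Real.exp_le_exp.2 (hsum.sum_le_tsum _ fun n _ => by positivity)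
  have hfin : ∑ n ∈ Finset.Icc 1 N, f n ≤ ∏ p ∈ (N + 1).primesBelow, ∑' k : ℕ, f (p ^ k) := by
    have h := sum_le_hasSum ((Finset.Icc 1 N).subtype (· ∈ (N + 1).smoothNumbers))
      (fun i _ => hf0 i) hE.2
    refine le_trans (le_of_eq ?_) h
    rw [Finset.sum_subtype_of_mem f]
    intro n hn
    rw [Finset.mem_Icc] at hn
    exact Nat.mem_smoothNumbers_of_lt (by omega) (by omega)
  calc ∑ n ∈ Finset.Icc 1 N, (1 / rad n : ℝ)
      ≤ ∑ n ∈ Finset.Icc 1 N, f n * (N : ℝ) ^ e := by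
        refine Finset.sum_le_sum fun n hn => ?_
        rw [Finset.mem_Icc] at hn
        have hn0 : (0 : ℝ) < n := by exact_mod_cast (by omega : 0 < n)
        have hr : (0 : ℝ) < rad n := by exact_mod_cast rad_pos n
        simp only [hf]
        rw [div_mul_eq_mul_div]
        gcongr
        rw [Real.rpow_neg hn0.le, inv_mul_eq_div, one_le_div (by positivity)]
        gcongr
        exact_mod_cast hn.2
    _ ≤ _ := by
        rw [← Finset.sum_mul]
        gcongr
        exact hfin.trans hprod

lemma exists_card_divisors_le {e : ℝ} (he : 0 < e) :
    ∃ C : ℝ, ∀ n : ℕ, n ≠ 0 → (n.divisors.card : ℝ) ≤ C * (n : ℝ) ^ e := by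
  obtain ⟨B, hB⟩ := exists_nat_gt ((2 : ℝ) ^ (1 / e))
  set D : ℝ := 1 + 1 / (e * Real.log 2) with hD
  have hl : 0 < Real.log 2 := Real.log_pos (by norm_num)
  have hD1 : 1 ≤ D := by rw [hD]; linarith [show 0 < 1 / (e * Real.log 2) by positivity]
  refine ⟨D ^ B, fun n hn => ?_⟩
  have key : ∀ p ∈ n.primeFactors, ((n.factorization p : ℝ) + 1) ≤
      (if p < B then D else 1) * ((p : ℝ) ^ n.factorization p) ^ e := by
    intro p hp
    have hpp := Nat.prime_of_mem_primeFactors hp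
    have hp2 : (2 : ℝ) ≤ p := by exact_mod_cast hpp.two_le
    set v := n.factorization p
    split_ifs with hpB
    · have h1 : ((2 : ℝ) ^ v) ^ e ≤ ((p : ℝ) ^ v) ^ e := by gcongr
      have h2 : 1 + (v : ℝ) * e * Real.log 2 ≤ ((2 : ℝ) ^ v) ^ e := by
        rw [← Real.rpow_natCast, ← Real.rpow_mul (by norm_num), Real.rpow_def_of_pos (by norm_num)]
        have := Real.add_one_le_exp (Real.log 2 * (v * e))
        linarith
      calc (v : ℝ) + 1 ≤ D * (1 + (v : ℝ) * e * Real.log 2) := by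
            rw [hD]
            have : (1 + 1 / (e * Real.log 2)) * (1 + (v : ℝ) * e * Real.log 2) =
              1 + v * e * Real.log 2 + 1 / (e * Real.log 2) + v := by field_simp; ring
            rw [this]
            have : 0 ≤ (v : ℝ) * e * Real.log 2 + 1 / (e * Real.log 2) := by positivity
            linarith
        _ ≤ _ := by gcongr; exact h2.trans h1
    · have hpB' : (2 : ℝ) ^ (1 / e) ≤ p := hB.le.trans (by exact_mod_cast not_lt.1 hpB)
      have h1 : (2 : ℝ) ≤ (p : ℝ) ^ e := by
        calc (2 : ℝ) = ((2 : ℝ) ^ (1 / e)) ^ e := by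
              rw [← Real.rpow_mul (by norm_num), one_div_mul_cancel he.ne', Real.rpow_one]
          _ ≤ _ := by gcongr
      have h2 : ((p : ℝ) ^ v) ^ e = ((p : ℝ) ^ e) ^ v := by
        rw [← Real.rpow_natCast, ← Real.rpow_mul (by positivity), mul_comm,
          Real.rpow_mul (by positivity), Real.rpow_natCast]
      rw [one_mul, h2]
      calc (v : ℝ) + 1 ≤ 2 ^ v := by exact_mod_cast Nat.lt_two_pow_self
        _ ≤ _ := by gcongr
  have hne : (n : ℝ) ^ e = ∏ p ∈ n.primeFactors, ((p : ℝ) ^ n.factorization p) ^ e := by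
    rw [Real.finsetProd_rpow _ _ fun _ _ => by positivity]
    congr 1
    conv_lhs => rw [← Nat.prod_factorization_pow_eq_self hn]
    rw [Finsupp.prod, Nat.support_factorization]
    push_cast
    rfl
  have hDB : ∏ p ∈ n.primeFactors, (if p < B then D else 1) ≤ D ^ B := by
    rw [← Finset.prod_filter, Finset.prod_const]
    refine pow_le_pow_right₀ hD1 ?_
    calc _ ≤ (Finset.range B).card := Finset.card_le_card fun p hp => by
            simp at hp ⊢; exact hp.2
      _ = B := Finset.card_range B
  rw [Nat.card_divisors hn, hne]
  push_cast
  calc _ ≤ ∏ p ∈ n.primeFactors, (if p < B then D else 1) * ((p : ℝ) ^ n.factorization p) ^ e :=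
        Finset.prod_le_prod (fun _ _ => by positivity) key
    _ ≤ _ := by
        rw [Finset.prod_mul_distrib]
        gcongr

lemma sum_comp_le_mul_sum {ι κ : Type*} [DecidableEq κ] (F : Finset ι) (T : Finset κ)
    (φ : ι → κ) (g : κ → ℝ) (K : ℝ) (hg : ∀ j ∈ T, 0 ≤ g j) (hφ : ∀ t ∈ F, φ t ∈ T)
    (hK : ∀ j ∈ T, ((F.filter fun t => φ t = j).card : ℝ) ≤ K) :
    ∑ t ∈ F, g (φ t) ≤ K * ∑ j ∈ T, g j := by
  rw [← Finset.sum_fiberwise_of_maps_to hφ, Finset.mul_sum]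
  refine Finset.sum_le_sum fun j hj => ?_
  rw [Finset.sum_congr rfl (g := fun _ => g j) fun t ht => by rw [(Finset.mem_filter.1 ht).2],
    Finset.sum_const, nsmul_eq_mul]
  exact mul_le_mul_of_nonneg_right (hK j hj) (hg j hj)

lemma sum_comp_le_sum_of_injOn {ι κ : Type*} [DecidableEq κ] (F : Finset ι) (T : Finset κ)
    (φ : ι → κ) (g : κ → ℝ) (hg : ∀ j ∈ T, 0 ≤ g j) (hφ : ∀ t ∈ F, φ t ∈ T)
    (hinj : ∀ t ∈ F, ∀ t' ∈ F, φ t = φ t' → t = t') :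
    ∑ t ∈ F, g (φ t) ≤ ∑ j ∈ T, g j := by
  rw [← one_mul (∑ j ∈ T, g j)]
  refine sum_comp_le_mul_sum F T φ g 1 hg hφ fun j _ => ?_
  have : (F.filter fun t => φ t = j).card ≤ 1 := by
    refine Finset.card_le_one.2 fun t ht t' ht' => ?_
    rw [Finset.mem_filter] at ht ht'
    exact hinj t ht.1 t' ht'.1 (ht.2.trans ht'.2.symm)
  exact_mod_cast this

lemma sum_inv_rad_nonneg (N : ℕ) : 0 ≤ ∑ n ∈ Finset.Icc 1 N, (1 / rad n : ℝ) :=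
  Finset.sum_nonneg fun _ _ => by positivity

lemma sum_prod_inv_rad_le {N : ℕ} {H : ℝ} (hH : ∑ n ∈ Finset.Icc 1 N, (1 / rad n : ℝ) ≤ H) :
    ∑ j ∈ Finset.Icc 1 N ×ˢ Finset.Icc 1 N, (1 / rad j.1 : ℝ) * (1 / rad j.2 : ℝ) ≤ H ^ 2 := by
  rw [Finset.sum_product]
  dsimp only
  rw [← Finset.sum_mul_sum, ← sq]
  exact pow_le_pow_left₀ (sum_inv_rad_nonneg N) hH 2

lemma sum_prod_prod_inv_rad_le {N : ℕ} {H : ℝ}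
    (hH : ∑ n ∈ Finset.Icc 1 N, (1 / rad n : ℝ) ≤ H) :
    ∑ j ∈ Finset.Icc 1 N ×ˢ Finset.Icc 1 N ×ˢ Finset.Icc 1 N,
      (1 / rad j.1 : ℝ) * ((1 / rad j.2.1 : ℝ) * (1 / rad j.2.2 : ℝ)) ≤ H ^ 3 := by
  rw [Finset.sum_product]
  dsimp only
  rw [← Finset.sum_mul_sum, pow_succ']
  have h0 := sum_inv_rad_nonneg N
  exact mul_le_mul hH (sum_prod_inv_rad_le hH) (Finset.sum_nonneg fun _ _ => by positivity)
    (h0.trans hH)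

lemma card_le_of_rad_mul_rad_le {ι : Type*} (F : Finset ι) (f g : ι → ℕ) (N : ℕ) (M H : ℝ)
    (hM0 : 0 ≤ M) (hf : ∀ t ∈ F, f t ∈ Finset.Icc 1 N) (hg : ∀ t ∈ F, g t ∈ Finset.Icc 1 N)
    (hinj : ∀ t ∈ F, ∀ t' ∈ F, f t = f t' → g t = g t' → t = t')
    (hM : ∀ t ∈ F, (rad (f t) * rad (g t) : ℝ) ≤ M)
    (hH : ∑ n ∈ Finset.Icc 1 N, (1 / rad n : ℝ) ≤ H) :
    (F.card : ℝ) ≤ M * H ^ 2 := by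
  calc (F.card : ℝ) = ∑ t ∈ F, (1 : ℝ) := by simp
    _ ≤ ∑ t ∈ F, M * ((1 / rad (f t) : ℝ) * (1 / rad (g t) : ℝ)) := by
        refine Finset.sum_le_sum fun t ht => ?_
        have h1 := one_le_rad (f t)
        have h2 := one_le_rad (g t)
        rw [one_div_mul_one_div, mul_one_div, one_le_div (by positivity)]
        exact hM t ht
    _ = M * ∑ t ∈ F, (1 / rad (f t) : ℝ) * (1 / rad (g t) : ℝ) := by rw [Finset.mul_sum]
    _ ≤ M * H ^ 2 := by
        refine mul_le_mul_of_nonneg_left (le_trans ?_ (sum_prod_inv_rad_le hH)) hM0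
        refine sum_comp_le_sum_of_injOn F _ (fun t => (f t, g t))
          (fun j => (1 / rad j.1 : ℝ) * (1 / rad j.2 : ℝ)) (fun _ _ => by positivity)
          (fun t ht => Finset.mk_mem_product (hf t ht) (hg t ht)) fun t ht t' ht' h => ?_
        rw [Prod.mk.injEq] at h
        exact hinj t ht t' ht' h.1 h.2

/-- Coprime points of a box in a planar lattice of determinant `w`, counted by the size of their
second coordinate and by their slope. -/
lemma card_le_of_mul_le_mul {ι : Type*} (F : Finset ι) (P Q : ι → ℕ) (w N : ℕ) (K : ℝ)
    (hw : 0 < w) (hK : 1 ≤ K) (hP : ∀ t ∈ F, 0 < P t) (hQ : ∀ t ∈ F, Q t ∈ Finset.Icc 1 N)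
    (hPQ : ∀ t ∈ F, (P t).Coprime (Q t))
    (hdvd : ∀ t ∈ F, ∀ t' ∈ F, (w : ℤ) ∣ (P t : ℤ) * Q t' - P t' * Q t)
    (hle : ∀ t ∈ F, (P t * Q t : ℝ) ≤ K * w)
    (hinj : ∀ t ∈ F, ∀ t' ∈ F, P t = P t' → Q t = Q t' → t = t') :
    (F.card : ℝ) ≤ 5 * K * (Nat.log 2 N + 1) := by
  set φ : ι → ℕ × ℕ := fun t =>
    (Nat.log 2 (Q t), ⌊(P t * 4 ^ (Nat.log 2 (Q t) + 1) / (Q t * w) : ℝ)⌋₊) with hφ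
  have hw' : (0 : ℝ) < w := by exact_mod_cast hw
  have hmaps : ∀ t ∈ F, φ t ∈ Finset.range (Nat.log 2 N + 1) ×ˢ Finset.range (⌊4 * K⌋₊ + 1) := by
    intro t ht
    have hq := Finset.mem_Icc.1 (hQ t ht)
    have hq0 : (0 : ℝ) < Q t := by exact_mod_cast hq.1
    have h2 : (2 : ℝ) ^ Nat.log 2 (Q t) ≤ Q t := by
      exact_mod_cast Nat.pow_log_le_self 2 (by omega)
    simp only [hφ, Finset.mem_product, Finset.mem_range, Nat.lt_succ_iff]
    refine ⟨Nat.log_mono_right hq.2, Nat.floor_le_floor ?_⟩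
    rw [div_le_iff₀ (by positivity)]
    have h4 : (4 : ℝ) ^ (Nat.log 2 (Q t) + 1) = 4 * (2 ^ Nat.log 2 (Q t)) ^ 2 := by
      rw [← pow_mul, mul_comm _ 2, pow_mul, pow_succ]; norm_num; ring
    rw [h4]
    have h5 : ((2 : ℝ) ^ Nat.log 2 (Q t)) ^ 2 ≤ (Q t : ℝ) ^ 2 := by gcongr
    calc (P t : ℝ) * (4 * (2 ^ Nat.log 2 (Q t)) ^ 2) ≤ P t * (4 * (Q t : ℝ) ^ 2) := by gcongr
      _ = (4 * (P t * Q t) * Q t : ℝ) := by ring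
      _ ≤ 4 * (K * w) * Q t :=
        mul_le_mul_of_nonneg_right (mul_le_mul_of_nonneg_left (hle t ht) (by norm_num)) hq0.le
      _ = _ := by ring
  have hφinj : Set.InjOn φ F := by
    intro t ht t' ht' h
    have ht : t ∈ F := ht
    have ht' : t' ∈ F := ht'
    simp only [hφ, Prod.mk.injEq] at h
    obtain ⟨hi, hfl⟩ := h
    rw [← hi] at hfl
    set i := Nat.log 2 (Q t)
    have hq := (Finset.mem_Icc.1 (hQ t ht)).1
    have hq' := (Finset.mem_Icc.1 (hQ t' ht')).1
    have hq0 : (0 : ℝ) < Q t := by exact_mod_cast hq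
    have hq0' : (0 : ℝ) < Q t' := by exact_mod_cast hq'
    have hlt : (Q t : ℝ) < 2 ^ (i + 1) := by exact_mod_cast Nat.lt_pow_succ_log_self (by norm_num) _
    have hlt' : (Q t' : ℝ) < 2 ^ (i + 1) := by
      rw [hi]; exact_mod_cast Nat.lt_pow_succ_log_self (by norm_num) _
    have hQQ : (Q t * Q t' : ℝ) < 4 ^ (i + 1) := by
      calc (Q t * Q t' : ℝ) < 2 ^ (i + 1) * 2 ^ (i + 1) := by gcongr
        _ = 4 ^ (i + 1) := by rw [← mul_pow]; norm_num
    have habs : |(P t * 4 ^ (i + 1) / (Q t * w) : ℝ) - P t' * 4 ^ (i + 1) / (Q t' * w)| < 1 := by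
      have a1 := Nat.floor_le (show (0 : ℝ) ≤ P t * 4 ^ (i + 1) / (Q t * w) by positivity)
      have a2 := Nat.lt_floor_add_one (P t * 4 ^ (i + 1) / (Q t * w) : ℝ)
      have b1 := Nat.floor_le (show (0 : ℝ) ≤ P t' * 4 ^ (i + 1) / (Q t' * w) by positivity)
      have b2 := Nat.lt_floor_add_one (P t' * 4 ^ (i + 1) / (Q t' * w) : ℝ)
      rw [hfl] at a1 a2
      rw [abs_lt]
      constructor <;> linarith
    have heq : (P t * 4 ^ (i + 1) / (Q t * w) : ℝ) - P t' * 4 ^ (i + 1) / (Q t' * w) =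
        (P t * Q t' - P t' * Q t) * (4 ^ (i + 1) / (Q t * Q t' * w)) := by field_simp
    rw [heq, abs_mul, abs_of_pos (show (0 : ℝ) < 4 ^ (i + 1) / (Q t * Q t' * w) by positivity),
      mul_div_assoc', div_lt_one (by positivity)] at habs
    have hzero : (P t : ℤ) * Q t' - P t' * Q t = 0 := by
      refine Int.eq_zero_of_abs_lt_dvd (hdvd t ht t' ht') ?_
      have : |(P t : ℝ) * Q t' - P t' * Q t| < w := by
        by_contra! hcon
        have : (w : ℝ) * 4 ^ (i + 1) ≤ |(P t : ℝ) * Q t' - P t' * Q t| * 4 ^ (i + 1) := by gcongr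
        have : (Q t * Q t' : ℝ) * w < 4 ^ (i + 1) * w := by gcongr
        linarith
      exact_mod_cast this
    have hmul : P t * Q t' = P t' * Q t := by
      have := sub_eq_zero.1 hzero
      exact_mod_cast this
    have hPP : P t = P t' := by
      apply Nat.dvd_antisymm
      · exact (hPQ t ht).dvd_of_dvd_mul_right (hmul ▸ dvd_mul_right _ _)
      · exact (hPQ t' ht').dvd_of_dvd_mul_right (hmul ▸ dvd_mul_right _ _)
    refine hinj t ht t' ht' hPP ?_
    rw [hPP] at hmul
    exact (Nat.eq_of_mul_eq_mul_left (hP t' ht') hmul).symm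
  have hcard := Finset.card_le_card_of_injOn φ hmaps hφinj
  rw [Finset.card_product, Finset.card_range, Finset.card_range] at hcard
  calc (F.card : ℝ) ≤ ((Nat.log 2 N + 1) * (⌊4 * K⌋₊ + 1) : ℕ) := by exact_mod_cast hcard
    _ = (Nat.log 2 N + 1) * (⌊4 * K⌋₊ + 1) := by push_cast; ring
    _ ≤ (Nat.log 2 N + 1) * (4 * K + K) := by
        gcongr
        exact Nat.floor_le (by linarith)
    _ = _ := by ring

lemma card_le_of_linear_eq {ι : Type*} (F : Finset ι) (u v w P Q R : ι → ℕ) (N : ℕ) (M H : ℝ)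
    (hM0 : 0 ≤ M) (hu : ∀ t ∈ F, u t ∈ Finset.Icc 1 N) (hv : ∀ t ∈ F, v t ∈ Finset.Icc 1 N)
    (hw : ∀ t ∈ F, w t ∈ Finset.Icc 1 N) (hP : ∀ t ∈ F, 0 < P t)
    (hQ : ∀ t ∈ F, Q t ∈ Finset.Icc 1 N)
    (heq : ∀ t ∈ F, u t * P t + v t * Q t = w t * R t)
    (huw : ∀ t ∈ F, (u t).Coprime (w t)) (hPQ : ∀ t ∈ F, (P t).Coprime (Q t))
    (hinj : ∀ t ∈ F, ∀ t' ∈ F, u t = u t' → v t = v t' → w t = w t' → P t = P t' → Q t = Q t' →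
      t = t')
    (hM : ∀ t ∈ F, (rad (u t) * (rad (v t) * rad (w t)) : ℝ) ≤ M)
    (hM' : ∀ t ∈ F, (rad (u t) * (rad (v t) * rad (w t)) * (P t * Q t) : ℝ) ≤ M * w t)
    (hH : ∑ n ∈ Finset.Icc 1 N, (1 / rad n : ℝ) ≤ H) (hlog : (Nat.log 2 N + 1 : ℝ) ≤ H) :
    (F.card : ℝ) ≤ 5 * M * H ^ 4 := by
  classical
  set T := Finset.Icc 1 N ×ˢ Finset.Icc 1 N ×ˢ Finset.Icc 1 N
  have hmaps : ∀ t ∈ F, (u t, v t, w t) ∈ T := fun t ht =>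
    Finset.mk_mem_product (hu t ht) (Finset.mk_mem_product (hv t ht) (hw t ht))
  have hfib : ∀ j ∈ T, ((F.filter fun t => (u t, v t, w t) = j).card : ℝ) ≤
      5 * M * H * ((1 / rad j.1 : ℝ) * ((1 / rad j.2.1 : ℝ) * (1 / rad j.2.2 : ℝ))) := by
    rintro ⟨u₀, v₀, w₀⟩ hj
    have hH0 : 0 ≤ H := (sum_inv_rad_nonneg N).trans hH
    rcases (F.filter fun t => (u t, v t, w t) = (u₀, v₀, w₀)).eq_empty_or_nonempty with h0 | ⟨s, hs⟩
    · rw [h0]; simp; positivity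
    have h1 := one_le_rad u₀
    have h2 := one_le_rad v₀
    have h3 := one_le_rad w₀
    set G := F.filter fun t => (u t, v t, w t) = (u₀, v₀, w₀)
    have hG : ∀ t ∈ G, t ∈ F ∧ u t = u₀ ∧ v t = v₀ ∧ w t = w₀ := by
      intro t ht
      simpa [G] using ht
    have hr : (0 : ℝ) < rad u₀ * (rad v₀ * rad w₀) := by positivity
    have hw₀ : 0 < w₀ := by
      simp only [T, Finset.mem_product, Finset.mem_Icc] at hj
      omega
    have hK1 : 1 ≤ M / (rad u₀ * (rad v₀ * rad w₀)) := by
      rw [one_le_div hr]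
      obtain ⟨hF, hu', hv', hw'⟩ := hG s hs
      have := hM s hF
      rwa [hu', hv', hw'] at this
    have := card_le_of_mul_le_mul G P Q w₀ N (M / (rad u₀ * (rad v₀ * rad w₀))) hw₀ hK1
      (fun t ht => hP t (hG t ht).1) (fun t ht => hQ t (hG t ht).1)
      (fun t ht => hPQ t (hG t ht).1)
      (by
        intro t ht t' ht'
        obtain ⟨hF, hu1, hv1, hw1⟩ := hG t ht
        obtain ⟨hF', hu2, hv2, hw2⟩ := hG t' ht'
        have e1 := heq t hF
        have e2 := heq t' hF'
        have hc := huw t hF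
        rw [hu1, hw1] at hc
        rw [hu1, hv1, hw1] at e1
        rw [hu2, hv2, hw2] at e2
        zify at e1 e2
        have hc' : IsCoprime (w₀ : ℤ) (u₀ : ℤ) := (Nat.isCoprime_iff_coprime.2 hc).symm
        refine hc'.dvd_of_dvd_mul_left ⟨R t * Q t' - R t' * Q t, ?_⟩
        linear_combination (Q t' : ℤ) * e1 - (Q t : ℤ) * e2)
      (by
        intro t ht
        obtain ⟨hF, hu1, hv1, hw1⟩ := hG t ht
        have := hM' t hF
        rw [hu1, hv1, hw1] at this
        rw [div_mul_eq_mul_div, le_div_iff₀ hr]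
        linarith)
      (by
        intro t ht t' ht' hp hq
        obtain ⟨hF, hu1, hv1, hw1⟩ := hG t ht
        obtain ⟨hF', hu2, hv2, hw2⟩ := hG t' ht'
        exact hinj t hF t' hF' (hu1.trans hu2.symm) (hv1.trans hv2.symm) (hw1.trans hw2.symm) hp hq)
    calc (G.card : ℝ) ≤ _ := this
      _ ≤ 5 * (M / (rad u₀ * (rad v₀ * rad w₀))) * H := by gcongr
      _ = _ := by field_simp
  calc (F.card : ℝ) = ∑ j ∈ T, ((F.filter fun t => (u t, v t, w t) = j).card : ℝ) := by
        exact_mod_cast Finset.card_eq_sum_card_fiberwise (f := fun t => (u t, v t, w t)) hmaps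
    _ ≤ ∑ j ∈ T, 5 * M * H * ((1 / rad j.1 : ℝ) * ((1 / rad j.2.1 : ℝ) * (1 / rad j.2.2 : ℝ))) :=
        Finset.sum_le_sum hfib
    _ ≤ 5 * M * H * H ^ 3 := by
        rw [← Finset.mul_sum]
        have hH0 : 0 ≤ H := (sum_inv_rad_nonneg N).trans hH
        exact mul_le_mul_of_nonneg_left (sum_prod_prod_inv_rad_le hH) (by positivity)
    _ = _ := by ring

lemma add_pow_sub_pow_le {x y d : ℤ} (hx : 0 ≤ x) (hxy : x ≤ y) (hd : 0 ≤ d) (k : ℕ) :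
    (x + d) ^ k - x ^ k ≤ (y + d) ^ k - y ^ k := by
  induction k with
  | zero => simp
  | succ k ih =>
    have e : ∀ z : ℤ, (z + d) ^ (k + 1) - z ^ (k + 1) =
        (z + d) * ((z + d) ^ k - z ^ k) + d * z ^ k := fun z => by ring
    have h0 : 0 ≤ (x + d) ^ k - x ^ k := sub_nonneg.2 (by gcongr; linarith)
    rw [e, e]
    gcongr
    linarith

lemma add_pow_sub_pow_lt {x y d : ℤ} (hx : 0 ≤ x) (hxy : x < y) (hd : 0 < d) {k : ℕ}
    (hk : 2 ≤ k) : (x + d) ^ k - x ^ k < (y + d) ^ k - y ^ k := by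
  obtain ⟨k, rfl⟩ := Nat.exists_eq_add_of_le' hk
  have e : ∀ z : ℤ, (z + d) ^ (k + 2) - z ^ (k + 2) =
      (z + d) * ((z + d) ^ (k + 1) - z ^ (k + 1)) + d * z ^ (k + 1) := fun z => by ring
  have h0 : 0 < (x + d) ^ (k + 1) - x ^ (k + 1) :=
    sub_pos.2 (pow_lt_pow_left₀ (by linarith) hx (by omega))
  have h1 := add_pow_sub_pow_le hx hxy.le hd.le (k + 1)
  have h2 : d * x ^ (k + 1) ≤ d * y ^ (k + 1) := by gcongr
  rw [e, e]
  nlinarith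

/-- A pair of naturals is determined by its difference and the difference of its `k`-th powers. -/
lemma eq_of_pow_sub_pow_eq {a b c d : ℕ} {k : ℕ} (hk : 2 ≤ k) (hab : a < b)
    (h : (b : ℤ) - a = d - c) (hpow : (b : ℤ) ^ k - a ^ k = d ^ k - c ^ k) : a = c := by
  have hb : (b : ℤ) = a + (b - a) := by ring
  have hd : (d : ℤ) = c + (b - a) := by rw [h]; ring
  have hpos : (0 : ℤ) < b - a := by omega
  rw [hd, hb] at hpow
  simp only [add_sub_cancel_left] at hpow
  rcases lt_trichotomy a c with hac | hac | hac
  · exact absurd hpow (add_pow_sub_pow_lt (by positivity) (by exact_mod_cast hac) hpos hk).ne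
  · exact hac
  · exact absurd hpow (add_pow_sub_pow_lt (by positivity) (by exact_mod_cast hac) hpos hk).ne'

lemma card_pow_sub_pow_le {ι : Type*} (E : Finset ι) (u x y : ι → ℕ) (k D : ℕ) (hk : 2 ≤ k)
    (hD : D ≠ 0) (heq : ∀ t ∈ E, ((u t : ℤ) * ((x t : ℤ) ^ k - (y t : ℤ) ^ k)).natAbs = D)
    (hinj : ∀ t ∈ E, ∀ t' ∈ E, u t = u t' → x t = x t' → y t = y t' → t = t') :
    E.card ≤ 2 * D.divisors.card ^ 2 := by
  have hmaps : ∀ t ∈ E, (u t, ((x t : ℤ) - y t).natAbs, decide (x t < y t)) ∈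
      D.divisors ×ˢ D.divisors ×ˢ (Finset.univ : Finset Bool) := by
    intro t ht
    simp only [Finset.mem_product, Nat.mem_divisors, Finset.mem_univ, and_true]
    rw [← heq t ht, Int.natAbs_mul, Int.natAbs_natCast]
    refine ⟨⟨dvd_mul_right _ _, ?_⟩, (Int.natAbs_dvd_natAbs.2 (sub_dvd_pow_sub_pow _ _ k)).mul_left _,
      ?_⟩ <;> rw [← Int.natAbs_natCast (u t), ← Int.natAbs_mul, heq t ht] <;> exact hD
  have hcard := Finset.card_le_card_of_injOn _ hmaps ?_
  · simp only [Finset.card_product, Finset.card_univ, Fintype.card_bool] at hcard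
    linarith
  intro t ht t' ht' h
  simp only [Prod.mk.injEq, decide_eq_decide] at h
  obtain ⟨hu, hd, hs⟩ := h
  have e := heq t ht
  have e' := heq t' ht'
  have hu0 : u t ≠ 0 := by
    rintro h0
    rw [h0] at e
    simp at e
    omega
  rw [hu] at e hu0
  have hp : ((x t : ℤ) ^ k - (y t : ℤ) ^ k).natAbs = ((x t' : ℤ) ^ k - (y t' : ℤ) ^ k).natAbs := by
    have := e.trans e'.symm
    rw [Int.natAbs_mul, Int.natAbs_mul] at this
    exact Nat.eq_of_mul_eq_mul_left (by simpa using Nat.pos_of_ne_zero hu0) this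
  have hne : ∀ s ∈ E, x s ≠ y s := by
    intro s hs hxy
    have := heq s hs
    rw [hxy] at this
    simp at this
    omega
  have hxt := hne t ht
  have hxt' := hne t' ht'
  have hle : ∀ {a b : ℕ}, a < b → (a : ℤ) ^ k ≤ (b : ℤ) ^ k := fun h => by gcongr
  by_cases hlt : x t < y t
  · have hlt' := hs.1 hlt
    have h1 := hle hlt
    have h2 := hle hlt'
    have hdd : (y t : ℤ) - x t = y t' - x t' := by omega
    have hx := eq_of_pow_sub_pow_eq hk hlt hdd (by omega)
    exact hinj t ht t' ht' hu hx (by omega)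
  · have hlt' : ¬ x t' < y t' := fun h => hlt (hs.2 h)
    have hgt : y t < x t := by omega
    have hgt' : y t' < x t' := by omega
    have h1 := hle hgt
    have h2 := hle hgt'
    have hdd : (x t : ℤ) - y t = x t' - y t' := by omega
    have hy := eq_of_pow_sub_pow_eq hk hgt hdd (by omega)
    exact hinj t ht t' ht' hu (by omega) hy

set_option maxHeartbeats 1000000 in
lemma card_le_of_pow_eq {ι : Type*} (F : Finset ι) (u x m n : ι → ℕ) (k N : ℕ) (M H : ℝ)
    (hk : 2 ≤ k) (hM0 : 0 ≤ M) (hH1 : 1 ≤ H)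
    (hu : ∀ t ∈ F, u t ∈ Finset.Icc 1 N) (hx : ∀ t ∈ F, x t ∈ Finset.Icc 1 N)
    (hm : ∀ t ∈ F, m t ∈ Finset.Icc 1 N) (hn : ∀ t ∈ F, n t ∈ Finset.Icc 1 N)
    (heq : ∀ t ∈ F, ∀ t' ∈ F, u t = u t' → m t = m t' →
      ((u t : ℤ) * ((x t : ℤ) ^ k - (x t' : ℤ) ^ k)).natAbs = ((n t : ℤ) - n t').natAbs)
    (hinj : ∀ t ∈ F, ∀ t' ∈ F, u t = u t' → x t = x t' → n t = n t' → t = t')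
    (hM : ∀ t ∈ F, (rad (u t) ^ 2 * rad (m t) * x t * rad (n t) : ℝ) ≤ M ^ 2)
    (hM' : ∀ t ∈ F, (rad (u t) * rad (m t) * rad (n t) ^ 2 : ℝ) ≤ M ^ 2)
    (hH : ∑ n ∈ Finset.Icc 1 N, (1 / rad n : ℝ) ≤ H)
    (hdiv : ∀ d ∈ Finset.Icc 1 N, (d.divisors.card : ℝ) ≤ H) :
    (F.card : ℝ) ≤ 2 * M * H ^ 4 := by
  classical
  set T := Finset.Icc 1 N ×ˢ Finset.Icc 1 N
  set q : ι → ℕ × ℕ := fun t => (u t, m t) with hq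
  have hqT : ∀ t ∈ F, q t ∈ T := fun t ht => Finset.mk_mem_product (hu t ht) (hm t ht)
  set wt : ℕ × ℕ → ℝ := fun j => rad j.1 * rad j.2 with hwt
  have hwt0 : ∀ j, 0 < wt j := fun j => by
    have h1 := one_le_rad j.1
    have h2 := one_le_rad j.2
    simp only [hwt]; positivity
  set E := (F ×ˢ F).filter fun p => q p.1 = q p.2 with hE
  have hEmem : ∀ p ∈ E, p.1 ∈ F ∧ p.2 ∈ F ∧ u p.1 = u p.2 ∧ m p.1 = m p.2 := by
    intro p hp
    simp only [hE, Finset.mem_filter, Finset.mem_product, hq, Prod.mk.injEq] at hp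
    tauto
  have hcs : (F.card : ℝ) ^ 2 ≤ H ^ 2 * ∑ p ∈ E, wt (q p.1) := by
    set c : ℕ × ℕ → ℝ := fun j => ((F.filter fun t => q t = j).card : ℝ) with hc
    have h1 : (F.card : ℝ) = ∑ j ∈ T, c j := by
      simp only [hc]
      exact_mod_cast Finset.card_eq_sum_card_fiberwise (f := q) hqT
    have h2 : ∑ p ∈ E, wt (q p.1) = ∑ j ∈ T, wt j * c j ^ 2 := by
      rw [← Finset.sum_fiberwise_of_maps_to (s := E) (t := T) (g := fun p => q p.1)
        fun p hp => hqT _ (hEmem p hp).1]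
      refine Finset.sum_congr rfl fun j _ => ?_
      have : (E.filter fun p => q p.1 = j) =
          (F.filter fun t => q t = j) ×ˢ (F.filter fun t => q t = j) := by
        ext p
        simp only [hE, Finset.mem_filter, Finset.mem_product]
        constructor
        · rintro ⟨⟨⟨a, b⟩, e⟩, rfl⟩
          exact ⟨⟨a, rfl⟩, b, e.symm⟩
        · rintro ⟨⟨a, rfl⟩, b, e⟩
          exact ⟨⟨⟨a, b⟩, e.symm⟩, rfl⟩
      rw [Finset.sum_congr rfl (g := fun _ => wt j) fun p hp => by
        rw [(Finset.mem_filter.1 hp).2], Finset.sum_const, nsmul_eq_mul, this, Finset.card_product]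
      push_cast
      ring
    rw [h1, h2]
    calc (∑ j ∈ T, c j) ^ 2 ≤ (∑ j ∈ T, (1 / rad j.1 : ℝ) * (1 / rad j.2 : ℝ)) *
          ∑ j ∈ T, wt j * c j ^ 2 := by
          refine Finset.sum_sq_le_sum_mul_sum_of_sq_le_mul _ (fun j _ => by positivity)
            (fun j _ => mul_nonneg (hwt0 j).le (sq_nonneg _)) fun j _ => le_of_eq ?_
          have h1 := one_le_rad j.1
          have h2 := one_le_rad j.2
          simp only [hwt]
          field_simp
      _ ≤ _ := by
          refine mul_le_mul_of_nonneg_right (sum_prod_inv_rad_le hH) ?_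
          exact Finset.sum_nonneg fun j _ => mul_nonneg (hwt0 j).le (sq_nonneg _)
  have hdiag : ∑ p ∈ E.filter (fun p => p.1 = p.2), wt (q p.1) ≤ M ^ 2 * H ^ 3 := by
    calc _ ≤ ∑ p ∈ E.filter (fun p => p.1 = p.2), M ^ 2 *
          ((1 / rad (u p.1) : ℝ) * ((1 / rad (x p.1) : ℝ) * (1 / rad (n p.1) : ℝ))) := by
          refine Finset.sum_le_sum fun p hp => ?_
          have hp1 := (hEmem p (Finset.mem_filter.1 hp).1).1
          have h1 := one_le_rad (u p.1)
          have h2 := one_le_rad (x p.1)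
          have h3 := one_le_rad (n p.1)
          have h4 := one_le_rad (m p.1)
          have h5 : (rad (x p.1) : ℝ) ≤ x p.1 := by
            have := (Finset.mem_Icc.1 (hx _ hp1)).1
            exact_mod_cast rad_le_self (by omega)
          rw [one_div_mul_one_div, one_div_mul_one_div, mul_one_div, le_div_iff₀ (by positivity)]
          calc wt (q p.1) * (rad (u p.1) * (rad (x p.1) * rad (n p.1)))
              = rad (u p.1) ^ 2 * rad (m p.1) * rad (x p.1) * rad (n p.1) := by
                simp only [hwt, hq]; ring
            _ ≤ rad (u p.1) ^ 2 * rad (m p.1) * x p.1 * rad (n p.1) := by gcongr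
            _ ≤ M ^ 2 := hM _ hp1
      _ ≤ M ^ 2 * H ^ 3 := by
          rw [← Finset.mul_sum]
          refine mul_le_mul_of_nonneg_left (le_trans ?_ (sum_prod_prod_inv_rad_le hH))
            (sq_nonneg M)
          refine sum_comp_le_sum_of_injOn _ _ (fun p : ι × ι => (u p.1, x p.1, n p.1))
            (fun j => (1 / rad j.1 : ℝ) * ((1 / rad j.2.1 : ℝ) * (1 / rad j.2.2 : ℝ)))
            (fun _ _ => by positivity) (fun p hp => ?_) fun p hp p' hp' h => ?_
          · have hp1 := (hEmem p (Finset.mem_filter.1 hp).1).1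
            exact Finset.mk_mem_product (hu _ hp1) (Finset.mk_mem_product (hx _ hp1) (hn _ hp1))
          · rw [Finset.mem_filter] at hp hp'
            simp only [Prod.mk.injEq] at h
            have := hinj _ (hEmem p hp.1).1 _ (hEmem p' hp'.1).1 h.1 h.2.1 h.2.2
            exact Prod.ext this (hp.2.symm.trans (this.trans hp'.2))
  have hnn : ∀ p ∈ E, p.1 ≠ p.2 → n p.1 ≠ n p.2 := by
    intro p hp hne hnn
    obtain ⟨h1, h2, h3, h4⟩ := hEmem p hp
    have := heq _ h1 _ h2 h3 h4
    have hu0 := (Finset.mem_Icc.1 (hu _ h1)).1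
    rw [hnn, sub_self, Int.natAbs_zero, Int.natAbs_eq_zero, mul_eq_zero, sub_eq_zero] at this
    have hpow : x p.1 ^ k = x p.2 ^ k := by
      rcases this with h | h
      · omega
      · exact_mod_cast h
    exact hne (hinj _ h1 _ h2 h3 (Nat.pow_left_injective (by omega) hpow) hnn)
  have hoff : ∑ p ∈ E.filter (fun p => ¬ p.1 = p.2), wt (q p.1) ≤ 2 * H ^ 2 * (M ^ 2 * H ^ 2) := by
    set E' := E.filter (fun p => ¬ p.1 = p.2) with hE'
    calc _ ≤ ∑ p ∈ E', M ^ 2 * ((1 / rad (n p.1) : ℝ) * (1 / rad (n p.2) : ℝ)) := by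
          refine Finset.sum_le_sum fun p hp => ?_
          obtain ⟨h1, h2, h3, h4⟩ := hEmem p (Finset.mem_filter.1 hp).1
          have a1 := one_le_rad (n p.1)
          have a2 := one_le_rad (n p.2)
          have b1 := hM' _ h1
          have b2 := hM' _ h2
          rw [← h3, ← h4] at b2
          rw [one_div_mul_one_div, mul_one_div, le_div_iff₀ (by positivity)]
          have hw := hwt0 (q p.1)
          simp only [hwt, hq] at hw ⊢
          nlinarith [mul_nonneg hw.le (sq_nonneg ((rad (n p.1) : ℝ) - rad (n p.2)))]
      _ = M ^ 2 * ∑ p ∈ E', (1 / rad (n p.1) : ℝ) * (1 / rad (n p.2) : ℝ) := by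
          rw [Finset.mul_sum]
      _ ≤ M ^ 2 * (2 * H ^ 2 * ∑ j ∈ T, (1 / rad j.1 : ℝ) * (1 / rad j.2 : ℝ)) := by
          refine mul_le_mul_of_nonneg_left ?_ (sq_nonneg M)
          refine sum_comp_le_mul_sum E' T (fun p => (n p.1, n p.2))
            (fun j => (1 / rad j.1 : ℝ) * (1 / rad j.2 : ℝ)) _ (fun _ _ => by positivity)
            (fun p hp => ?_) fun j hj => ?_
          · obtain ⟨h1, h2, -⟩ := hEmem p (Finset.mem_filter.1 hp).1
            exact Finset.mk_mem_product (hn _ h1) (hn _ h2)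
          · rcases eq_or_ne j.1 j.2 with hjj | hjj
            · rw [Finset.filter_false_of_mem, Finset.card_empty]
              · push_cast; positivity
              · rintro p hp rfl
                rw [Finset.mem_filter] at hp
                exact hnn p hp.1 hp.2 hjj
            set D := ((j.1 : ℤ) - j.2).natAbs with hD
            have hD0 : D ≠ 0 := by omega
            have hDN : D ∈ Finset.Icc 1 N := by
              simp only [T, Finset.mem_product, Finset.mem_Icc] at hj
              rw [Finset.mem_Icc]
              omega
            have hmem : ∀ p ∈ E'.filter (fun p => (n p.1, n p.2) = j),
                p ∈ E ∧ n p.1 = j.1 ∧ n p.2 = j.2 := by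
              intro p hp
              rw [Finset.mem_filter, hE', Finset.mem_filter] at hp
              exact ⟨hp.1.1, by rw [← hp.2], by rw [← hp.2]⟩
            have := card_pow_sub_pow_le (E'.filter fun p => (n p.1, n p.2) = j)
              (fun p => u p.1) (fun p => x p.1) (fun p => x p.2) k D hk hD0
              (by
                intro p hp
                obtain ⟨he, e1, e2⟩ := hmem p hp
                obtain ⟨h1, h2, h3, h4⟩ := hEmem p he
                rw [heq _ h1 _ h2 h3 h4, e1, e2])
              (by
                intro p hp p' hp' hu hx hx'
                obtain ⟨he, e1, e2⟩ := hmem p hp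
                obtain ⟨h1, h2, h3, h4⟩ := hEmem p he
                obtain ⟨he', e1', e2'⟩ := hmem p' hp'
                obtain ⟨h1', h2', h3', h4'⟩ := hEmem p' he'
                exact Prod.ext (hinj _ h1 _ h1' hu hx (e1.trans e1'.symm))
                  (hinj _ h2 _ h2' (h3.symm.trans (hu.trans h3')) hx' (e2.trans e2'.symm)))
            calc _ ≤ ((2 * D.divisors.card ^ 2 : ℕ) : ℝ) := by exact_mod_cast this
              _ = 2 * (D.divisors.card : ℝ) ^ 2 := by push_cast; ring
              _ ≤ 2 * H ^ 2 := by
                gcongr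
                exact hdiv D hDN
      _ ≤ M ^ 2 * (2 * H ^ 2 * H ^ 2) := by
          gcongr
          exact sum_prod_inv_rad_le hH
      _ = _ := by ring
  rw [← Finset.sum_filter_add_sum_filter_not E (fun p => p.1 = p.2)] at hcs
  refine abs_le_of_sq_le_sq' ?_ (by positivity) |>.2
  have h34 : H ^ 3 ≤ H ^ 4 := pow_le_pow_right₀ hH1 (by norm_num)
  have h68 : H ^ 6 ≤ H ^ 8 := pow_le_pow_right₀ hH1 (by norm_num)
  calc (F.card : ℝ) ^ 2 ≤ H ^ 2 * (M ^ 2 * H ^ 4 + 2 * H ^ 2 * (M ^ 2 * H ^ 2)) := by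
        refine hcs.trans ?_
        gcongr
        exact hdiag.trans (by gcongr)
    _ = 3 * M ^ 2 * H ^ 6 := by ring
    _ ≤ 4 * M ^ 2 * H ^ 8 := by gcongr; norm_num
    _ = _ := by ring

/-- The product of the primes dividing `n` exactly `k` times. -/
def exactPart (k n : ℕ) : ℕ := ∏ p ∈ n.primeFactors with n.factorization p = k, p

/-- The cofactor of `exactPart k n ^ k` in `n`. -/
def exactCofactor (k n : ℕ) : ℕ :=
  ∏ p ∈ n.primeFactors with ¬ n.factorization p = k, p ^ n.factorization p

lemma exactPart_pos (k n : ℕ) : 0 < exactPart k n :=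
  Finset.prod_pos fun _ hp => Nat.pos_of_mem_primeFactors (Finset.mem_filter.1 hp).1

lemma exactCofactor_mul_pow {n : ℕ} (k : ℕ) (hn : n ≠ 0) :
    exactCofactor k n * exactPart k n ^ k = n := by
  have h : ∏ p ∈ n.primeFactors, p ^ n.factorization p = n :=
    Nat.prod_factorization_pow_eq_self hn
  conv_rhs => rw [← h, ← Finset.prod_filter_mul_prod_filter_not _ (fun p => n.factorization p = k)]
  rw [mul_comm, exactCofactor, exactPart, ← Finset.prod_pow]
  congr 1
  exact Finset.prod_congr rfl fun p hp => by rw [(Finset.mem_filter.1 hp).2]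

lemma exactCofactor_dvd {n : ℕ} (k : ℕ) (hn : n ≠ 0) : exactCofactor k n ∣ n :=
  ⟨_, (exactCofactor_mul_pow k hn).symm⟩

lemma exactPart_dvd (k n : ℕ) : exactPart k n ∣ n := by
  have h : exactPart k n ∣ ∏ p ∈ n.primeFactors, p :=
    Finset.prod_dvd_prod_of_subset _ _ _ (Finset.filter_subset _ _)
  exact h.trans (Nat.prod_primeFactors_dvd n)

lemma exactCofactor_mem_Icc {n N : ℕ} (k : ℕ) (hn : n ∈ Finset.Icc 1 N) :
    exactCofactor k n ∈ Finset.Icc 1 N := by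
  rw [Finset.mem_Icc] at hn ⊢
  have h := exactCofactor_dvd k (show n ≠ 0 by omega)
  exact ⟨Nat.pos_of_dvd_of_pos h hn.1, (Nat.le_of_dvd hn.1 h).trans hn.2⟩

lemma exactPart_mem_Icc {n N : ℕ} (k : ℕ) (hn : n ∈ Finset.Icc 1 N) :
    exactPart k n ∈ Finset.Icc 1 N := by
  rw [Finset.mem_Icc] at hn ⊢
  have h := exactPart_dvd k n
  exact ⟨exactPart_pos k n, (Nat.le_of_dvd hn.1 h).trans hn.2⟩

lemma rad_exactCofactor_mul_exactPart_le (k n : ℕ) :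
    rad (exactCofactor k n) * exactPart k n ≤ rad n := by
  have hsub : (exactCofactor k n).primeFactors ⊆
      n.primeFactors.filter fun p => ¬ n.factorization p = k := by
    intro p hp
    rw [Nat.mem_primeFactors] at hp
    obtain ⟨q, hq, hpq⟩ := (hp.1.prime.dvd_finsetProd_iff _).1 hp.2.1
    have := (Nat.prime_dvd_prime_iff_eq hp.1
      (Nat.prime_of_mem_primeFactors (Finset.mem_filter.1 hq).1)).1 (hp.1.dvd_of_dvd_pow hpq)
    rwa [this]
  rw [mul_comm, rad, rad, exactPart,
    ← Finset.prod_filter_mul_prod_filter_not n.primeFactors (fun p => n.factorization p = k)]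
  refine Nat.mul_le_mul_left _ (Finset.prod_le_prod_of_subset_of_one_le' hsub fun p hp _ => ?_)
  exact Nat.pos_of_mem_primeFactors (Finset.mem_filter.1 hp).1

lemma rad_pow_five_le {n : ℕ} (hn : n ≠ 0) :
    rad n ^ 5 ≤ n * exactPart 1 n ^ 4 * exactPart 2 n ^ 3 * exactPart 3 n ^ 2 * exactPart 4 n := by
  have h : ∏ p ∈ n.primeFactors, p ^ n.factorization p = n :=
    Nat.prod_factorization_pow_eq_self hn
  conv_rhs => enter [1, 1, 1, 1]; rw [← h]
  simp only [rad, exactPart, Finset.prod_filter, ← Finset.prod_pow, ← Finset.prod_mul_distrib]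
  refine Finset.prod_le_prod' fun p hp => ?_
  have hp0 := Nat.pos_of_mem_primeFactors hp
  have hv : n.factorization p ≠ 0 := by
    have := Nat.support_factorization n ▸ hp
    exact Finsupp.mem_support_iff.1 this
  generalize n.factorization p = v at hv
  rcases Nat.lt_or_ge v 5 with h5 | h5
  · interval_cases v <;> simp_all <;> ring_nf <;> rfl
  · simp only [show v ≠ 1 by omega, show v ≠ 2 by omega, show v ≠ 3 by omega,
      show v ≠ 4 by omega, if_false, one_pow, mul_one]
    exact Nat.pow_le_pow_right hp0 h5

/-- The hypotheses of `card_le_of_pow_eq` on the sizes of the radicals. -/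
def PowCond (M : ℝ) (k y m n : ℕ) : Prop :=
  (rad (exactCofactor k y) ^ 2 * rad m * exactPart k y * rad n : ℝ) ≤ M ^ 2 ∧
    (rad (exactCofactor k y) * rad m * rad n ^ 2 : ℝ) ≤ M ^ 2

/-- The hypotheses of `card_le_of_linear_eq` on the sizes of the radicals. -/
def LinCond (M : ℝ) (a b c : ℕ) : Prop :=
  (rad (exactCofactor 1 a) * (rad (exactCofactor 1 b) * rad (exactCofactor 1 c)) : ℝ) ≤ M ∧
    (rad (exactCofactor 1 a) * (rad (exactCofactor 1 b) * rad (exactCofactor 1 c)) *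
      (exactPart 1 a * exactPart 1 b) : ℝ) ≤ M * exactCofactor 1 c

lemma log_rad_exactCofactor_le (k n : ℕ) :
    Real.log (rad (exactCofactor k n)) + Real.log (exactPart k n) ≤ Real.log (rad n) := by
  have h1 : (0 : ℝ) < rad (exactCofactor k n) := by exact_mod_cast rad_pos _
  have h2 : (0 : ℝ) < exactPart k n := by exact_mod_cast exactPart_pos _ _
  rw [← Real.log_mul h1.ne' h2.ne']
  refine Real.log_le_log (by positivity) ?_
  exact_mod_cast rad_exactCofactor_mul_exactPart_le k n

lemma log_rad_le {n : ℕ} (hn : n ≠ 0) :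
    5 * Real.log (rad n) ≤ Real.log n + 4 * Real.log (exactPart 1 n) +
      3 * Real.log (exactPart 2 n) + 2 * Real.log (exactPart 3 n) + Real.log (exactPart 4 n) := by
  have h0 : (0 : ℝ) < rad n := by exact_mod_cast rad_pos _
  have hn' : (0 : ℝ) < n := by exact_mod_cast Nat.pos_of_ne_zero hn
  have h : ∀ k, (0 : ℝ) < exactPart k n := fun k => by exact_mod_cast exactPart_pos _ _
  have h1 := h 1
  have h2 := h 2
  have h3 := h 3
  have h4 := h 4
  have := Real.log_le_log (by positivity)
    (show (rad n : ℝ) ^ 5 ≤ n * (exactPart 1 n : ℝ) ^ 4 * (exactPart 2 n : ℝ) ^ 3 *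
      (exactPart 3 n : ℝ) ^ 2 * exactPart 4 n by exact_mod_cast rad_pow_five_le hn)
  rw [Real.log_mul (by positivity) (by positivity), Real.log_mul (by positivity) (by positivity),
    Real.log_mul (by positivity) (by positivity), Real.log_mul (by positivity) (by positivity),
    Real.log_pow, Real.log_pow, Real.log_pow, Real.log_pow] at this
  push_cast at this
  linarith

lemma log_rad_nonneg (n : ℕ) : 0 ≤ Real.log (rad n) := Real.log_nonneg (one_le_rad n)

lemma powCond_of_log_le {M E : ℝ} (hM : 0 < M) (hE : E ≤ Real.log M) {k y m n : ℕ}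
    (h1 : 2 * Real.log (rad y) + Real.log (rad m) + Real.log (rad n) - Real.log (exactPart k y) ≤
      2 * E)
    (h2 : Real.log (rad y) + Real.log (rad m) + 2 * Real.log (rad n) - Real.log (exactPart k y) ≤
      2 * E) : PowCond M k y m n := by
  have hr : ∀ n, (0 : ℝ) < rad n := fun n => by exact_mod_cast rad_pos n
  have hx : (0 : ℝ) < exactPart k y := by exact_mod_cast exactPart_pos _ _
  have hu := hr (exactCofactor k y)
  have hm := hr m
  have hn := hr n
  have hlog := log_rad_exactCofactor_le k y
  constructor
  · rw [← Real.log_le_log_iff (by positivity) (by positivity), Real.log_pow,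
      Real.log_mul (by positivity) (by positivity), Real.log_mul (by positivity) (by positivity),
      Real.log_mul (by positivity) (by positivity), Real.log_pow]
    push_cast
    linarith
  · rw [← Real.log_le_log_iff (by positivity) (by positivity), Real.log_pow,
      Real.log_mul (by positivity) (by positivity), Real.log_mul (by positivity) (by positivity),
      Real.log_pow]
    push_cast
    linarith

lemma linCond_of_log_le {M E : ℝ} (hM : 0 < M) (hE : E ≤ Real.log M) {a b c : ℕ} (hc : c ≠ 0)
    (h1 : Real.log (rad a) + Real.log (rad b) + Real.log (rad c) -
      (Real.log (exactPart 1 a) + Real.log (exactPart 1 b) + Real.log (exactPart 1 c)) ≤ E)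
    (h2 : Real.log (rad a) + Real.log (rad b) + Real.log (rad c) ≤ E + Real.log c) :
    LinCond M a b c := by
  have hr : ∀ n, (0 : ℝ) < rad n := fun n => by exact_mod_cast rad_pos n
  have hx : ∀ n, (0 : ℝ) < exactPart 1 n := fun n => by exact_mod_cast exactPart_pos 1 n
  have hu := hr (exactCofactor 1 a)
  have hv := hr (exactCofactor 1 b)
  have hw := hr (exactCofactor 1 c)
  have ha := hx a
  have hb := hx b
  have la := log_rad_exactCofactor_le 1 a
  have lb := log_rad_exactCofactor_le 1 b
  have lc := log_rad_exactCofactor_le 1 c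
  have hc' : (exactCofactor 1 c * exactPart 1 c : ℝ) = c := by
    have := exactCofactor_mul_pow 1 hc
    rw [pow_one] at this
    exact_mod_cast this
  have hcpos : (0 : ℝ) < exactCofactor 1 c := by
    exact_mod_cast Nat.pos_of_dvd_of_pos (exactCofactor_dvd 1 hc) (Nat.pos_of_ne_zero hc)
  have lw : Real.log (exactCofactor 1 c) + Real.log (exactPart 1 c) = Real.log c := by
    rw [← Real.log_mul hcpos.ne' (hx c).ne', hc']
  constructor
  · rw [← Real.log_le_log_iff (by positivity) (by positivity),
      Real.log_mul (by positivity) (by positivity), Real.log_mul (by positivity) (by positivity)]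
    linarith
  · rw [← Real.log_le_log_iff (by positivity) (by positivity),
      Real.log_mul (by positivity) (by positivity), Real.log_mul (by positivity) (by positivity),
      Real.log_mul (by positivity) (by positivity), Real.log_mul (by positivity) (by positivity),
      Real.log_mul (by positivity) (by positivity)]
    linarith

/-- Every abc triple satisfies the hypotheses of one of the counting lemmas. -/
lemma IsABCTriple.cases {a b c : ℕ} {M : ℝ} (h : IsABCTriple 1.001 a b c)
    (hM : (c : ℝ) ^ (0.659 : ℝ) ≤ M) :
    ((rad a * rad b : ℝ) ≤ M ∨ (rad a * rad c : ℝ) ≤ M ∨ (rad b * rad c : ℝ) ≤ M) ∨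
      (PowCond M 2 a b c ∨ PowCond M 3 a b c ∨ PowCond M 4 a b c) ∨
      (PowCond M 2 b a c ∨ PowCond M 3 b a c ∨ PowCond M 4 b a c) ∨
      (PowCond M 2 c b a ∨ PowCond M 3 c b a ∨ PowCond M 4 c b a) ∨ LinCond M a b c := by
  obtain ⟨ha, hb, hc, hab, habc, hrad⟩ := h
  have hc' : (0 : ℝ) < c := by exact_mod_cast hc
  have hc1 : (1 : ℝ) ≤ c := by exact_mod_cast hc
  have hL : 0 ≤ Real.log c := Real.log_nonneg hc1
  have hM0 : 0 < M := (by positivity : (0 : ℝ) < (c : ℝ) ^ (0.659 : ℝ)).trans_le hM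
  have hE : 0.659 * Real.log c ≤ Real.log M := by
    rw [← Real.log_rpow hc']
    exact Real.log_le_log (by positivity) hM
  have hr : ∀ n, (0 : ℝ) < rad n := fun n => by exact_mod_cast rad_pos n
  have hcop : (a * b).Coprime c := by
    rw [← habc]
    refine Nat.Coprime.mul_left ?_ ?_
    · simpa using hab
    · simpa using Nat.Coprime.symm hab
  have hsum : Real.log (rad a) + Real.log (rad b) + Real.log (rad c) ≤ 1.001 * Real.log c := by
    rw [rad_mul_of_coprime hcop, rad_mul_of_coprime hab] at hrad
    push_cast at hrad
    have := hr a
    have := hr b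
    have := hr c
    rw [← Real.log_mul (by positivity) (by positivity), ← Real.log_mul (by positivity)
      (by positivity), ← Real.log_rpow hc']
    exact Real.log_le_log (by positivity) hrad.le
  have hpair : ∀ m n : ℕ, Real.log (rad m) + Real.log (rad n) ≤ 0.659 * Real.log c →
      (rad m * rad n : ℝ) ≤ M := by
    intro m n hmn
    have hm := hr m
    have hn := hr n
    rw [← Real.log_le_log_iff (by positivity) hM0, Real.log_mul hm.ne' hn.ne']
    exact hmn.trans hE
  have hla : Real.log a ≤ Real.log c :=
    Real.log_le_log (by exact_mod_cast ha) (by exact_mod_cast (by omega : a ≤ c))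
  have hlb : Real.log b ≤ Real.log c :=
    Real.log_le_log (by exact_mod_cast hb) (by exact_mod_cast (by omega : b ≤ c))
  have ra := log_rad_le ha.ne'
  have rb := log_rad_le hb.ne'
  have rc := log_rad_le hc.ne'
  by_contra! hcon
  obtain ⟨⟨hAB, hAC, hBC⟩, ⟨ha2, ha3, ha4⟩, ⟨hb2, hb3, hb4⟩, ⟨hc2, hc3, hc4⟩, hlin⟩ := hcon
  replace hAB := not_le.1 fun h => hAB.not_ge (hpair a b h)
  replace hAC := not_le.1 fun h => hAC.not_ge (hpair a c h)
  replace hBC := not_le.1 fun h => hBC.not_ge (hpair b c h)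
  have hxa : ∀ k, ¬ PowCond M k a b c → Real.log (exactPart k a) ≤ 0.025 * Real.log c := by
    intro k hk
    by_contra! hx
    exact hk (powCond_of_log_le hM0 hE (by linarith) (by linarith))
  have hxb : ∀ k, ¬ PowCond M k b a c → Real.log (exactPart k b) ≤ 0.025 * Real.log c := by
    intro k hk
    by_contra! hx
    exact hk (powCond_of_log_le hM0 hE (by linarith) (by linarith))
  have hxc : ∀ k, ¬ PowCond M k c b a → Real.log (exactPart k c) ≤ 0.025 * Real.log c := by
    intro k hk
    by_contra! hx
    exact hk (powCond_of_log_le hM0 hE (by linarith) (by linarith))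
  replace ha2 := hxa 2 ha2
  replace ha3 := hxa 3 ha3
  replace ha4 := hxa 4 ha4
  replace hb2 := hxb 2 hb2
  replace hb3 := hxb 3 hb3
  replace hb4 := hxb 4 hb4
  replace hc2 := hxc 2 hc2
  replace hc3 := hxc 3 hc3
  replace hc4 := hxc 4 hc4
  exact hlin (linCond_of_log_le hM0 hE hc.ne' (by linarith) (by linarith))

lemma card_le_of_powCond {ι : Type*} (F : Finset ι) (y m n : ι → ℕ) (k N : ℕ) (M H : ℝ)
    (hk : 2 ≤ k) (hM0 : 0 ≤ M) (hH1 : 1 ≤ H)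
    (hy : ∀ t ∈ F, y t ∈ Finset.Icc 1 N) (hm : ∀ t ∈ F, m t ∈ Finset.Icc 1 N)
    (hn : ∀ t ∈ F, n t ∈ Finset.Icc 1 N)
    (heq : ∀ t ∈ F, ∀ t' ∈ F, m t = m t' →
      ((y t : ℤ) - y t').natAbs = ((n t : ℤ) - n t').natAbs)
    (hinj : ∀ t ∈ F, ∀ t' ∈ F, y t = y t' → n t = n t' → t = t')
    (hM : ∀ t ∈ F, PowCond M k (y t) (m t) (n t))
    (hH : ∑ n ∈ Finset.Icc 1 N, (1 / rad n : ℝ) ≤ H)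
    (hdiv : ∀ d ∈ Finset.Icc 1 N, (d.divisors.card : ℝ) ≤ H) :
    (F.card : ℝ) ≤ 2 * M * H ^ 4 := by
  have hfac : ∀ t ∈ F, exactCofactor k (y t) * exactPart k (y t) ^ k = y t := fun t ht =>
    exactCofactor_mul_pow k (by have := (Finset.mem_Icc.1 (hy t ht)).1; omega)
  refine card_le_of_pow_eq F (fun t => exactCofactor k (y t)) (fun t => exactPart k (y t)) m n k N
    M H hk hM0 hH1 (fun t ht => exactCofactor_mem_Icc k (hy t ht))
    (fun t ht => exactPart_mem_Icc k (hy t ht)) hm hn (fun t ht t' ht' hu hmm => ?_)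
    (fun t ht t' ht' hu hx hnn => ?_) (fun t ht => (hM t ht).1) (fun t ht => (hM t ht).2) hH hdiv
  · rw [← heq t ht t' ht' hmm]
    congr 1
    have e := hfac t ht
    have e' := hfac t' ht'
    rw [← hu] at e'
    zify at e e'
    linear_combination e - e'
  · refine hinj t ht t' ht' ?_ hnn
    rw [← hfac t ht, ← hfac t' ht', hu, hx]

lemma card_le_of_linCond {ι : Type*} (F : Finset ι) (a b c : ι → ℕ) (N : ℕ) (M H : ℝ)
    (hM0 : 0 ≤ M) (ha : ∀ t ∈ F, a t ∈ Finset.Icc 1 N) (hb : ∀ t ∈ F, b t ∈ Finset.Icc 1 N)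
    (hc : ∀ t ∈ F, c t ∈ Finset.Icc 1 N) (hsum : ∀ t ∈ F, a t + b t = c t)
    (hab : ∀ t ∈ F, (a t).Coprime (b t))
    (hinj : ∀ t ∈ F, ∀ t' ∈ F, a t = a t' → b t = b t' → t = t')
    (hM : ∀ t ∈ F, LinCond M (a t) (b t) (c t))
    (hH : ∑ n ∈ Finset.Icc 1 N, (1 / rad n : ℝ) ≤ H) (hlog : (Nat.log 2 N + 1 : ℝ) ≤ H) :
    (F.card : ℝ) ≤ 5 * M * H ^ 4 := by
  have hpos : ∀ n ∈ Finset.Icc 1 N, n ≠ 0 := fun n hn => by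
    have := (Finset.mem_Icc.1 hn).1
    omega
  have hfac : ∀ n ∈ Finset.Icc 1 N, exactCofactor 1 n * exactPart 1 n = n := by
    intro n hn
    have := exactCofactor_mul_pow 1 (hpos n hn)
    rwa [pow_one] at this
  have heq : ∀ t ∈ F, exactCofactor 1 (a t) * exactPart 1 (a t) +
      exactCofactor 1 (b t) * exactPart 1 (b t) = exactCofactor 1 (c t) * exactPart 1 (c t) := by
    intro t ht
    rw [hfac _ (ha t ht), hfac _ (hb t ht), hfac _ (hc t ht), hsum t ht]
  have hcop : ∀ t ∈ F, (exactCofactor 1 (a t)).Coprime (exactCofactor 1 (c t)) := by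
    intro t ht
    have hac : (a t).Coprime (c t) := by
      rw [← hsum t ht]
      simpa using hab t ht
    exact (hac.coprime_dvd_left (exactCofactor_dvd 1 (hpos _ (ha t ht)))).coprime_dvd_right
      (exactCofactor_dvd 1 (hpos _ (hc t ht)))
  have hcop' : ∀ t ∈ F, (exactPart 1 (a t)).Coprime (exactPart 1 (b t)) := fun t ht =>
    ((hab t ht).coprime_dvd_left (exactPart_dvd 1 _)).coprime_dvd_right (exactPart_dvd 1 _)
  refine card_le_of_linear_eq F (fun t => exactCofactor 1 (a t)) (fun t => exactCofactor 1 (b t))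
    (fun t => exactCofactor 1 (c t)) (fun t => exactPart 1 (a t)) (fun t => exactPart 1 (b t))
    (fun t => exactPart 1 (c t)) N M H hM0 (fun t ht => exactCofactor_mem_Icc 1 (ha t ht))
    (fun t ht => exactCofactor_mem_Icc 1 (hb t ht))
    (fun t ht => exactCofactor_mem_Icc 1 (hc t ht)) (fun t _ => exactPart_pos 1 (a t))
    (fun t ht => exactPart_mem_Icc 1 (hb t ht)) heq hcop hcop'
    (fun t ht t' ht' h1 h2 _ h4 h5 => ?_) (fun t ht => (hM t ht).1) (fun t ht => (hM t ht).2)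
    hH hlog
  have e1 : a t = a t' := by rw [← hfac _ (ha t ht), ← hfac _ (ha t' ht'), h1, h4]
  have e2 : b t = b t' := by rw [← hfac _ (hb t ht), ← hfac _ (hb t' ht'), h2, h5]
  exact hinj t ht t' ht' e1 e2

lemma card_filter_or_le {ι : Type*} (F : Finset ι) (p q : ι → Prop) [DecidablePred p]
    [DecidablePred q] [DecidablePred fun t => p t ∨ q t] {K L : ℝ}
    (hp : ((F.filter p).card : ℝ) ≤ K) (hq : ((F.filter q).card : ℝ) ≤ L) :
    ((F.filter fun t => p t ∨ q t).card : ℝ) ≤ K + L := by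
  classical
  have h : (F.filter fun t => p t ∨ q t).card ≤ (F.filter p).card + (F.filter q).card := by
    refine le_trans (Finset.card_le_card fun t ht => ?_) (Finset.card_union_le _ _)
    simp only [Finset.mem_union, Finset.mem_filter] at ht ⊢
    tauto
  have h' : ((F.filter fun t => p t ∨ q t).card : ℝ) ≤ (F.filter p).card + (F.filter q).card := by
    exact_mod_cast h
  linarith

/-- The count of abc triples in terms of a bound `H` for the divisor-type quantities. -/
lemma card_abcTriple_le (S : Finset (ℕ × ℕ × ℕ)) (N : ℕ) (M H : ℝ) (hH1 : 1 ≤ H)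
    (hS : ∀ t ∈ S, IsABCTriple 1.001 t.1 t.2.1 t.2.2 ∧ t.2.2 ≤ N)
    (hM : ∀ t ∈ S, (t.2.2 : ℝ) ^ (0.659 : ℝ) ≤ M) (hM0 : 0 ≤ M)
    (hH : ∑ n ∈ Finset.Icc 1 N, (1 / rad n : ℝ) ≤ H)
    (hdiv : ∀ d ∈ Finset.Icc 1 N, (d.divisors.card : ℝ) ≤ H)
    (hlog : (Nat.log 2 N + 1 : ℝ) ≤ H) :
    (S.card : ℝ) ≤ 26 * (M * H ^ 4) := by
  classical
  have ha : ∀ t ∈ S, t.1 ∈ Finset.Icc 1 N := fun t ht => by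
    obtain ⟨⟨h1, h2, h3, h4, h5, -⟩, h6⟩ := hS t ht
    exact Finset.mem_Icc.2 (by omega)
  have hb : ∀ t ∈ S, t.2.1 ∈ Finset.Icc 1 N := fun t ht => by
    obtain ⟨⟨h1, h2, h3, h4, h5, -⟩, h6⟩ := hS t ht
    exact Finset.mem_Icc.2 (by omega)
  have hc : ∀ t ∈ S, t.2.2 ∈ Finset.Icc 1 N := fun t ht => by
    obtain ⟨⟨h1, h2, h3, h4, h5, -⟩, h6⟩ := hS t ht
    exact Finset.mem_Icc.2 (by omega)
  have hsum : ∀ t ∈ S, t.1 + t.2.1 = t.2.2 := fun t ht => (hS t ht).1.2.2.2.2.1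
  have hab : ∀ t ∈ S, t.1.Coprime t.2.1 := fun t ht => (hS t ht).1.2.2.2.1
  have hext : ∀ t t' : ℕ × ℕ × ℕ, t.1 = t'.1 → t.2.1 = t'.2.1 → t.2.2 = t'.2.2 → t = t' :=
    fun t t' h1 h2 h3 => Prod.ext h1 (Prod.ext h2 h3)
  have hradical : ∀ f g : ℕ × ℕ × ℕ → ℕ, (∀ t ∈ S, f t ∈ Finset.Icc 1 N) →
      (∀ t ∈ S, g t ∈ Finset.Icc 1 N) →
      (∀ t ∈ S, ∀ t' ∈ S, f t = f t' → g t = g t' → t = t') →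
      ((S.filter fun t => (rad (f t) * rad (g t) : ℝ) ≤ M).card : ℝ) ≤ M * H ^ 4 := by
    intro f g hf hg hinj
    refine (card_le_of_rad_mul_rad_le _ f g N M H hM0
      (fun t ht => hf t (Finset.mem_filter.1 ht).1) (fun t ht => hg t (Finset.mem_filter.1 ht).1)
      (fun t ht t' ht' => hinj t (Finset.mem_filter.1 ht).1 t' (Finset.mem_filter.1 ht').1)
      (fun t ht => (Finset.mem_filter.1 ht).2) hH).trans ?_
    exact mul_le_mul_of_nonneg_left (pow_le_pow_right₀ hH1 (by norm_num)) hM0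
  have hpow : ∀ k, 2 ≤ k → ∀ y m n : ℕ × ℕ × ℕ → ℕ, (∀ t ∈ S, y t ∈ Finset.Icc 1 N) →
      (∀ t ∈ S, m t ∈ Finset.Icc 1 N) → (∀ t ∈ S, n t ∈ Finset.Icc 1 N) →
      (∀ t ∈ S, ∀ t' ∈ S, m t = m t' →
        ((y t : ℤ) - y t').natAbs = ((n t : ℤ) - n t').natAbs) →
      (∀ t ∈ S, ∀ t' ∈ S, y t = y t' → n t = n t' → t = t') →
      ((S.filter fun t => PowCond M k (y t) (m t) (n t)).card : ℝ) ≤ 2 * M * H ^ 4 := by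
    intro k hk y m n hy hm hn heq hinj
    exact card_le_of_powCond _ y m n k N M H hk hM0 hH1
      (fun t ht => hy t (Finset.mem_filter.1 ht).1) (fun t ht => hm t (Finset.mem_filter.1 ht).1)
      (fun t ht => hn t (Finset.mem_filter.1 ht).1)
      (fun t ht t' ht' => heq t (Finset.mem_filter.1 ht).1 t' (Finset.mem_filter.1 ht').1)
      (fun t ht t' ht' => hinj t (Finset.mem_filter.1 ht).1 t' (Finset.mem_filter.1 ht').1)
      (fun t ht => (Finset.mem_filter.1 ht).2) hH hdiv
  have hpowa : ∀ k, 2 ≤ k →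
      ((S.filter fun t => PowCond M k t.1 t.2.1 t.2.2).card : ℝ) ≤ 2 * M * H ^ 4 := by
    intro k hk
    refine hpow k hk (fun t => t.1) (fun t => t.2.1) (fun t => t.2.2) ha hb hc
      (fun t ht t' ht' h => ?_) (fun t ht t' ht' h1 h2 => ?_) <;>
      have e := hsum t ht <;> have e' := hsum t' ht'
    · omega
    · exact hext _ _ h1 (by omega) h2
  have hpowb : ∀ k, 2 ≤ k →
      ((S.filter fun t => PowCond M k t.2.1 t.1 t.2.2).card : ℝ) ≤ 2 * M * H ^ 4 := by
    intro k hk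
    refine hpow k hk (fun t => t.2.1) (fun t => t.1) (fun t => t.2.2) hb ha hc
      (fun t ht t' ht' h => ?_) (fun t ht t' ht' h1 h2 => ?_) <;>
      have e := hsum t ht <;> have e' := hsum t' ht'
    · omega
    · exact hext _ _ (by omega) h1 h2
  have hpowc : ∀ k, 2 ≤ k →
      ((S.filter fun t => PowCond M k t.2.2 t.2.1 t.1).card : ℝ) ≤ 2 * M * H ^ 4 := by
    intro k hk
    refine hpow k hk (fun t => t.2.2) (fun t => t.2.1) (fun t => t.1) hc hb ha
      (fun t ht t' ht' h => ?_) (fun t ht t' ht' h1 h2 => ?_) <;>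
      have e := hsum t ht <;> have e' := hsum t' ht'
    · omega
    · exact hext _ _ h2 (by omega) h1
  have hlin : ((S.filter fun t => LinCond M t.1 t.2.1 t.2.2).card : ℝ) ≤ 5 * M * H ^ 4 := by
    set G := S.filter fun t => LinCond M t.1 t.2.1 t.2.2
    have hG : ∀ t ∈ G, t ∈ S ∧ LinCond M t.1 t.2.1 t.2.2 := fun t ht => Finset.mem_filter.1 ht
    clear_value G
    refine card_le_of_linCond G (fun t => t.1) (fun t => t.2.1) (fun t => t.2.2) N M H hM0
      (fun t ht => ha t (hG t ht).1) (fun t ht => hb t (hG t ht).1)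
      (fun t ht => hc t (hG t ht).1) (fun t ht => hsum t (hG t ht).1)
      (fun t ht => hab t (hG t ht).1)
      (fun t ht t' ht' h1 h2 => hext _ _ h1 h2 ?_) (fun t ht => ?_) hH hlog
    · have e := hsum t (hG t ht).1
      have e' := hsum t' (hG t' ht').1
      omega
    · exact (hG t ht).2
  have hcard_rad : ((S.filter fun t => (rad t.1 * rad t.2.1 : ℝ) ≤ M ∨
      (rad t.1 * rad t.2.2 : ℝ) ≤ M ∨ (rad t.2.1 * rad t.2.2 : ℝ) ≤ M).card : ℝ) ≤
      M * H ^ 4 + (M * H ^ 4 + M * H ^ 4) := by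
    refine card_filter_or_le S _ _ ?_ (card_filter_or_le S _ _ ?_ ?_)
    · exact hradical (fun t => t.1) (fun t => t.2.1) ha hb fun t ht t' ht' h1 h2 =>
        hext _ _ h1 h2 (by have := hsum t ht; have := hsum t' ht'; omega)
    · exact hradical (fun t => t.1) (fun t => t.2.2) ha hc fun t ht t' ht' h1 h2 =>
        hext _ _ h1 (by have := hsum t ht; have := hsum t' ht'; omega) h2
    · exact hradical (fun t => t.2.1) (fun t => t.2.2) hb hc fun t ht t' ht' h1 h2 =>
        hext _ _ (by have := hsum t ht; have := hsum t' ht'; omega) h1 h2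
  have hcard_three : ∀ y m n : ℕ × ℕ × ℕ → ℕ,
      (∀ k, 2 ≤ k →
        ((S.filter fun t => PowCond M k (y t) (m t) (n t)).card : ℝ) ≤ 2 * M * H ^ 4) →
      ((S.filter fun t => PowCond M 2 (y t) (m t) (n t) ∨ PowCond M 3 (y t) (m t) (n t) ∨
        PowCond M 4 (y t) (m t) (n t)).card : ℝ) ≤
      2 * M * H ^ 4 + (2 * M * H ^ 4 + 2 * M * H ^ 4) := by
    intro y m n h
    refine card_filter_or_le S _ _ ?_ (card_filter_or_le S _ _ ?_ ?_)
    · exact h 2 (by norm_num)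
    · exact h 3 (by norm_num)
    · exact h 4 (by norm_num)
  have hcover := card_filter_or_le S _ _ hcard_rad
    (card_filter_or_le S _ _ (hcard_three (fun t => t.1) (fun t => t.2.1) (fun t => t.2.2) hpowa)
      (card_filter_or_le S _ _
        (hcard_three (fun t => t.2.1) (fun t => t.1) (fun t => t.2.2) hpowb)
        (card_filter_or_le S _ _
          (hcard_three (fun t => t.2.2) (fun t => t.2.1) (fun t => t.1) hpowc) hlin)))
  rw [Finset.filter_true_of_mem fun t ht => (hS t ht).1.cases (hM t ht)] at hcover
  linarith

lemma IsABCTriple.mono {l l' : ℝ} {a b c : ℕ} (h : IsABCTriple l a b c) (hl : l ≤ l') :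
    IsABCTriple l' a b c := by
  obtain ⟨ha, hb, hc, hab, habc, hrad⟩ := h
  have hc1 : (1 : ℝ) ≤ c := by exact_mod_cast hc
  exact ⟨ha, hb, hc, hab, habc, hrad.trans_le (Real.rpow_le_rpow_of_exponent_le hc1 hl)⟩

theorem abc_BLT_bound :
    ∀ lam : ℝ, 0 < lam → lam < 1.001 → ∃ C : ℝ,
      ∀ X : ℝ, 2 ≤ X →
        (NabcCount lam X : ℝ) ≤ C * X ^ (33 / 50 : ℝ) := by
  intro lam _ hlam
  obtain ⟨C₁, hC₁⟩ := exists_sum_inv_rad_le (e := 1 / 4000) (by norm_num)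
  obtain ⟨C₂, hC₂⟩ := exists_card_divisors_le (e := 1 / 4000) (by norm_num)
  set K := max 1 (max C₁ C₂)
  have hK1 : 1 ≤ K := le_max_left _ _
  have hK₁ : C₁ ≤ K := (le_max_left _ _).trans (le_max_right _ _)
  have hK₂ : C₂ ≤ K := (le_max_right _ _).trans (le_max_right _ _)
  refine ⟨26 * K ^ 4, fun X hX => ?_⟩
  have hX0 : 0 < X := by linarith
  set N := ⌊X⌋₊ with hN
  have hNX : (N : ℝ) ≤ X := Nat.floor_le hX0.le
  have hN0 : N ≠ 0 := by
    rw [hN, Ne, Nat.floor_eq_zero]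
    linarith
  have hpow : ∀ n : ℕ, n ≤ N → (n : ℝ) ^ (1 / 4000 : ℝ) ≤ X ^ (1 / 4000 : ℝ) := by
    intro n hn
    have : (n : ℝ) ≤ N := by exact_mod_cast hn
    exact Real.rpow_le_rpow (by positivity) (this.trans hNX) (by norm_num)
  set H := K * X ^ (1 / 4000 : ℝ) with hHdef
  have hXe : 1 ≤ X ^ (1 / 4000 : ℝ) := Real.one_le_rpow (by linarith) (by norm_num)
  have hH1 : 1 ≤ H := one_le_mul_of_one_le_of_one_le hK1 hXe
  have hH : ∑ n ∈ Finset.Icc 1 N, (1 / rad n : ℝ) ≤ H := by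
    refine (hC₁ N).trans ?_
    exact mul_le_mul hK₁ (hpow N le_rfl) (by positivity) (by linarith)
  have hdiv : ∀ d ∈ Finset.Icc 1 N, (d.divisors.card : ℝ) ≤ H := by
    intro d hd
    rw [Finset.mem_Icc] at hd
    refine (hC₂ d (by omega)).trans ?_
    exact mul_le_mul hK₂ (hpow d hd.2) (by positivity) (by linarith)
  have hlog : (Nat.log 2 N + 1 : ℝ) ≤ H := by
    have h := hdiv (2 ^ Nat.log 2 N)
      (Finset.mem_Icc.2 ⟨Nat.one_le_two_pow, Nat.pow_log_le_self 2 hN0⟩)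
    rw [Nat.divisors_prime_pow Nat.prime_two, Finset.card_map, Finset.card_range] at h
    exact_mod_cast h
  set A := {t : ℕ × ℕ × ℕ | IsABCTriple lam t.1 t.2.1 t.2.2 ∧
    (t.1 : ℝ) ≤ X ∧ (t.2.1 : ℝ) ≤ X ∧ (t.2.2 : ℝ) ≤ X} with hA
  have hfin : A.Finite := by
    refine (Finset.finite_toSet (Finset.Iic N ×ˢ Finset.Iic N ×ˢ Finset.Iic N)).subset ?_
    rintro t ⟨-, h1, h2, h3⟩
    simp only [Finset.coe_product, Set.mem_prod, Finset.mem_coe, Finset.mem_Iic]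
    exact ⟨Nat.le_floor h1, Nat.le_floor h2, Nat.le_floor h3⟩
  have hbound := card_abcTriple_le hfin.toFinset N (X ^ (0.659 : ℝ)) H hH1
    (fun t ht => by
      obtain ⟨h, -, -, h3⟩ := hfin.mem_toFinset.1 ht
      exact ⟨h.mono hlam.le, Nat.le_floor h3⟩)
    (fun t ht => by
      obtain ⟨-, -, -, h3⟩ := hfin.mem_toFinset.1 ht
      exact Real.rpow_le_rpow (by positivity) h3 (by norm_num))
    (by positivity) hH hdiv hlog
  rw [NabcCount, Set.ncard_eq_toFinset_card A hfin]
  refine hbound.trans (le_of_eq ?_)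
  rw [hHdef, mul_pow, ← Real.rpow_natCast (X ^ (1 / 4000 : ℝ)), ← Real.rpow_mul hX0.le,
    mul_left_comm (X ^ (0.659 : ℝ)), ← Real.rpow_add hX0, ← mul_assoc]
  norm_num
end

section
/- (Geometry bound.) Let d ≥ 1 and ε > 0 be fixed. Let X_1,…,X_d, Y_1,…,Y_d, Z_1,…,Z_d ≥ 1 and let c = (c_1,c_2,c_3) ∈ ℤ³ have non-zero pairwise coprime coordinates. Then there is a constant C(d, ε) such that for all subsets I, I′, I″ ⊆ {1,…,d}, B_d(c, X, Y, Z) ≤ C(d, ε) · max_{1≤i≤d}(X_i Y_i Z_i)^ε · (∏_{i∈I} X_i · ∏_{i∈I′} Y_i · ∏_{i∈I″} Z_i) · (1 + (∏_{i∉I} X_i^i · ∏_{i∉I′} Y_i^i · ∏_{i∉I″} Z_i^i) / max(|c_1| ∏_i X_i^i, |c_2| ∏_i Y_i^i, |c_3| ∏_i Z_i^i)). -/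
open Finset

/-- `Bcount d c₁ c₂ c₃ X Y Z` counts tuples `(x, y, z) ∈ ℕ^(3d)` with
`X i ≤ x i < 2 X i`, `Y i ≤ y i < 2 Y i`, `Z i ≤ z i < 2 Z i` (indices `i+1` run over
`1, …, d`), satisfying `c₁ ∏ x_j^j + c₂ ∏ y_j^j = c₃ ∏ z_j^j` and
`gcd(c₁ ∏ x_j, c₂ ∏ y_j, c₃ ∏ z_j) = 1`. -/
noncomputable def Bcount (d : ℕ) (c₁ c₂ c₃ : ℤ) (X Y Z : Fin d → ℝ) : ℕ :=
  Set.ncard {t : (Fin d → ℕ) × (Fin d → ℕ) × (Fin d → ℕ) |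
    (∀ i, X i ≤ (t.1 i : ℝ) ∧ (t.1 i : ℝ) < 2 * X i) ∧
    (∀ i, Y i ≤ (t.2.1 i : ℝ) ∧ (t.2.1 i : ℝ) < 2 * Y i) ∧
    (∀ i, Z i ≤ (t.2.2 i : ℝ) ∧ (t.2.2 i : ℝ) < 2 * Z i) ∧
    c₁ * ∏ j, (t.1 j : ℤ) ^ ((j : ℕ) + 1) + c₂ * ∏ j, (t.2.1 j : ℤ) ^ ((j : ℕ) + 1)
      = c₃ * ∏ j, (t.2.2 j : ℤ) ^ ((j : ℕ) + 1) ∧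
    Int.gcd (c₁ * ∏ j, (t.1 j : ℤ))
      ((Int.gcd (c₂ * ∏ j, (t.2.1 j : ℤ)) (c₃ * ∏ j, (t.2.2 j : ℤ)) : ℤ)) = 1}

/-- The divisor bound: the number of divisors of `n` is `O(n ^ η)` for every `η > 0`. -/
theorem exists_card_divisors_le_rpow (η : ℝ) (hη : 0 < η) :
    ∃ C : ℝ, 1 ≤ C ∧ ∀ n : ℕ, n ≠ 0 → (#n.divisors : ℝ) ≤ C * (n : ℝ) ^ η := by
  have hlog : 0 < η * Real.log 2 := mul_pos hη (Real.log_pos one_lt_two)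
  set B : ℝ := 1 + 1 / (η * Real.log 2) with hB
  have hB1 : 1 ≤ B := by rw [hB]; linarith [one_div_pos.2 hlog]
  set P : ℕ := ⌈(2 : ℝ) ^ (1 / η)⌉₊ with hP
  have key : ∀ p : ℕ, p.Prime → ∀ a : ℕ,
      ((a : ℝ) + 1) ≤ (if p < P then B else 1) * ((p : ℝ) ^ a) ^ η := by
    intro p hp a
    have hp2 : (2 : ℝ) ≤ p := by exact_mod_cast hp.two_le
    have hswap : ((p : ℝ) ^ a) ^ η = ((p : ℝ) ^ η) ^ a := by
      rw [← Real.rpow_natCast, ← Real.rpow_natCast, ← Real.rpow_mul (by positivity),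
        ← Real.rpow_mul (by positivity), mul_comm]
    rw [hswap]
    split_ifs with h
    · have h1 : ((2 : ℝ) ^ η) ^ a ≤ ((p : ℝ) ^ η) ^ a := by gcongr
      have h2 : 1 + η * Real.log 2 ≤ (2 : ℝ) ^ η := by
        rw [Real.rpow_def_of_pos two_pos]
        linarith [Real.add_one_le_exp (Real.log 2 * η)]
      have h3 : 1 + (a : ℝ) * (η * Real.log 2) ≤ ((2 : ℝ) ^ η) ^ a :=
        (one_add_mul_le_pow (by linarith) a).trans (by gcongr)
      have h4 : (a : ℝ) + 1 ≤ B * (1 + (a : ℝ) * (η * Real.log 2)) := by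
        have : B * (1 + (a : ℝ) * (η * Real.log 2)) =
            1 + a + (1 / (η * Real.log 2) + a * (η * Real.log 2)) := by
          rw [hB]; field_simp; ring
        rw [this]
        have : 0 ≤ 1 / (η * Real.log 2) + a * (η * Real.log 2) := by positivity
        linarith
      exact h4.trans (by gcongr; exact h3.trans h1)
    · rw [one_mul]
      have hPp : (2 : ℝ) ^ (1 / η) ≤ p :=
        (Nat.le_ceil _).trans (by exact_mod_cast not_lt.1 h)
      have h2 : (2 : ℝ) ≤ (p : ℝ) ^ η := by
        calc (2 : ℝ) = ((2 : ℝ) ^ (1 / η)) ^ η := by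
              rw [← Real.rpow_mul two_pos.le, one_div_mul_cancel hη.ne', Real.rpow_one]
          _ ≤ _ := by gcongr
      have h3 : (a : ℝ) + 1 ≤ 2 ^ a := by exact_mod_cast Nat.lt_two_pow_self
      exact h3.trans (by gcongr)
  refine ⟨B ^ P, one_le_pow₀ hB1, fun n hn => ?_⟩
  have hn' : (n : ℝ) ^ η = ∏ p ∈ n.primeFactors, ((p : ℝ) ^ n.factorization p) ^ η := by
    rw [Real.finsetProd_rpow _ _ (fun _ _ => by positivity)]
    congr 1
    exact_mod_cast (Nat.prod_factorization_pow_eq_self hn).symm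
  have hcount : ∏ p ∈ n.primeFactors, (if p < P then B else 1) ≤ B ^ P := by
    rw [← Finset.prod_filter, Finset.prod_const]
    refine pow_le_pow_right₀ hB1 ?_
    calc #(n.primeFactors.filter (· < P)) ≤ #(range P) :=
          card_le_card fun p hp => mem_range.2 (mem_filter.1 hp).2
      _ = P := card_range P
  rw [Nat.card_divisors hn, hn']
  push_cast
  calc ∏ p ∈ n.primeFactors, ((n.factorization p : ℝ) + 1)
      ≤ ∏ p ∈ n.primeFactors, ((if p < P then B else 1) *
          ((p : ℝ) ^ n.factorization p) ^ η) :=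
        prod_le_prod (fun _ _ => by positivity)
          fun p hp => key p (Nat.prime_of_mem_primeFactors hp) _
    _ ≤ _ := by
        rw [prod_mul_distrib]
        gcongr

/-- Bounding a finite set through the image and the fibres of a map. -/
theorem card_le_mul_of_image_fiber {α β : Type*} [DecidableEq β] (s : Finset α) (f : α → β)
    {A B : ℝ} (hB : 0 ≤ B) (hA : (#(s.image f) : ℝ) ≤ A)
    (h : ∀ b ∈ s.image f, (#{a ∈ s | f a = b} : ℝ) ≤ B) : (#s : ℝ) ≤ A * B := by
  rw [card_eq_sum_card_image f s]
  push_cast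
  calc _ ≤ ∑ _b ∈ s.image f, B := sum_le_sum h
    _ = #(s.image f) * B := by simp
    _ ≤ _ := by gcongr

/-- Two distinct primitive solutions of `α u + β v + γ w = 0` have `γ` dividing the nonzero
determinant of their `(u, v)`-coordinates. -/
theorem abs_le_abs_det_of_linear {α β γ u v w u' v' w' : ℤ}
    (h : α * u + β * v + γ * w = 0) (h' : α * u' + β * v' + γ * w' = 0) (hc : IsCoprime α γ)
    (hdet : v * u' - v' * u ≠ 0) : |γ| ≤ |v * u' - v' * u| := by
  have hdvd : γ ∣ α * (v * u' - v' * u) :=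
    ⟨v' * w - v * w', by linear_combination v * h' - v' * h⟩
  exact Int.le_of_dvd (abs_pos.2 hdet) ((abs_dvd_abs _ _).2 (hc.symm.dvd_of_dvd_mul_left hdvd))

theorem eq_of_coprime_of_mul_eq {u v u' v' : ℕ} (h : u.Coprime v) (h' : u'.Coprime v')
    (he : v * u' = v' * u) : u = u' ∧ v = v' := by
  have h1 : u ∣ u' := h.dvd_of_dvd_mul_left ⟨v', by rw [he, mul_comm]⟩
  have h2 : u' ∣ u := h'.dvd_of_dvd_mul_left ⟨v, by rw [← he, mul_comm]⟩
  have h3 : v ∣ v' := h.symm.dvd_of_dvd_mul_right ⟨u', he.symm⟩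
  have h4 : v' ∣ v := h'.symm.dvd_of_dvd_mul_right ⟨u, he⟩
  exact ⟨Nat.dvd_antisymm h1 h2, Nat.dvd_antisymm h3 h4⟩

/-- Primitive solutions of `α u + β v + γ w = 0` with `u ≍ U` and `v ≪ V` number
`O(1 + U V / |γ|)`, since their slopes `v / u` are well spaced. -/
theorem card_le_of_linear {ι : Type*} (s : Finset ι) (u v w : ι → ℕ) {α β γ : ℤ} (hγ : γ ≠ 0)
    (h0 : ∀ p ∈ s, α * u p + β * v p + γ * w p = 0) (hc : IsCoprime α γ)
    (huv : ∀ p ∈ s, (u p).Coprime (v p))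
    (hinj : ∀ p ∈ s, ∀ q ∈ s, u p = u q → v p = v q → p = q)
    {K U V : ℝ} (hK : 1 ≤ K) (hU0 : 0 < U) (hV0 : 0 ≤ V)
    (hU : ∀ p ∈ s, U ≤ u p ∧ (u p : ℝ) ≤ K * U) (hV : ∀ p ∈ s, (v p : ℝ) ≤ K * V) :
    (#s : ℝ) ≤ 1 + K ^ 3 * (U * V / |(γ : ℝ)|) := by
  have hγ' : 0 < |(γ : ℝ)| := abs_pos.2 (by exact_mod_cast hγ)
  have hK0 : 0 < K := by linarith
  set δ : ℝ := |(γ : ℝ)| / (K * U) ^ 2 with hδ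
  have hδ0 : 0 < δ := by positivity
  set N : ℝ := K ^ 3 * (U * V / |(γ : ℝ)|) with hN
  have hN0 : 0 ≤ N := by positivity
  let f : ι → ℕ := fun p => ⌊(v p : ℝ) / u p / δ⌋₊
  have hmaps : Set.MapsTo f s (range (⌊N⌋₊ + 1)) := by
    intro p hp
    obtain ⟨h1, h2⟩ := hU p hp
    simp only [coe_range, Set.mem_Iio, f]
    refine Nat.lt_succ_of_le (Nat.floor_le_floor ?_)
    calc (v p : ℝ) / u p / δ ≤ K * V / U / δ := by gcongr; exact hV p hp
      _ = N := by rw [hN, hδ]; field_simp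
  have hinj' : Set.InjOn f s := by
    intro p hp q hq hpq
    by_contra hne
    have hp0 : (0 : ℝ) < u p := hU0.trans_le (hU p hp).1
    have hq0 : (0 : ℝ) < u q := hU0.trans_le (hU q hq).1
    have hdet : (v p : ℤ) * u q - v q * u p ≠ 0 := by
      intro h
      obtain ⟨h1, h2⟩ := eq_of_coprime_of_mul_eq (huv p hp) (huv q hq)
        (by exact_mod_cast sub_eq_zero.1 h)
      exact hne (hinj p hp q hq h1 h2)
    have hle := abs_le_abs_det_of_linear (h0 p hp) (h0 q hq) hc hdet
    have hle' : |(γ : ℝ)| ≤ |(v p : ℝ) * u q - v q * u p| := by exact_mod_cast hle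
    have hlt : |(v p : ℝ) / u p / δ - (v q : ℝ) / u q / δ| < 1 := by
      have a1 := Nat.floor_le (a := (v p : ℝ) / u p / δ) (by positivity)
      have a2 := Nat.floor_le (a := (v q : ℝ) / u q / δ) (by positivity)
      have a3 := Nat.lt_floor_add_one ((v p : ℝ) / u p / δ)
      have a4 := Nat.lt_floor_add_one ((v q : ℝ) / u q / δ)
      have a5 : (⌊(v p : ℝ) / u p / δ⌋₊ : ℝ) = ⌊(v q : ℝ) / u q / δ⌋₊ := by exact_mod_cast hpq
      rw [abs_lt]
      constructor <;> linarith
    have heq : (v p : ℝ) / u p / δ - (v q : ℝ) / u q / δ =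
        ((v p : ℝ) * u q - v q * u p) / (u p * u q * δ) := by field_simp
    rw [heq, abs_div, abs_of_pos (by positivity : (0 : ℝ) < u p * u q * δ),
      div_lt_one (by positivity)] at hlt
    have hprod : (u p : ℝ) * u q * δ ≤ |(γ : ℝ)| := by
      calc (u p : ℝ) * u q * δ ≤ (K * U) * (K * U) * δ := by
            gcongr
            · exact (hU p hp).2
            · exact (hU q hq).2
        _ = _ := by rw [hδ]; field_simp
    linarith
  have hcard := card_le_card_of_injOn f hmaps hinj'
  rw [card_range] at hcard
  calc (#s : ℝ) ≤ (⌊N⌋₊ : ℝ) + 1 := by exact_mod_cast hcard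
    _ ≤ 1 + N := by linarith [Nat.floor_le hN0]

/-- The weighted product `∏ x_i ^ i` over a set of indices. -/
def weightedProd {d : ℕ} (s : Finset (Fin d)) (x : Fin d → ℕ) : ℕ :=
  ∏ i ∈ s, x i ^ ((i : ℕ) + 1)

/-- The restriction of `x` to the indices in `s`, extended by `1`. -/
def restrictOne {d : ℕ} (s : Finset (Fin d)) (x : Fin d → ℕ) : Fin d → ℕ :=
  fun i => if i ∈ s then x i else 1

theorem weightedProd_restrictOne {d : ℕ} (s : Finset (Fin d)) (x : Fin d → ℕ) :
    weightedProd s (restrictOne s x) = weightedProd s x :=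
  prod_congr rfl fun i hi => by simp [restrictOne, hi]

theorem weightedProd_mul_compl {d : ℕ} (s : Finset (Fin d)) (x : Fin d → ℕ) :
    (weightedProd s x : ℤ) * weightedProd sᶜ x = ∏ i, (x i : ℤ) ^ ((i : ℕ) + 1) := by
  rw [← prod_mul_prod_compl s]
  simp [weightedProd]

theorem eq_of_restrictOne_eq {d : ℕ} {s : Finset (Fin d)} {x y : Fin d → ℕ}
    (h : restrictOne s x = restrictOne s y) (h' : restrictOne sᶜ x = restrictOne sᶜ y) :
    x = y := by
  funext i
  by_cases hi : i ∈ s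
  · simpa [restrictOne, hi] using congrFun h i
  · simpa [restrictOne, hi] using congrFun h' i

theorem restrictOne_mem_piFinset_divisors {d : ℕ} (s : Finset (Fin d)) {x : Fin d → ℕ}
    (hx : ∀ i, x i ≠ 0) :
    restrictOne s x ∈ Fintype.piFinset fun _ : Fin d => (weightedProd s x).divisors := by
  have h0 : weightedProd s x ≠ 0 := prod_ne_zero_iff.2 fun i _ => pow_ne_zero _ (hx i)
  refine Fintype.mem_piFinset.2 fun i => Nat.mem_divisors.2 ⟨?_, h0⟩
  by_cases hi : i ∈ s
  · simp only [restrictOne, hi, if_true]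
    exact (dvd_pow_self _ (Nat.succ_ne_zero _)).trans
      (dvd_prod_of_mem (fun i => x i ^ ((i : ℕ) + 1)) hi)
  · simp [restrictOne, hi]

/-- The tuple `x` lies in the dyadic box determined by `X`. -/
def InDyadicBox {d : ℕ} (X : Fin d → ℝ) (x : Fin d → ℕ) : Prop :=
  ∀ i, X i ≤ (x i : ℝ) ∧ (x i : ℝ) < 2 * X i

theorem InDyadicBox.ne_zero {d : ℕ} {X : Fin d → ℝ} {x : Fin d → ℕ} (h : InDyadicBox X x)
    (hX : ∀ i, 1 ≤ X i) (i : Fin d) : x i ≠ 0 := by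
  have : (0 : ℝ) < x i := by linarith [(h i).1, hX i]
  exact_mod_cast this.ne'

theorem InDyadicBox.mem_piFinset {d : ℕ} {X : Fin d → ℝ} {x : Fin d → ℕ}
    (h : InDyadicBox X x) : x ∈ Fintype.piFinset fun i => range ⌈2 * X i⌉₊ :=
  Fintype.mem_piFinset.2 fun i => mem_range.2 (Nat.lt_ceil.2 (h i).2)

theorem InDyadicBox.le_weightedProd {d : ℕ} {X : Fin d → ℝ} {x : Fin d → ℕ}
    (h : InDyadicBox X x) (hX : ∀ i, 1 ≤ X i) (s : Finset (Fin d)) :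
    ∏ i ∈ s, X i ^ ((i : ℕ) + 1) ≤ (weightedProd s x : ℝ) := by
  rw [weightedProd]
  push_cast
  refine prod_le_prod (fun i _ => by have := hX i; positivity) fun i _ => ?_
  have := hX i
  gcongr
  exact (h i).1

theorem InDyadicBox.weightedProd_le {d : ℕ} {X : Fin d → ℝ} {x : Fin d → ℕ}
    (h : InDyadicBox X x) (hX : ∀ i, 1 ≤ X i) (s : Finset (Fin d)) :
    (weightedProd s x : ℝ) ≤ (2 ^ d) ^ d * ∏ i ∈ s, X i ^ ((i : ℕ) + 1) := by
  have hs : #s ≤ d := by simpa using card_le_univ s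
  have hnn : (0 : ℝ) ≤ ∏ i ∈ s, X i ^ ((i : ℕ) + 1) :=
    prod_nonneg fun i _ => by have := hX i; positivity
  rw [weightedProd]
  push_cast
  calc ∏ i ∈ s, (x i : ℝ) ^ ((i : ℕ) + 1)
      ≤ ∏ i ∈ s, (2 ^ d * X i ^ ((i : ℕ) + 1)) := by
        refine prod_le_prod (fun _ _ => by positivity) fun i _ => ?_
        have := hX i
        calc (x i : ℝ) ^ ((i : ℕ) + 1) ≤ (2 * X i) ^ ((i : ℕ) + 1) := by
              gcongr; exact (h i).2.le
          _ = 2 ^ ((i : ℕ) + 1) * X i ^ ((i : ℕ) + 1) := mul_pow _ _ _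
          _ ≤ _ := by
              gcongr
              · norm_num
              · exact i.2
    _ = (2 ^ d) ^ #s * ∏ i ∈ s, X i ^ ((i : ℕ) + 1) := by
        rw [prod_mul_distrib, prod_const]
    _ ≤ _ := by
        gcongr
        exact one_le_pow₀ (by norm_num)

theorem InDyadicBox.weightedProd_le_pow {d : ℕ} {X : Fin d → ℝ} {x : Fin d → ℕ}
    (h : InDyadicBox X x) {M : ℝ} (hM : 1 ≤ M) (hXM : ∀ i, X i ≤ M) (s : Finset (Fin d)) :
    (weightedProd s x : ℝ) ≤ ((2 * M) ^ d) ^ d := by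
  have hs : #s ≤ d := by simpa using card_le_univ s
  have h1 : 1 ≤ 2 * M := by linarith
  rw [weightedProd]
  push_cast
  calc ∏ i ∈ s, (x i : ℝ) ^ ((i : ℕ) + 1) ≤ ∏ _i ∈ s, (2 * M) ^ d := by
        refine prod_le_prod (fun _ _ => by positivity) fun i _ => ?_
        calc (x i : ℝ) ^ ((i : ℕ) + 1) ≤ (2 * M) ^ ((i : ℕ) + 1) := by
              gcongr; linarith [(h i).2, hXM i]
          _ ≤ _ := pow_le_pow_right₀ h1 i.2
    _ = ((2 * M) ^ d) ^ #s := prod_const _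
    _ ≤ _ := pow_le_pow_right₀ (one_le_pow₀ h1) hs

theorem card_image_restrictOne_le {ι : Type*} {d : ℕ} (F : Finset ι) (x : ι → Fin d → ℕ)
    {X : Fin d → ℝ} (hX : ∀ i, 1 ≤ X i) (hx : ∀ t ∈ F, InDyadicBox X (x t))
    (s : Finset (Fin d)) :
    (#(F.image fun t => restrictOne s (x t)) : ℝ) ≤ 3 ^ d * ∏ i ∈ s, X i := by
  have hs : #s ≤ d := by simpa using card_le_univ s
  have hnn : (0 : ℝ) ≤ ∏ i ∈ s, X i := prod_nonneg fun i _ => by linarith [hX i]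
  have hsub : (F.image fun t => restrictOne s (x t)) ⊆
      Fintype.piFinset fun i => if i ∈ s then range ⌈2 * X i⌉₊ else {1} := by
    intro y hy
    obtain ⟨t, ht, rfl⟩ := mem_image.1 hy
    refine Fintype.mem_piFinset.2 fun i => ?_
    by_cases hi : i ∈ s
    · simpa only [restrictOne, hi, if_true] using
        Fintype.mem_piFinset.1 (hx t ht).mem_piFinset i
    · simp [restrictOne, hi]
  have hcard : (#(Fintype.piFinset fun i => if i ∈ s then range ⌈2 * X i⌉₊ else {1}) : ℝ) =
      ∏ i ∈ s, (⌈2 * X i⌉₊ : ℝ) := by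
    rw [Fintype.card_piFinset, ← prod_mul_prod_compl s,
      prod_congr (s₂ := s) (g := fun i => ⌈2 * X i⌉₊) rfl (fun i hi => by simp [hi]),
      prod_eq_one (s := sᶜ) fun i hi => by simp [mem_compl.1 hi]]
    simp
  calc (#(F.image fun t => restrictOne s (x t)) : ℝ) ≤ ∏ i ∈ s, (⌈2 * X i⌉₊ : ℝ) := by
        rw [← hcard]; exact_mod_cast card_le_card hsub
    _ ≤ ∏ i ∈ s, (3 * X i) := by
        refine prod_le_prod (fun _ _ => by positivity) fun i _ => ?_
        have := hX i
        linarith [Nat.ceil_lt_add_one (a := 2 * X i) (by linarith)]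
    _ = 3 ^ #s * ∏ i ∈ s, X i := by rw [prod_mul_distrib, prod_const]
    _ ≤ _ := by
        gcongr
        norm_num

theorem dvd_mul_prod_of_dvd_mul_prod_pow {d : ℕ} {c p : ℤ} {x : Fin d → ℕ} (hp : Prime p)
    (h : p ∣ c * ∏ i, (x i : ℤ) ^ ((i : ℕ) + 1)) : p ∣ c * ∏ i, (x i : ℤ) := by
  rcases hp.dvd_or_dvd h with h | h
  · exact h.mul_right _
  · obtain ⟨i, -, hi⟩ := (hp.dvd_finsetProd_iff _).1 h
    exact ((hp.dvd_of_dvd_pow hi).trans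
      (dvd_prod_of_mem (fun i => (x i : ℤ)) (mem_univ i))).mul_left _

/-- If `A + B = C` and the primes dividing `A`, `B`, `C` divide `A'`, `B'`, `C'` respectively,
where `gcd(A', B', C') = 1`, then `A`, `B`, `C` are pairwise coprime. -/
theorem pairwise_isCoprime_of_gcd_eq_one {A B C A' B' C' : ℤ} (hA : A ≠ 0) (hB : B ≠ 0)
    (h : A + B = C) (hg : Int.gcd A' (Int.gcd B' C' : ℤ) = 1)
    (hA' : ∀ p, Prime p → p ∣ A → p ∣ A') (hB' : ∀ p, Prime p → p ∣ B → p ∣ B')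
    (hC' : ∀ p, Prime p → p ∣ C → p ∣ C') : IsCoprime A B ∧ IsCoprime A C ∧ IsCoprime B C := by
  have key : ∀ p, Prime p → p ∣ A → p ∣ B → p ∣ C → False := by
    intro p hp h1 h2 h3
    have := Int.dvd_coe_gcd (hA' p hp h1) (Int.dvd_coe_gcd (hB' p hp h2) (hC' p hp h3))
    rw [hg] at this
    exact hp.not_isUnit (isUnit_of_dvd_one (by exact_mod_cast this))
  refine ⟨isCoprime_of_prime_dvd (fun h => hA h.1) fun p hp h1 h2 => ?_,
    isCoprime_of_prime_dvd (fun h => hA h.1) fun p hp h1 h2 => ?_,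
    isCoprime_of_prime_dvd (fun h => hB h.1) fun p hp h1 h2 => ?_⟩
  · exact key p hp h1 h2 (h ▸ dvd_add h1 h2)
  · exact key p hp h1 ((dvd_add_right h1).1 (h ▸ h2)) h2
  · exact key p hp ((dvd_add_left h1).1 (h ▸ h2)) h1 h2

/-- The tuples counted by `Bcount`. -/
def IsCounted {d : ℕ} (c₁ c₂ c₃ : ℤ) (X Y Z : Fin d → ℝ)
    (t : (Fin d → ℕ) × (Fin d → ℕ) × (Fin d → ℕ)) : Prop :=
  InDyadicBox X t.1 ∧ InDyadicBox Y t.2.1 ∧ InDyadicBox Z t.2.2 ∧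
    c₁ * ∏ j, (t.1 j : ℤ) ^ ((j : ℕ) + 1) + c₂ * ∏ j, (t.2.1 j : ℤ) ^ ((j : ℕ) + 1)
      = c₃ * ∏ j, (t.2.2 j : ℤ) ^ ((j : ℕ) + 1) ∧
    Int.gcd (c₁ * ∏ j, (t.1 j : ℤ))
      ((Int.gcd (c₂ * ∏ j, (t.2.1 j : ℤ)) (c₃ * ∏ j, (t.2.2 j : ℤ)) : ℤ)) = 1

theorem IsCounted.isCoprime {d : ℕ} {c₁ c₂ c₃ : ℤ} {X Y Z : Fin d → ℝ}
    {t : (Fin d → ℕ) × (Fin d → ℕ) × (Fin d → ℕ)} (h : IsCounted c₁ c₂ c₃ X Y Z t)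
    (hX : ∀ i, 1 ≤ X i) (hY : ∀ i, 1 ≤ Y i) (h₁ : c₁ ≠ 0) (h₂ : c₂ ≠ 0) :
    IsCoprime (c₁ * ∏ j, (t.1 j : ℤ) ^ ((j : ℕ) + 1))
        (c₂ * ∏ j, (t.2.1 j : ℤ) ^ ((j : ℕ) + 1)) ∧
      IsCoprime (c₁ * ∏ j, (t.1 j : ℤ) ^ ((j : ℕ) + 1))
        (c₃ * ∏ j, (t.2.2 j : ℤ) ^ ((j : ℕ) + 1)) ∧
      IsCoprime (c₂ * ∏ j, (t.2.1 j : ℤ) ^ ((j : ℕ) + 1))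
        (c₃ * ∏ j, (t.2.2 j : ℤ) ^ ((j : ℕ) + 1)) := by
  obtain ⟨hx, hy, -, heq, hg⟩ := h
  refine pairwise_isCoprime_of_gcd_eq_one (mul_ne_zero h₁ ?_) (mul_ne_zero h₂ ?_) heq hg
    (fun p hp => dvd_mul_prod_of_dvd_mul_prod_pow hp)
    (fun p hp => dvd_mul_prod_of_dvd_mul_prod_pow hp)
    (fun p hp => dvd_mul_prod_of_dvd_mul_prod_pow hp)
  · exact prod_ne_zero_iff.2 fun i _ => pow_ne_zero _ (by exact_mod_cast hx.ne_zero hX i)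
  · exact prod_ne_zero_iff.2 fun i _ => pow_ne_zero _ (by exact_mod_cast hy.ne_zero hY i)

theorem mul_div_le_mul_div_of_split {U V W g c P Q : ℝ} (hU : 0 ≤ U) (hV : 0 ≤ V) (hW : 0 < W)
    (hP : 0 < P) (hc : 0 < c) (hQ : P * W = Q) (hg : c * P ≤ g) :
    U * V / g ≤ U * V * W / (c * Q) := by
  calc U * V / g ≤ U * V / (c * P) := by gcongr
    _ = _ := by rw [← hQ]; field_simp

/-- The weighted products over the complements of the three index sets. -/
def complProds {d : ℕ} (I I' I'' : Finset (Fin d))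
    (t : (Fin d → ℕ) × (Fin d → ℕ) × (Fin d → ℕ)) : ℕ × ℕ × ℕ :=
  (weightedProd Iᶜ t.1, weightedProd I'ᶜ t.2.1, weightedProd I''ᶜ t.2.2)

/-- The restrictions to the three index sets. -/
def restrictOnes {d : ℕ} (I I' I'' : Finset (Fin d))
    (t : (Fin d → ℕ) × (Fin d → ℕ) × (Fin d → ℕ)) :
    (Fin d → ℕ) × (Fin d → ℕ) × (Fin d → ℕ) :=
  (restrictOne I t.1, restrictOne I' t.2.1, restrictOne I'' t.2.2)

theorem card_image_complProds_le {d : ℕ} {c₁ c₂ c₃ : ℤ} {X Y Z : Fin d → ℝ}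
    (hX : ∀ i, 1 ≤ X i) (hY : ∀ i, 1 ≤ Y i) (hZ : ∀ i, 1 ≤ Z i)
    (h₁ : c₁ ≠ 0) (h₂ : c₂ ≠ 0) (h₃ : c₃ ≠ 0) (I I' I'' : Finset (Fin d))
    (F : Finset ((Fin d → ℕ) × (Fin d → ℕ) × (Fin d → ℕ)))
    (hF : ∀ t ∈ F, IsCounted c₁ c₂ c₃ X Y Z t)
    (a : (Fin d → ℕ) × (Fin d → ℕ) × (Fin d → ℕ)) (ha : ∀ t ∈ F, restrictOnes I I' I'' t = a) :
    (#(F.image (complProds I I' I'')) : ℝ) ≤ 1 + ((2 ^ d) ^ d) ^ 3 *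
      ((∏ i ∈ Iᶜ, X i ^ ((i : ℕ) + 1)) * (∏ i ∈ I'ᶜ, Y i ^ ((i : ℕ) + 1)) *
        (∏ i ∈ I''ᶜ, Z i ^ ((i : ℕ) + 1)) /
          max ((|c₁| : ℝ) * ∏ i, X i ^ ((i : ℕ) + 1))
            (max ((|c₂| : ℝ) * ∏ i, Y i ^ ((i : ℕ) + 1))
              ((|c₃| : ℝ) * ∏ i, Z i ^ ((i : ℕ) + 1)))) := by
  have hpos : ∀ {X : Fin d → ℝ}, (∀ i, 1 ≤ X i) → ∀ s : Finset (Fin d),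
      0 < ∏ i ∈ s, X i ^ ((i : ℕ) + 1) := fun hX s =>
    prod_pos fun i _ => pow_pos (by linarith [hX i]) _
  rcases F.eq_empty_or_nonempty with rfl | ⟨t₀, ht₀⟩
  · have := hpos hX Iᶜ
    have := hpos hY I'ᶜ
    have := hpos hZ I''ᶜ
    have := hpos hX univ
    have : 0 < max ((|c₁| : ℝ) * ∏ i, X i ^ ((i : ℕ) + 1))
            (max ((|c₂| : ℝ) * ∏ i, Y i ^ ((i : ℕ) + 1))
              ((|c₃| : ℝ) * ∏ i, Z i ^ ((i : ℕ) + 1))) :=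
      lt_max_of_lt_left (mul_pos (abs_pos.2 (by exact_mod_cast h₁)) this)
    simp only [image_empty, card_empty, Nat.cast_zero]
    positivity
  set K : ℝ := (2 ^ d) ^ d with hK
  have hK1 : 1 ≤ K := one_le_pow₀ (one_le_pow₀ one_le_two)
  set α : ℤ := c₁ * weightedProd I t₀.1 with hα
  set β : ℤ := c₂ * weightedProd I' t₀.2.1 with hβ
  set γ : ℤ := c₃ * weightedProd I'' t₀.2.2 with hγ
  have hsame : ∀ t ∈ F, c₁ * ∏ j, (t.1 j : ℤ) ^ ((j : ℕ) + 1) = α * weightedProd Iᶜ t.1 ∧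
      c₂ * ∏ j, (t.2.1 j : ℤ) ^ ((j : ℕ) + 1) = β * weightedProd I'ᶜ t.2.1 ∧
      c₃ * ∏ j, (t.2.2 j : ℤ) ^ ((j : ℕ) + 1) = γ * weightedProd I''ᶜ t.2.2 := by
    intro t ht
    have he := (ha t ht).trans (ha t₀ ht₀).symm
    simp only [restrictOnes, Prod.mk.injEq] at he
    rw [hα, hβ, hγ, ← weightedProd_restrictOne I t₀.1, ← weightedProd_restrictOne I' t₀.2.1,
      ← weightedProd_restrictOne I'' t₀.2.2, ← he.1, ← he.2.1, ← he.2.2,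
      weightedProd_restrictOne, weightedProd_restrictOne, weightedProd_restrictOne,
      mul_assoc, mul_assoc, mul_assoc, weightedProd_mul_compl, weightedProd_mul_compl,
      weightedProd_mul_compl]
    exact ⟨rfl, rfl, rfl⟩
  have hne : ∀ {X : Fin d → ℝ} {x : Fin d → ℕ}, (∀ i, 1 ≤ X i) → InDyadicBox X x →
      ∀ s : Finset (Fin d), (weightedProd s x : ℤ) ≠ 0 := fun hX hx s => by
    exact_mod_cast prod_ne_zero_iff.2 fun i _ => pow_ne_zero _ (hx.ne_zero hX i)
  obtain ⟨hx₀, hy₀, hz₀, -, -⟩ := hF t₀ ht₀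
  have hα0 : α ≠ 0 := mul_ne_zero h₁ (hne hX hx₀ I)
  have hβ0 : β ≠ 0 := mul_ne_zero h₂ (hne hY hy₀ I')
  have hγ0 : γ ≠ 0 := mul_ne_zero h₃ (hne hZ hz₀ I'')
  have hcop : ∀ t ∈ F, IsCoprime (α * weightedProd Iᶜ t.1) (β * weightedProd I'ᶜ t.2.1) ∧
      IsCoprime (α * weightedProd Iᶜ t.1) (γ * weightedProd I''ᶜ t.2.2) ∧
      IsCoprime (β * weightedProd I'ᶜ t.2.1) (γ * weightedProd I''ᶜ t.2.2) := by
    intro t ht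
    obtain ⟨e1, e2, e3⟩ := hsame t ht
    rw [← e1, ← e2, ← e3]
    exact (hF t ht).isCoprime hX hY h₁ h₂
  have hαβ : IsCoprime α β := (hcop t₀ ht₀).1.of_mul_left_left.of_mul_right_left
  have hαγ : IsCoprime α γ := (hcop t₀ ht₀).2.1.of_mul_left_left.of_mul_right_left
  set S := F.image (complProds I I' I'') with hS
  have hmem : ∀ p ∈ S, ∃ t ∈ F, (weightedProd Iᶜ t.1, weightedProd I'ᶜ t.2.1,
      weightedProd I''ᶜ t.2.2) = p := fun p hp => mem_image.1 hp
  have hlin : ∀ p ∈ S, α * p.1 + β * p.2.1 = γ * p.2.2 := by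
    intro p hp
    obtain ⟨t, ht, rfl⟩ := hmem p hp
    obtain ⟨e1, e2, e3⟩ := hsame t ht
    simp only
    rw [← e1, ← e2, ← e3]
    exact (hF t ht).2.2.2.1
  have huv : ∀ p ∈ S, p.1.Coprime p.2.1 := by
    intro p hp
    obtain ⟨t, ht, rfl⟩ := hmem p hp
    exact Nat.isCoprime_iff_coprime.1 (hcop t ht).1.of_mul_left_right.of_mul_right_right
  have huw : ∀ p ∈ S, p.1.Coprime p.2.2 := by
    intro p hp
    obtain ⟨t, ht, rfl⟩ := hmem p hp
    exact Nat.isCoprime_iff_coprime.1 (hcop t ht).2.1.of_mul_left_right.of_mul_right_right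
  have hvw : ∀ p ∈ S, p.2.1.Coprime p.2.2 := by
    intro p hp
    obtain ⟨t, ht, rfl⟩ := hmem p hp
    exact Nat.isCoprime_iff_coprime.1 (hcop t ht).2.2.of_mul_left_right.of_mul_right_right
  have hbox : ∀ p ∈ S,
      ((∏ i ∈ Iᶜ, X i ^ ((i : ℕ) + 1)) ≤ p.1 ∧
        (p.1 : ℝ) ≤ K * ∏ i ∈ Iᶜ, X i ^ ((i : ℕ) + 1)) ∧
      ((∏ i ∈ I'ᶜ, Y i ^ ((i : ℕ) + 1)) ≤ p.2.1 ∧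
        (p.2.1 : ℝ) ≤ K * ∏ i ∈ I'ᶜ, Y i ^ ((i : ℕ) + 1)) ∧
      ((∏ i ∈ I''ᶜ, Z i ^ ((i : ℕ) + 1)) ≤ p.2.2 ∧
        (p.2.2 : ℝ) ≤ K * ∏ i ∈ I''ᶜ, Z i ^ ((i : ℕ) + 1)) := by
    intro p hp
    obtain ⟨t, ht, rfl⟩ := hmem p hp
    obtain ⟨hx, hy, hz, -, -⟩ := hF t ht
    exact ⟨⟨hx.le_weightedProd hX _, hx.weightedProd_le hX _⟩,
      ⟨hy.le_weightedProd hY _, hy.weightedProd_le hY _⟩,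
      ⟨hz.le_weightedProd hZ _, hz.weightedProd_le hZ _⟩⟩
  have hU := hpos hX Iᶜ
  have hV := hpos hY I'ᶜ
  have hW := hpos hZ I''ᶜ
  have habs : ∀ {X : Fin d → ℝ} {x : Fin d → ℕ}, (∀ i, 1 ≤ X i) → InDyadicBox X x →
      ∀ (c : ℤ) (s : Finset (Fin d)), |(c : ℝ)| * ∏ i ∈ s, X i ^ ((i : ℕ) + 1) ≤
        |((c * weightedProd s x : ℤ) : ℝ)| := by
    intro X x hX hx c s
    push_cast
    rw [abs_mul, Nat.abs_cast]
    gcongr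
    exact hx.le_weightedProd hX s
  have b1 : (#S : ℝ) ≤ 1 + K ^ 3 * ((∏ i ∈ I'ᶜ, Y i ^ ((i : ℕ) + 1)) *
      (∏ i ∈ I''ᶜ, Z i ^ ((i : ℕ) + 1)) / |(α : ℝ)|) := by
    refine card_le_of_linear S (fun p => p.2.1) (fun p => p.2.2) (fun p => p.1)
      (α := β) (β := -γ) hα0 (fun p hp => ?_) hαβ.symm hvw
      (fun p hp q hq e1 e2 => ?_) hK1 hV hW.le (fun p hp => (hbox p hp).2.1)
      (fun p hp => (hbox p hp).2.2.2)
    · linear_combination hlin p hp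
    · have e3 : α * p.1 = α * q.1 := by
        have := hlin p hp
        have := hlin q hq
        simp only [e1, e2] at *
        linarith
      have e4 : p.1 = q.1 := by exact_mod_cast mul_left_cancel₀ hα0 e3
      exact Prod.ext e4 (Prod.ext e1 e2)
  have b2 : (#S : ℝ) ≤ 1 + K ^ 3 * ((∏ i ∈ Iᶜ, X i ^ ((i : ℕ) + 1)) *
      (∏ i ∈ I''ᶜ, Z i ^ ((i : ℕ) + 1)) / |(β : ℝ)|) := by
    refine card_le_of_linear S (fun p => p.1) (fun p => p.2.2) (fun p => p.2.1)
      (α := α) (β := -γ) hβ0 (fun p hp => ?_) hαβ huw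
      (fun p hp q hq e1 e2 => ?_) hK1 hU hW.le (fun p hp => (hbox p hp).1)
      (fun p hp => (hbox p hp).2.2.2)
    · linear_combination hlin p hp
    · have e3 : β * p.2.1 = β * q.2.1 := by
        have := hlin p hp
        have := hlin q hq
        simp only [e1, e2] at *
        linarith
      have e4 : p.2.1 = q.2.1 := by exact_mod_cast mul_left_cancel₀ hβ0 e3
      exact Prod.ext e1 (Prod.ext e4 e2)
  have b3 : (#S : ℝ) ≤ 1 + K ^ 3 * ((∏ i ∈ Iᶜ, X i ^ ((i : ℕ) + 1)) *
      (∏ i ∈ I'ᶜ, Y i ^ ((i : ℕ) + 1)) / |(γ : ℝ)|) := by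
    have := card_le_of_linear S (fun p => p.1) (fun p => p.2.1) (fun p => p.2.2)
      (α := α) (β := β) (γ := -γ) (neg_ne_zero.2 hγ0) (fun p hp => ?_) hαγ.neg_right huv
      (fun p hp q hq e1 e2 => ?_) hK1 hU hV.le (fun p hp => (hbox p hp).1)
      (fun p hp => (hbox p hp).2.1.2)
    · simpa using this
    · linear_combination hlin p hp
    · have e3 : γ * p.2.2 = γ * q.2.2 := by
        have := hlin p hp
        have := hlin q hq
        simp only [e1, e2] at *
        linarith
      have e4 : p.2.2 = q.2.2 := by exact_mod_cast mul_left_cancel₀ hγ0 e3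
      exact Prod.ext e1 (Prod.ext e2 e4)
  have k1 := mul_div_le_mul_div_of_split hV.le hW.le hU (hpos hX I)
    (abs_pos.2 (Int.cast_ne_zero.2 h₁)) (prod_mul_prod_compl I _) (habs hX hx₀ c₁ I)
  have k2 := mul_div_le_mul_div_of_split hU.le hW.le hV (hpos hY I')
    (abs_pos.2 (Int.cast_ne_zero.2 h₂)) (prod_mul_prod_compl I' _) (habs hY hy₀ c₂ I')
  have k3 := mul_div_le_mul_div_of_split hU.le hV.le hW (hpos hZ I'')
    (abs_pos.2 (Int.cast_ne_zero.2 h₃)) (prod_mul_prod_compl I'' _) (habs hZ hz₀ c₃ I'')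
  rw [mul_right_comm] at k2
  rw [mul_right_comm, mul_comm (∏ i ∈ I'ᶜ, Y i ^ ((i : ℕ) + 1))
    (∏ i ∈ Iᶜ, X i ^ ((i : ℕ) + 1))] at k1
  rcases max_choice ((|c₁| : ℝ) * ∏ i, X i ^ ((i : ℕ) + 1))
      (max ((|c₂| : ℝ) * ∏ i, Y i ^ ((i : ℕ) + 1))
        ((|c₃| : ℝ) * ∏ i, Z i ^ ((i : ℕ) + 1))) with h | h
  · rw [h]
    exact b1.trans (by gcongr)
  · rw [h]
    rcases max_choice ((|c₂| : ℝ) * ∏ i, Y i ^ ((i : ℕ) + 1))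
        ((|c₃| : ℝ) * ∏ i, Z i ^ ((i : ℕ) + 1)) with h | h
    · rw [h]
      exact b2.trans (by gcongr)
    · rw [h]
      exact b3.trans (by gcongr)

theorem card_fiber_le {d : ℕ} (I I' I'' : Finset (Fin d))
    (F : Finset ((Fin d → ℕ) × (Fin d → ℕ) × (Fin d → ℕ)))
    (hF : ∀ t ∈ F, (∀ i, t.1 i ≠ 0) ∧ (∀ i, t.2.1 i ≠ 0) ∧ ∀ i, t.2.2 i ≠ 0)
    (a : (Fin d → ℕ) × (Fin d → ℕ) × (Fin d → ℕ)) (ha : ∀ t ∈ F, restrictOnes I I' I'' t = a)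
    (b : ℕ × ℕ × ℕ) (hb : ∀ t ∈ F, complProds I I' I'' t = b) :
    #F ≤ #b.1.divisors ^ d * (#b.2.1.divisors ^ d * #b.2.2.divisors ^ d) := by
  have hmaps : Set.MapsTo (restrictOnes Iᶜ I'ᶜ I''ᶜ) F
      ((Fintype.piFinset fun _ : Fin d => b.1.divisors) ×ˢ
        (Fintype.piFinset fun _ : Fin d => b.2.1.divisors) ×ˢ
        (Fintype.piFinset fun _ : Fin d => b.2.2.divisors) : Finset _) := by
    intro t ht
    obtain ⟨h1, h2, h3⟩ := hF t ht
    rw [← hb t ht]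
    exact mem_coe.2 (mem_product.2 ⟨restrictOne_mem_piFinset_divisors _ h1,
      mem_product.2 ⟨restrictOne_mem_piFinset_divisors _ h2,
        restrictOne_mem_piFinset_divisors _ h3⟩⟩)
  have hinj : Set.InjOn (restrictOnes Iᶜ I'ᶜ I''ᶜ) F := by
    intro t ht t' ht' h
    have h' := (ha t ht).trans (ha t' ht').symm
    simp only [restrictOnes, Prod.mk.injEq] at h h'
    exact Prod.ext (eq_of_restrictOne_eq h'.1 h.1)
      (Prod.ext (eq_of_restrictOne_eq h'.2.1 h.2.1) (eq_of_restrictOne_eq h'.2.2 h.2.2))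
  simpa [card_product, Fintype.card_piFinset] using card_le_card_of_injOn _ hmaps hinj

theorem card_image_restrictOnes_le {d : ℕ} {X Y Z : Fin d → ℝ}
    (hX : ∀ i, 1 ≤ X i) (hY : ∀ i, 1 ≤ Y i) (hZ : ∀ i, 1 ≤ Z i) (I I' I'' : Finset (Fin d))
    (F : Finset ((Fin d → ℕ) × (Fin d → ℕ) × (Fin d → ℕ)))
    (hF : ∀ t ∈ F, InDyadicBox X t.1 ∧ InDyadicBox Y t.2.1 ∧ InDyadicBox Z t.2.2) :
    (#(F.image (restrictOnes I I' I'')) : ℝ) ≤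
      (3 ^ d * ∏ i ∈ I, X i) * ((3 ^ d * ∏ i ∈ I', Y i) * (3 ^ d * ∏ i ∈ I'', Z i)) := by
  have h1 := card_image_restrictOne_le F (fun t => t.1) hX (fun t ht => (hF t ht).1) I
  have h2 := card_image_restrictOne_le F (fun t => t.2.1) hY (fun t ht => (hF t ht).2.1) I'
  have h3 := card_image_restrictOne_le F (fun t => t.2.2) hZ (fun t ht => (hF t ht).2.2) I''
  have hsub : F.image (restrictOnes I I' I'') ⊆ (F.image fun t => restrictOne I t.1) ×ˢ
      (F.image fun t => restrictOne I' t.2.1) ×ˢ (F.image fun t => restrictOne I'' t.2.2) := by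
    intro y hy
    obtain ⟨t, ht, rfl⟩ := mem_image.1 hy
    exact mem_product.2 ⟨mem_image_of_mem _ ht, mem_product.2
      ⟨mem_image_of_mem _ ht, mem_image_of_mem _ ht⟩⟩
  have hcard := card_le_card hsub
  rw [card_product, card_product] at hcard
  calc (#(F.image (restrictOnes I I' I'')) : ℝ) ≤ _ := Nat.cast_le.2 hcard
    _ ≤ _ := by
      push_cast
      exact mul_le_mul h1 (mul_le_mul h2 h3 (by positivity) ((Nat.cast_nonneg _).trans h2))
        (by positivity) ((Nat.cast_nonneg _).trans h1)

theorem Bcount_geometry_bound (d : ℕ) (hd : 1 ≤ d) (ε : ℝ) (hε : 0 < ε) :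
    ∃ C : ℝ, ∀ X Y Z : Fin d → ℝ,
      (∀ i, 1 ≤ X i) → (∀ i, 1 ≤ Y i) → (∀ i, 1 ≤ Z i) →
      ∀ c₁ c₂ c₃ : ℤ, c₁ ≠ 0 → c₂ ≠ 0 → c₃ ≠ 0 →
      IsCoprime c₁ c₂ → IsCoprime c₁ c₃ → IsCoprime c₂ c₃ →
      ∀ I I' I'' : Finset (Fin d),
        (Bcount d c₁ c₂ c₃ X Y Z : ℝ) ≤
          C * (⨆ i, X i * Y i * Z i) ^ ε *
            ((∏ i ∈ I, X i) * (∏ i ∈ I', Y i) * (∏ i ∈ I'', Z i)) *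
            (1 + (∏ i ∈ Iᶜ, X i ^ ((i : ℕ) + 1)) * (∏ i ∈ I'ᶜ, Y i ^ ((i : ℕ) + 1)) *
                    (∏ i ∈ I''ᶜ, Z i ^ ((i : ℕ) + 1)) /
                  max ((|c₁| : ℝ) * ∏ i, X i ^ ((i : ℕ) + 1))
                    (max ((|c₂| : ℝ) * ∏ i, Y i ^ ((i : ℕ) + 1))
                      ((|c₃| : ℝ) * ∏ i, Z i ^ ((i : ℕ) + 1)))) := by
  have hd0 : (0 : ℝ) < d := by exact_mod_cast hd
  set η : ℝ := ε / (3 * (d : ℝ) ^ 3) with hη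
  have hη0 : 0 < η := by positivity
  obtain ⟨C, hC1, hC⟩ := exists_card_divisors_le_rpow η hη0
  have hC0 : 0 < C := by linarith
  refine ⟨(3 ^ d) ^ 3 * ((2 ^ d) ^ d) ^ 3 * (C ^ (3 * d) * 2 ^ ε), ?_⟩
  intro X Y Z hX hY hZ c₁ c₂ c₃ h₁ h₂ h₃ _ _ _ I I' I''
  set M : ℝ := ⨆ i, X i * Y i * Z i with hM
  have hle : ∀ i, X i * Y i * Z i ≤ M := fun i =>
    le_ciSup (f := fun i => X i * Y i * Z i) (Set.finite_range _).bddAbove i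
  have hXY : ∀ i, 1 ≤ X i * Y i := fun i => one_le_mul_of_one_le_of_one_le (hX i) (hY i)
  have hXM : ∀ i, X i ≤ M := fun i => by nlinarith [hle i, hXY i, hX i, hY i, hZ i]
  have hYM : ∀ i, Y i ≤ M := fun i => by nlinarith [hle i, hXY i, hX i, hY i, hZ i]
  have hZM : ∀ i, Z i ≤ M := fun i => by nlinarith [hle i, hXY i, hX i, hY i, hZ i]
  have hM1 : 1 ≤ M := (hX ⟨0, hd⟩).trans (hXM _)
  have hfin : {t | IsCounted c₁ c₂ c₃ X Y Z t}.Finite := by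
    refine ((Fintype.piFinset fun i => range ⌈2 * X i⌉₊) ×ˢ
      (Fintype.piFinset fun i => range ⌈2 * Y i⌉₊) ×ˢ
      (Fintype.piFinset fun i => range ⌈2 * Z i⌉₊)).finite_toSet.subset fun t ht => ?_
    exact mem_coe.2 (mem_product.2 ⟨ht.1.mem_piFinset,
      mem_product.2 ⟨ht.2.1.mem_piFinset, ht.2.2.1.mem_piFinset⟩⟩)
  set F := hfin.toFinset with hFdef
  have hF : ∀ t ∈ F, IsCounted c₁ c₂ c₃ X Y Z t := fun t ht => hfin.mem_toFinset.1 ht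
  have hB : Bcount d c₁ c₂ c₃ X Y Z = #F := Set.ncard_eq_toFinset_card _ hfin
  set R : ℝ := (∏ i ∈ Iᶜ, X i ^ ((i : ℕ) + 1)) * (∏ i ∈ I'ᶜ, Y i ^ ((i : ℕ) + 1)) *
    (∏ i ∈ I''ᶜ, Z i ^ ((i : ℕ) + 1)) /
      max ((|c₁| : ℝ) * ∏ i, X i ^ ((i : ℕ) + 1))
        (max ((|c₂| : ℝ) * ∏ i, Y i ^ ((i : ℕ) + 1))
          ((|c₃| : ℝ) * ∏ i, Z i ^ ((i : ℕ) + 1))) with hR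
  have hpos : ∀ {X : Fin d → ℝ}, (∀ i, 1 ≤ X i) → ∀ s : Finset (Fin d),
      0 ≤ ∏ i ∈ s, X i ^ ((i : ℕ) + 1) := fun hX s =>
    prod_nonneg fun i _ => pow_nonneg (by linarith [hX i]) _
  have hR0 : 0 ≤ R := div_nonneg
    (mul_nonneg (mul_nonneg (hpos hX _) (hpos hY _)) (hpos hZ _))
    (le_max_of_le_left (mul_nonneg (abs_nonneg _) (hpos hX _)))
  set Q : ℝ := C * (((2 * M) ^ d) ^ d) ^ η with hQ
  have hM0 : 0 < M := by linarith
  have hQ0 : 0 ≤ Q := by positivity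
  have hdiv : ∀ {X : Fin d → ℝ} {x : Fin d → ℕ}, InDyadicBox X x → (∀ i, 1 ≤ X i) →
      (∀ i, X i ≤ M) → ∀ s : Finset (Fin d), (#(weightedProd s x).divisors : ℝ) ≤ Q := by
    intro X x hx hX hXM s
    refine (hC _ (prod_ne_zero_iff.2 fun i _ => pow_ne_zero _ (hx.ne_zero hX i))).trans ?_
    rw [hQ]
    gcongr
    exact hx.weightedProd_le_pow hM1 hXM s
  have hQpow : Q ^ d * (Q ^ d * Q ^ d) = C ^ (3 * d) * 2 ^ ε * M ^ ε := by
    have e1 : ((((2 * M) ^ d) ^ d) ^ η) ^ (3 * d) = (2 * M) ^ ε := by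
      rw [← pow_mul, ← Real.rpow_natCast (2 * M), ← Real.rpow_mul (by positivity),
        ← Real.rpow_natCast, ← Real.rpow_mul (by positivity)]
      congr 1
      rw [hη]
      push_cast
      field_simp
    calc Q ^ d * (Q ^ d * Q ^ d) = Q ^ (3 * d) := by ring
      _ = _ := by
        rw [hQ, mul_pow, e1, Real.mul_rpow two_pos.le hM0.le, mul_assoc]
  set K : ℝ := (2 ^ d) ^ d with hK
  have hK1 : 1 ≤ K ^ 3 := one_le_pow₀ (one_le_pow₀ (one_le_pow₀ one_le_two))
  have hfib : ∀ a ∈ F.image (restrictOnes I I' I''),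
      (#{t ∈ F | restrictOnes I I' I'' t = a} : ℝ) ≤
        (1 + K ^ 3 * R) * (Q ^ d * (Q ^ d * Q ^ d)) := by
    intro a _
    refine card_le_mul_of_image_fiber _ (complProds I I' I'') (by positivity)
      (card_image_complProds_le hX hY hZ h₁ h₂ h₃ I I' I'' _
        (fun t ht => hF t (mem_filter.1 ht).1) a fun t ht => (mem_filter.1 ht).2) ?_
    intro b hb
    obtain ⟨t₀, ht₀, rfl⟩ := mem_image.1 hb
    obtain ⟨hx, hy, hz, -, -⟩ := hF t₀ (mem_filter.1 ht₀).1
    have hcard := card_fiber_le I I' I''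
      {t ∈ {t ∈ F | restrictOnes I I' I'' t = a} | complProds I I' I'' t =
        complProds I I' I'' t₀}
      (fun t ht => by
        obtain ⟨hx, hy, hz, -, -⟩ := hF t (mem_filter.1 (mem_filter.1 ht).1).1
        exact ⟨hx.ne_zero hX, hy.ne_zero hY, hz.ne_zero hZ⟩)
      a (fun t ht => (mem_filter.1 (mem_filter.1 ht).1).2) _ fun t ht => (mem_filter.1 ht).2
    refine (Nat.cast_le.2 hcard).trans ?_
    push_cast
    gcongr
    · exact hdiv hx hX hXM _
    · exact hdiv hy hY hYM _
    · exact hdiv hz hZ hZM _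
  have htotal := card_le_mul_of_image_fiber F (restrictOnes I I' I'') (by positivity)
    (card_image_restrictOnes_le hX hY hZ I I' I'' F
      fun t ht => ⟨(hF t ht).1, (hF t ht).2.1, (hF t ht).2.2.1⟩) hfib
  rw [hB]
  refine htotal.trans ?_
  rw [hQpow]
  have hprod : ∀ {X : Fin d → ℝ}, (∀ i, 1 ≤ X i) → ∀ s : Finset (Fin d), 0 ≤ ∏ i ∈ s, X i :=
    fun hX s => prod_nonneg fun i _ => by linarith [hX i]
  have hI := hprod hX I
  have hI' := hprod hY I'
  have hI'' := hprod hZ I''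
  calc _ ≤ (3 ^ d * ∏ i ∈ I, X i) * ((3 ^ d * ∏ i ∈ I', Y i) * (3 ^ d * ∏ i ∈ I'', Z i)) *
        ((K ^ 3 * (1 + R)) * (C ^ (3 * d) * 2 ^ ε * M ^ ε)) := by
        gcongr
        linarith
    _ = _ := by ring
end

section
/- (Determinant bound.) Let d ≥ 1 and ε > 0 be fixed. Let X_1,…,X_d, Y_1,…,Y_d, Z_1,…,Z_d ≥ 1 and let c = (c_1,c_2,c_3) ∈ ℤ³ have all coordinates non-zero. Then there is a constant C(d, ε) such that for all integers p, q with 1 ≤ p, q ≤ d, B_d(c, X, Y, Z) ≤ C(d, ε) · max_{1≤i≤d}(X_i Y_i Z_i)^ε · (∏_{i≤d} X_i Y_i Z_i) · (X_p Y_q)^{-1} · min(X_p^{1/q}, Y_q^{1/p}). -/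
open Finset

section Elimination
open Polynomial

/-- The matrix of multiplication by `∑ g j y ^ j` in the basis `1, y, …, y ^ (Q - 1)` of
`R[y] / (y ^ Q - h)`. -/
def powerMulMatrix {R : Type*} [CommRing R] (Q : ℕ) (h : R) (g : ℕ → R) :
    Matrix (Fin Q) (Fin Q) R :=
  Matrix.of fun k m => if (k : ℕ) ≤ m then g (m - k) else h * g (m + Q - k)

theorem sum_powerMulMatrix_mul_pow {R A : Type*} [CommRing R] [CommRing A] (φ : R →+* A)
    (Q : ℕ) (h : R) (g : ℕ → R) (y : A) (hy : y ^ Q = φ h) (k : Fin Q) :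
    ∑ m : Fin Q, φ (powerMulMatrix Q h g k m) * y ^ (m : ℕ)
      = y ^ (k : ℕ) * ∑ j ∈ range Q, φ (g j) * y ^ j := by
  obtain ⟨r, hr⟩ := Nat.exists_eq_add_of_le k.2.le
  have key : ∀ m : Fin Q, φ (powerMulMatrix Q h g k m) * y ^ (m : ℕ) =
      (fun m : ℕ => φ (if (k : ℕ) ≤ m then g (m - k) else h * g (m + Q - k)) * y ^ m) m :=
    fun m => rfl
  rw [Finset.sum_congr rfl fun m _ => key m, Fin.sum_univ_eq_sum_range
    (fun m : ℕ => φ (if (k : ℕ) ≤ m then g (m - k) else h * g (m + Q - k)) * y ^ m) Q]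
  have e1 : range Q = range (k + r) := congrArg range hr
  have e2 : range Q = range (r + k) := congrArg range (hr.trans (add_comm _ _))
  conv_lhs => rw [e1, Finset.sum_range_add]
  conv_rhs => rw [e2, Finset.sum_range_add]
  rw [mul_add, add_comm, mul_sum, mul_sum]
  congr 1
  · refine sum_congr rfl fun i _ => ?_
    simp [pow_add]; ring
  · refine sum_congr rfl fun i hi => ?_
    have hi' := mem_range.1 hi
    rw [if_neg (by omega), map_mul, ← hy, show i + Q - (k : ℕ) = r + i by omega]
    have : y ^ Q = y ^ (k : ℕ) * y ^ r := by rw [← pow_add, ← hr]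
    rw [this]; ring

theorem sum_C_mul_X_pow_degree_lt {R : Type*} [CommRing R] (Q : ℕ) (g : ℕ → R) :
    (∑ j ∈ range Q, C (g j) * X ^ j : R[X]).degree < Q := by
  refine (degree_sum_le _ _).trans_lt ?_
  refine (Finset.sup_lt_iff (WithBot.bot_lt_coe Q)).2 fun j hj => ?_
  exact (degree_C_mul_X_pow_le _ _).trans_lt (Nat.cast_lt.2 (mem_range.1 hj))

theorem coeff_eq_zero_of_aeval_root_eq_zero {R : Type*} [CommRing R] [Nontrivial R]
    {Q : ℕ} {h : R} (hQ : 0 < Q) (g : ℕ → R)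
    (hz : ∑ j ∈ range Q, AdjoinRoot.of (X ^ Q - C h) (g j) * AdjoinRoot.root (X ^ Q - C h) ^ j = 0) :
    ∀ j < Q, g j = 0 := by
  have h1 : AdjoinRoot.mk (X ^ Q - C h) (∑ j ∈ range Q, C (g j) * X ^ j) = 0 := by
    rw [map_sum, ← hz]
    exact sum_congr rfl fun j _ => by simp
  rw [AdjoinRoot.mk_eq_zero] at h1
  have h2 : (∑ j ∈ range Q, C (g j) * X ^ j : R[X]) = 0 := by
    by_contra hne
    have hmon : (X ^ Q - C h : R[X]).Monic := monic_X_pow_sub_C h hQ.ne'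
    refine hmon.not_dvd_of_degree_lt hne ?_ h1
    rw [degree_X_pow_sub_C hQ]
    exact sum_C_mul_X_pow_degree_lt Q g
  intro j hj
  have := congrArg (fun p => coeff p j) h2
  simpa [finsetSum_coeff, coeff_C_mul, coeff_X_pow, hj] using this

theorem det_powerMulMatrix_ne_zero {R : Type*} [CommRing R] [IsDomain R]
    {Q : ℕ} {h : R} (hQ : 0 < Q) (hp : Prime (X ^ Q - C h : R[X])) (g : ℕ → R)
    (hg : ∃ j < Q, g j ≠ 0) : (powerMulMatrix Q h g).det ≠ 0 := by
  intro hdet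
  obtain ⟨v, hv, hvM⟩ := Matrix.exists_vecMul_eq_zero_iff.2 hdet
  have : IsDomain (AdjoinRoot (X ^ Q - C h : R[X])) := AdjoinRoot.isDomain_of_prime hp
  set F : R[X] := X ^ Q - C h with hF
  have hy : (AdjoinRoot.root F) ^ Q = AdjoinRoot.of F h := by
    have := AdjoinRoot.eval₂_root F
    rw [hF] at this
    simpa [sub_eq_zero] using this
  have hprod : (∑ k : Fin Q, AdjoinRoot.of F (v k) * AdjoinRoot.root F ^ (k : ℕ)) *
      (∑ j ∈ range Q, AdjoinRoot.of F (g j) * AdjoinRoot.root F ^ j) = 0 := by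
    have : ∀ k : Fin Q, AdjoinRoot.of F (v k) * AdjoinRoot.root F ^ (k : ℕ) *
        (∑ j ∈ range Q, AdjoinRoot.of F (g j) * AdjoinRoot.root F ^ j) =
        ∑ m : Fin Q, AdjoinRoot.of F (v k * powerMulMatrix Q h g k m) *
          AdjoinRoot.root F ^ (m : ℕ) := by
      intro k
      rw [mul_assoc, ← sum_powerMulMatrix_mul_pow (AdjoinRoot.of F) Q h g _ hy k, mul_sum]
      exact sum_congr rfl fun m _ => by rw [map_mul, mul_assoc]
    rw [sum_mul, sum_congr rfl fun k _ => this k, sum_comm]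
    refine sum_eq_zero fun m _ => ?_
    rw [← sum_mul, ← map_sum]
    have h0 : ∑ k, v k * powerMulMatrix Q h g k m = 0 := congrFun hvM m
    rw [h0]; simp
  rcases mul_eq_zero.1 hprod with h0 | h0
  · apply hv
    funext k
    have key : ∀ k : Fin Q, AdjoinRoot.of F (v k) * AdjoinRoot.root F ^ (k : ℕ) =
        (fun m : ℕ => AdjoinRoot.of F (if hm : m < Q then v ⟨m, hm⟩ else 0) *
          AdjoinRoot.root F ^ m) k := fun k => by simp
    rw [sum_congr rfl fun k _ => key k, Fin.sum_univ_eq_sum_range (fun m : ℕ =>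
      AdjoinRoot.of F (if hm : m < Q then v ⟨m, hm⟩ else 0) * AdjoinRoot.root F ^ m) Q] at h0
    have := coeff_eq_zero_of_aeval_root_eq_zero hQ _ h0 k k.2
    simpa using this
  · obtain ⟨j, hj, hne⟩ := hg
    exact hne (coeff_eq_zero_of_aeval_root_eq_zero hQ g h0 j hj)

theorem eval_det_powerMulMatrix_eq_zero {Q : ℕ} (hQ : 0 < Q) {h : ℝ[X]} {g : ℕ → ℝ[X]} {x y : ℝ}
    (hy : y ^ Q = h.eval x) (hg : ∑ j ∈ range Q, (g j).eval x * y ^ j = 0) :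
    (powerMulMatrix Q h g).det.eval x = 0 := by
  have : (powerMulMatrix Q h g).det.eval x =
      ((evalRingHom x).mapMatrix (powerMulMatrix Q h g)).det := by
    rw [← RingHom.map_det]; rfl
  rw [this]
  refine Matrix.exists_mulVec_eq_zero_iff.1 ⟨fun m => y ^ (m : ℕ), ?_, ?_⟩
  · intro h0
    have := congrFun h0 ⟨0, hQ⟩
    simp at this
  · funext k
    have := sum_powerMulMatrix_mul_pow (evalRingHom x) Q h g y hy k
    simp only [coe_evalRingHom, hg, mul_zero] at this
    simpa [Matrix.mulVec, dotProduct] using this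

theorem natDegree_det_le {n : Type*} [Fintype n] [DecidableEq n] (M : Matrix n n ℝ[X]) (B : ℕ)
    (hM : ∀ i j, (M i j).natDegree ≤ B) : M.det.natDegree ≤ Fintype.card n * B := by
  rw [Matrix.det_apply]
  refine natDegree_sum_le_of_forall_le _ _ fun σ _ => ?_
  refine (natDegree_smul_le _ _).trans ((natDegree_prod_le _ _).trans ?_)
  refine (sum_le_card_nsmul _ _ B fun i _ => hM _ _).trans ?_
  simp

theorem prime_X_pow_sub_C_of_binomial {P Q : ℕ} (hP : 0 < P) (hQ : 0 < Q) {κ ν : ℝ} (hκ : κ ≠ 0)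
    (hν : ν ≠ 0) : Prime (X ^ Q - C (C κ * (X ^ P - C ν)) : ℝ[X][X]) := by
  rw [← irreducible_iff_prime]
  have hdeg : (X ^ P - C ν : ℝ[X]).degree ≠ 0 := by
    rw [degree_X_pow_sub_C hP]; exact_mod_cast hP.ne'
  have hne : (X ^ P - C ν : ℝ[X]) ≠ 0 := X_pow_sub_C_ne_zero hP ν
  obtain ⟨w, hw, hwd⟩ := WfDvdMonoid.exists_irreducible_factor
    (fun hu => hdeg (degree_eq_zero_of_isUnit hu)) hne
  have hsep : (X ^ P - C ν : ℝ[X]).Separable :=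
    separable_X_pow_sub_C ν (by exact_mod_cast hP.ne') hν
  have hmon : (X ^ Q - C (C κ * (X ^ P - C ν)) : ℝ[X][X]).Monic := monic_X_pow_sub_C _ hQ.ne'
  refine irreducible_of_eisenstein_criterion (P := Ideal.span {w})
    ((Ideal.span_singleton_prime hw.ne_zero).2 hw.prime) ?_ ?_ ?_ ?_ hmon.isPrimitive
  · rw [hmon.leadingCoeff, Ideal.mem_span_singleton]
    exact fun h => hw.not_isUnit (isUnit_of_dvd_one h)
  · intro m hm
    rw [degree_X_pow_sub_C hQ] at hm
    have hm' : m < Q := by exact_mod_cast hm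
    rw [coeff_sub, coeff_X_pow, if_neg hm'.ne, coeff_C, Ideal.mem_span_singleton]
    split_ifs
    · simpa using (hwd.mul_left _)
    · simp
  · rw [degree_X_pow_sub_C hQ]; exact_mod_cast hQ
  · rw [coeff_sub, coeff_X_pow, if_neg hQ.ne, coeff_C_zero, zero_sub, Ideal.span_singleton_pow,
      Ideal.mem_span_singleton, dvd_neg, sq]
    intro hd
    have hu : IsUnit (C κ : ℝ[X]) := isUnit_C.2 (isUnit_iff_ne_zero.2 hκ)
    rw [hu.dvd_mul_left] at hd
    exact hw.not_isUnit (isUnit_of_self_mul_dvd_separable hsep hd)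

/-- Elimination: a curve `∑ g j (x) y ^ j = 0` with degree less than `Q` in `y` meets
`y ^ Q = κ (x ^ P - ν)` in points with boundedly many abscissae. -/
theorem exists_eliminant {P Q D : ℕ} (hP : 0 < P) (hQ : 0 < Q) {κ ν : ℝ} (hκ : κ ≠ 0)
    (hν : ν ≠ 0) (g : ℕ → ℝ[X]) (hdeg : ∀ j, (g j).natDegree ≤ D) (hg : ∃ j < Q, g j ≠ 0) :
    ∃ R : ℝ[X], R ≠ 0 ∧ R.natDegree ≤ Q * (P + D) ∧ ∀ x y : ℝ, y ^ Q = κ * (x ^ P - ν) →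
      ∑ j ∈ range Q, (g j).eval x * y ^ j = 0 → R.eval x = 0 := by
  refine ⟨(powerMulMatrix Q (C κ * (X ^ P - C ν)) g).det,
    det_powerMulMatrix_ne_zero hQ (prime_X_pow_sub_C_of_binomial hP hQ hκ hν) g hg, ?_, ?_⟩
  · refine (natDegree_det_le _ (P + D) fun i j => ?_).trans (by simp)
    simp only [powerMulMatrix, Matrix.of_apply]
    split_ifs
    · exact (hdeg _).trans (Nat.le_add_left _ _)
    · refine natDegree_mul_le.trans (add_le_add ?_ (hdeg _))
      refine (natDegree_C_mul_le _ _).trans ?_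
      rw [natDegree_X_pow_sub_C]
  · intro x y hy h0
    exact eval_det_powerMulMatrix_eq_zero hQ (by simpa using hy) h0

end Elimination

section CoeffNorm
open Polynomial

/-- The sum of the absolute values of the coefficients of a real polynomial. -/
noncomputable def coeffNorm (P : ℝ[X]) : ℝ := P.sum fun _ a => |a|

theorem coeffNorm_eq_sum_range (P : ℝ[X]) {N : ℕ} (hN : P.natDegree < N) :
    coeffNorm P = ∑ m ∈ range N, |P.coeff m| :=
  P.sum_over_range' (fun _ => abs_zero) N hN

theorem coeffNorm_nonneg (P : ℝ[X]) : 0 ≤ coeffNorm P :=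
  sum_nonneg fun _ _ => abs_nonneg _

theorem coeffNorm_C (a : ℝ) : coeffNorm (C a) = |a| := by
  simp [coeffNorm, sum_C_index]

theorem coeffNorm_X : coeffNorm X = 1 := by
  rw [coeffNorm_eq_sum_range X (N := 2) (by simp)]
  simp [sum_range_succ, coeff_X]

theorem coeffNorm_add_le (P Q : ℝ[X]) : coeffNorm (P + Q) ≤ coeffNorm P + coeffNorm Q := by
  set N := max P.natDegree Q.natDegree + 1 with hN
  rw [coeffNorm_eq_sum_range (P + Q) (N := N) (Nat.lt_succ_of_le (natDegree_add_le _ _)),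
    coeffNorm_eq_sum_range P (N := N) (by omega), coeffNorm_eq_sum_range Q (N := N) (by omega),
    ← sum_add_distrib]
  exact sum_le_sum fun m _ => by rw [coeff_add]; exact abs_add_le _ _

theorem coeffNorm_mul_le (P Q : ℝ[X]) : coeffNorm (P * Q) ≤ coeffNorm P * coeffNorm Q := by
  set A : ℝ[X] → ℝ[X] := fun P => ∑ m ∈ range (P.natDegree + 1), C |P.coeff m| * X ^ m with hA
  have hcoeff : ∀ P m, (A P).coeff m = |P.coeff m| := by
    intro P m
    simp only [hA, finsetSum_coeff, coeff_C_mul, coeff_X_pow, mul_ite, mul_one, mul_zero,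
      sum_ite_eq, mem_range]
    split_ifs with h
    · rfl
    · rw [coeff_eq_zero_of_natDegree_lt (by omega), abs_zero]
  have heval : ∀ P, (A P).eval 1 = coeffNorm P := by
    intro P
    rw [coeffNorm_eq_sum_range P (Nat.lt_succ_self _)]
    simp [hA, eval_finsetSum]
  rw [← heval P, ← heval Q, ← eval_mul]
  set N := max (P * Q).natDegree (A P * A Q).natDegree + 1 with hN
  rw [coeffNorm_eq_sum_range (P * Q) (N := N) (by omega),
    eval_eq_sum_range' (n := N) (p := A P * A Q) (by omega)]
  refine sum_le_sum fun m _ => ?_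
  rw [one_pow, mul_one, coeff_mul, coeff_mul]
  refine (abs_sum_le_sum_abs _ _).trans_eq (sum_congr rfl fun ij _ => ?_)
  rw [hcoeff, hcoeff, abs_mul]

theorem abs_eval_le_coeffNorm (P : ℝ[X]) {x : ℝ} (hx : |x| ≤ 1) : |P.eval x| ≤ coeffNorm P := by
  rw [coeffNorm_eq_sum_range P (Nat.lt_succ_self _), eval_eq_sum_range]
  refine (abs_sum_le_sum_abs _ _).trans (sum_le_sum fun m _ => ?_)
  rw [abs_mul, abs_pow]
  exact mul_le_of_le_one_right (abs_nonneg _) (pow_le_one₀ (abs_nonneg _) hx)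

/-- `f` agrees with a polynomial in `τ` of coefficient norm at most `K` up to an error `K * η`. -/
def PolyApprox {ι : Type*} (τ : ι → ℝ) (η K : ℝ) (f : ι → ℝ) : Prop :=
  ∃ P : ℝ[X], coeffNorm P ≤ K ∧ ∀ k, |f k - P.eval (τ k)| ≤ K * η

namespace PolyApprox
variable {ι : Type*} {τ : ι → ℝ} {η K K' : ℝ} {f f' : ι → ℝ}

theorem nonneg (h : PolyApprox τ η K f) : 0 ≤ K := by
  obtain ⟨P, hP, -⟩ := h
  exact (coeffNorm_nonneg P).trans hP

theorem mono (hη : 0 ≤ η) (h : PolyApprox τ η K f) (hK : K ≤ K') : PolyApprox τ η K' f := by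
  obtain ⟨P, hP, hf⟩ := h
  exact ⟨P, hP.trans hK, fun k => (hf k).trans (mul_le_mul_of_nonneg_right hK hη)⟩

theorem const (hη : 0 ≤ η) (c : ℝ) : PolyApprox τ η |c| fun _ => c :=
  ⟨C c, (coeffNorm_C c).le, fun k => by simp; positivity⟩

theorem self (hη : 0 ≤ η) : PolyApprox τ η 1 τ :=
  ⟨X, coeffNorm_X.le, fun k => by simpa using hη⟩

theorem of_small (h : ∀ k, |f k| ≤ K * η) (hK : 0 ≤ K) : PolyApprox τ η K f :=
  ⟨0, by simpa [coeffNorm] using hK, fun k => by simpa using h k⟩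

theorem add (h : PolyApprox τ η K f) (h' : PolyApprox τ η K' f') :
    PolyApprox τ η (K + K') fun k => f k + f' k := by
  obtain ⟨P, hP, hf⟩ := h
  obtain ⟨P', hP', hf'⟩ := h'
  refine ⟨P + P', (coeffNorm_add_le _ _).trans (add_le_add hP hP'), fun k => ?_⟩
  rw [eval_add, add_sub_add_comm, add_mul]
  exact (abs_add_le _ _).trans (add_le_add (hf k) (hf' k))

theorem mul (hη : 0 ≤ η) (hη1 : η ≤ 1) (hτ : ∀ k, |τ k| ≤ 1) (h : PolyApprox τ η K f)
    (h' : PolyApprox τ η K' f') : PolyApprox τ η (3 * (K * K')) fun k => f k * f' k := by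
  have hK := h.nonneg
  have hK' := h'.nonneg
  obtain ⟨P, hP, hf⟩ := h
  obtain ⟨P', hP', hf'⟩ := h'
  have hKK : 0 ≤ K * K' := mul_nonneg hK hK'
  refine ⟨P * P', (coeffNorm_mul_le _ _).trans ?_, fun k => ?_⟩
  · have := mul_le_mul hP hP' (coeffNorm_nonneg _) hK
    linarith
  · have e : f k * f' k - (P * P').eval (τ k) = (f k - P.eval (τ k)) * (f' k - P'.eval (τ k)) +
        (f k - P.eval (τ k)) * P'.eval (τ k) + P.eval (τ k) * (f' k - P'.eval (τ k)) := by
      rw [eval_mul]; ring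
    have h1 := (abs_eval_le_coeffNorm P (hτ k)).trans hP
    have h2 := (abs_eval_le_coeffNorm P' (hτ k)).trans hP'
    have a1 : |(f k - P.eval (τ k)) * (f' k - P'.eval (τ k))| ≤ (K * η) * (K' * 1) := by
      rw [abs_mul]
      exact mul_le_mul (hf k) ((hf' k).trans (by gcongr)) (abs_nonneg _) (by positivity)
    have a2 : |(f k - P.eval (τ k)) * P'.eval (τ k)| ≤ (K * η) * K' := by
      rw [abs_mul]
      exact mul_le_mul (hf k) h2 (abs_nonneg _) (by positivity)
    have a3 : |P.eval (τ k) * (f' k - P'.eval (τ k))| ≤ K * (K' * η) := by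
      rw [abs_mul]
      exact mul_le_mul h1 (hf' k) (abs_nonneg _) hK
    rw [e]
    refine (abs_add_le _ _).trans ((add_le_add_left (abs_add_le _ _) _).trans ?_)
    nlinarith

theorem pow (hη : 0 ≤ η) (hη1 : η ≤ 1) (hτ : ∀ k, |τ k| ≤ 1) (h : PolyApprox τ η K f) (n : ℕ) :
    PolyApprox τ η ((3 * K) ^ n) fun k => f k ^ n := by
  induction n with
  | zero => simpa using const (τ := τ) hη 1
  | succ n ih =>
    have := mul hη hη1 hτ ih h
    simp only [pow_succ]
    exact mono hη this (le_of_eq (by ring))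

theorem sum {α : Type*} (hη : 0 ≤ η) (s : Finset α) {K : α → ℝ} {f : α → ι → ℝ}
    (h : ∀ a ∈ s, PolyApprox τ η (K a) (f a)) :
    PolyApprox τ η (∑ a ∈ s, K a) fun k => ∑ a ∈ s, f a k := by
  classical
  induction s using Finset.induction_on with
  | empty => simpa using const (τ := τ) hη 0
  | insert a s ha ih =>
    simp only [sum_insert ha]
    exact (h a (mem_insert_self _ _)).add (ih fun b hb => h b (mem_insert_of_mem hb))

end PolyApprox

end CoeffNorm

section DeterminantEstimate

theorem abs_det_le_factorial_mul_prod {ι : Type*} [Fintype ι] [DecidableEq ι] (A : Matrix ι ι ℝ)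
    (b : ι → ℝ) (h : ∀ i k, |A i k| ≤ b i) :
    |A.det| ≤ (Fintype.card ι).factorial * ∏ i, b i := by
  rw [Matrix.det_apply]
  refine (abs_sum_le_sum_abs _ _).trans ?_
  have : ∀ σ ∈ (univ : Finset (Equiv.Perm ι)),
      |Equiv.Perm.sign σ • ∏ i, A (σ i) i| ≤ ∏ i, b i := by
    intro σ _
    have h1 : |Equiv.Perm.sign σ • ∏ i, A (σ i) i| = ∏ i, |A (σ i) i| := by
      rw [← abs_prod]
      rcases Int.units_eq_one_or (Equiv.Perm.sign σ) with h | h <;> simp [h]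
    rw [h1, ← Equiv.prod_comp σ b]
    exact prod_le_prod (fun i _ => abs_nonneg _) fun i _ => h _ _
  refine (sum_le_card_nsmul _ _ _ this).trans ?_
  rw [card_univ, Fintype.card_perm, nsmul_eq_mul]

theorem sum_range_card_le_sum_of_injective {ι : Type*} [Fintype ι] (m : ι → ℕ)
    (hm : Function.Injective m) : ∑ i ∈ range (Fintype.card ι), i ≤ ∑ i, m i := by
  classical
  have h := Finset.sum_range_le_sum (s := univ.image fun i => (m i : ℤ)) (c := 0) (by simp)
  rw [card_image_of_injective (f := fun i => (m i : ℤ)) _ (Nat.cast_injective.comp hm), card_univ,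
    sum_image (fun a _ b _ h => hm (Nat.cast_injective h))] at h
  zify
  simpa using h

/-- A generalised Vandermonde estimate: functions well approximated by polynomials in a small
parameter have a small determinant. -/
theorem abs_det_le_of_polyApprox {ι : Type*} [Fintype ι] [DecidableEq ι] {τ : ι → ℝ} {δ K : ℝ}
    (hδ : 0 ≤ δ) (hδ1 : δ ≤ 1) (hτ : ∀ k, |τ k| ≤ δ) (f : ι → ι → ℝ)
    (hf : ∀ i, PolyApprox τ (δ ^ ∑ i ∈ range (Fintype.card ι), i) K (f i)) :
    |(Matrix.of f).det| ≤ (Fintype.card ι).factorial * (2 * K) ^ Fintype.card ι *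
      δ ^ ∑ i ∈ range (Fintype.card ι), i := by
  set S := ∑ i ∈ range (Fintype.card ι), i with hS
  choose P hP hPf using hf
  set N := (univ.sup fun i => (P i).natDegree) + 1 with hN
  have hdeg : ∀ i, (P i).natDegree < N := fun i =>
    Nat.lt_succ_of_le (le_sup (f := fun i => (P i).natDegree) (mem_univ i))
  set row : ι → Option (Fin N) → ι → ℝ := fun i o k =>
    o.elim (f i k - (P i).eval (τ k)) fun m => (P i).coeff m * τ k ^ (m : ℕ) with hrow
  set wt : ι → Option (Fin N) → ℝ := fun i o => o.elim K fun m => |(P i).coeff m| with hwt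
  have hwt0 : ∀ i o, 0 ≤ wt i o := by
    rintro i (_ | m)
    · exact (coeffNorm_nonneg _).trans (hP i)
    · exact abs_nonneg _
  have hdecomp : Matrix.of f = fun i => ∑ o, row i o := by
    funext i k
    rw [Finset.sum_apply, Fintype.sum_option]
    simp only [hrow, Option.elim, Matrix.of_apply]
    rw [Fin.sum_univ_eq_sum_range (fun m => (P i).coeff m * τ k ^ m) N,
      ← Polynomial.eval_eq_sum_range' (hdeg i)]
    ring
  have hexp : (Matrix.of f).det = ∑ r : ι → Option (Fin N),
      Matrix.det (fun i => row i (r i)) := by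
    rw [hdecomp]
    exact (Matrix.detRowAlternating (n := ι) (R := ℝ)).toMultilinearMap.map_sum row
  have hterm : ∀ r : ι → Option (Fin N), |Matrix.det (fun i => row i (r i))| ≤
      (Fintype.card ι).factorial * δ ^ S * ∏ i, wt i (r i) := by
    intro r
    have hnn : 0 ≤ (Fintype.card ι).factorial * δ ^ S * ∏ i, wt i (r i) :=
      mul_nonneg (by positivity) (prod_nonneg fun i _ => hwt0 _ _)
    set ex : ι → ℕ := fun i => (r i).elim S fun m => (m : ℕ) with hex
    have hb : ∀ i k, |row i (r i) k| ≤ δ ^ ex i * wt i (r i) := by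
      intro i k
      simp only [hrow, hwt, hex]
      cases r i with
      | none => simpa [mul_comm] using hPf i k
      | some m =>
        simp only [Option.elim, abs_mul, abs_pow]
        rw [mul_comm]
        exact mul_le_mul_of_nonneg_right (pow_le_pow_left₀ (abs_nonneg _) (hτ k) _) (abs_nonneg _)
    have hmain : S ≤ ∑ i, ex i → |Matrix.det (fun i => row i (r i))| ≤
        (Fintype.card ι).factorial * δ ^ S * ∏ i, wt i (r i) := by
      intro hle
      refine (abs_det_le_factorial_mul_prod _ _ hb).trans ?_
      rw [prod_mul_distrib, prod_pow_eq_pow_sum, ← mul_assoc]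
      have := pow_le_pow_of_le_one hδ hδ1 hle
      have := prod_nonneg (s := univ) fun i _ => hwt0 i (r i)
      gcongr
    by_cases hnone : ∃ i, r i = none
    · obtain ⟨i, hi⟩ := hnone
      refine hmain ?_
      have : ex i = S := by simp [hex, hi]
      rw [← this]
      exact single_le_sum (f := ex) (fun _ _ => Nat.zero_le _) (mem_univ i)
    · push Not at hnone
      choose m hm using fun i => Option.ne_none_iff_exists'.1 (hnone i)
      by_cases hinj : Function.Injective m
      · refine hmain ?_
        have : ∀ i, ex i = (m i : ℕ) := fun i => by simp [hex, hm]
        rw [sum_congr rfl fun i _ => this i]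
        exact sum_range_card_le_sum_of_injective _ (Fin.val_injective.comp hinj)
      · simp only [Function.Injective, not_forall] at hinj
        obtain ⟨i, j, hij, hne⟩ := hinj
        have e : (fun i => row i (r i)) = Matrix.of fun i k =>
            (P i).coeff (m i) * (Matrix.of fun i k => τ k ^ (m i : ℕ)) i k := by
          funext i k
          simp [hrow, hm]
        rw [e, Matrix.det_mul_column, Matrix.det_zero_of_row_eq hne (by funext k; simp [hij])]
        simpa using hnn
  have hsum : ∀ i, ∑ o, wt i o ≤ 2 * K := by
    intro i
    rw [Fintype.sum_option]
    simp only [hwt, Option.elim]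
    rw [Fin.sum_univ_eq_sum_range (fun m => |(P i).coeff m|) N,
      ← coeffNorm_eq_sum_range _ (hdeg i)]
    linarith [hP i]
  rw [hexp]
  refine (abs_sum_le_sum_abs _ _).trans ((sum_le_sum fun r _ => hterm r).trans ?_)
  rw [← mul_sum, ← Fintype.prod_sum]
  have : ∏ i, ∑ o, wt i o ≤ (2 * K) ^ Fintype.card ι := by
    refine (prod_le_prod (fun i _ => sum_nonneg fun o _ => hwt0 i o) fun i _ => hsum i).trans ?_
    simp
  calc _ ≤ (Fintype.card ι).factorial * δ ^ S * (2 * K) ^ Fintype.card ι := by gcongr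
    _ = _ := by ring

end DeterminantEstimate

section LocalEstimate

theorem exists_taylor_one_add_rpow (a : ℝ) (S : ℕ) : ∃ K r : ℝ, ∃ b : ℕ → ℝ, 0 ≤ K ∧ 0 < r ∧
    ∀ w : ℝ, |w| ≤ r → |(1 + w) ^ a - ∑ m ∈ range S, b m * w ^ m| ≤ K * |w| ^ S := by
  have h := (Real.one_add_rpow_hasFPowerSeriesAt_zero (a := a)).isBigO_sub_partialSum_pow S
  obtain ⟨K, hK, hb⟩ := h.exists_nonneg
  rw [Asymptotics.IsBigOWith_def] at hb
  obtain ⟨r, hr, hr'⟩ := Metric.eventually_nhds_iff.1 hb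
  refine ⟨K, r / 2, fun m => (binomialSeries ℝ a).coeff m, hK, half_pos hr, fun w hw => ?_⟩
  have := hr' (y := w) (by rw [Real.dist_eq, sub_zero]; linarith)
  simpa [FormalMultilinearSeries.partialSum, mul_comm] using this

/-- On the curve `U ^ P + β t ^ Q = const` with `|β| ≤ 1`, the coordinate `U` is well approximated
by polynomials in `t - t₀`, uniformly in the curve. -/
theorem exists_polyApprox_of_curve (ι : Type*) {P : ℕ} (hP : P ≠ 0) (Q S : ℕ) :
    ∃ K δ₀ : ℝ, 0 < δ₀ ∧ δ₀ ≤ 1 ∧ ∀ (β U₀ t₀ δ : ℝ) (U t : ι → ℝ), |β| ≤ 1 →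
      1 ≤ U₀ → U₀ ≤ 2 → 0 ≤ t₀ → t₀ ≤ 2 → (∀ k, 0 ≤ U k) → (∀ k, 0 ≤ t k) → (∀ k, t k ≤ 2) →
      (∀ k, U k ^ P + β * t k ^ Q = U₀ ^ P + β * t₀ ^ Q) → 0 ≤ δ → δ ≤ δ₀ →
      (∀ k, |t k - t₀| ≤ δ) →
      PolyApprox (fun k => t k - t₀) (δ ^ S) K U ∧ PolyApprox (fun k => t k - t₀) (δ ^ S) K t := by
  obtain ⟨K, r, b, hK, hr, hb⟩ := exists_taylor_one_add_rpow ((P : ℝ)⁻¹) S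
  set L : ℝ := Q * 2 ^ (Q - 1) + 1 with hL
  have hL1 : 1 ≤ L := by rw [hL]; linarith [show (0 : ℝ) ≤ Q * 2 ^ (Q - 1) by positivity]
  set Kw : ℝ := 3 * (1 * (3 * (1 + 2)) ^ Q) + 2 ^ Q with hKw
  refine ⟨max (3 * (2 * (∑ m ∈ range S, 3 * (|b m| * (3 * Kw) ^ m) + K * L ^ S))) (1 + 2),
    min 1 (r / L), lt_min one_pos (by positivity), min_le_left _ _, ?_⟩
  intro β U₀ t₀ δ U t hβ hU₀ hU₀' ht₀ ht₀' hU ht ht' hcurve hδ hδ₀ hτ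
  have hδ1 : δ ≤ 1 := hδ₀.trans (min_le_left _ _)
  have hη : 0 ≤ δ ^ S := by positivity
  have hη1 : δ ^ S ≤ 1 := pow_le_one₀ hδ hδ1
  have hτ1 : ∀ k, |t k - t₀| ≤ 1 := fun k => (hτ k).trans hδ1
  have hUP : 1 ≤ U₀ ^ P := one_le_pow₀ hU₀
  have hUP0 : 0 < U₀ ^ P := by linarith
  have hβ' : |β / U₀ ^ P| ≤ 1 := by
    rw [abs_div, abs_of_pos hUP0, div_le_one hUP0]; linarith
  have htA : PolyApprox (fun k => t k - t₀) (δ ^ S) (1 + 2) t := by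
    have h1 := (PolyApprox.self (τ := fun k => t k - t₀) hη).add
      (PolyApprox.mono (K' := 2) hη (PolyApprox.const hη t₀) (by rwa [abs_of_nonneg ht₀]))
    simpa using h1
  refine ⟨?_, PolyApprox.mono hη htA (le_max_right _ _)⟩
  set w : ι → ℝ := fun k => -(β / U₀ ^ P) * t k ^ Q + β / U₀ ^ P * t₀ ^ Q with hw
  have hwA : PolyApprox (fun k => t k - t₀) (δ ^ S) Kw w := by
    refine PolyApprox.add (PolyApprox.mul hη hη1 hτ1 ?_ (PolyApprox.pow hη hη1 hτ1 htA Q)) ?_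
    · exact PolyApprox.mono hη (PolyApprox.const hη _) (by rwa [abs_neg])
    · refine PolyApprox.mono hη (PolyApprox.const hη _) ?_
      rw [abs_mul, abs_pow, abs_of_nonneg ht₀]
      have := pow_le_pow_left₀ ht₀ ht₀' Q
      calc |β / U₀ ^ P| * t₀ ^ Q ≤ 1 * 2 ^ Q := by gcongr
        _ = 2 ^ Q := one_mul _
  have hwδ : ∀ k, |w k| ≤ L * δ := by
    intro k
    have e : w k = -(β / U₀ ^ P) * (t k ^ Q - t₀ ^ Q) := by rw [hw]; ring
    have h1 := abs_pow_sub_pow_le (t k) t₀ Q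
    have h2 : max |t k| |t₀| ≤ 2 := by
      rw [abs_of_nonneg (ht k), abs_of_nonneg ht₀]; exact max_le (ht' k) ht₀'
    rw [e, abs_mul, abs_neg]
    calc |β / U₀ ^ P| * |t k ^ Q - t₀ ^ Q| ≤ 1 * (δ * Q * 2 ^ (Q - 1)) := by
          refine mul_le_mul hβ' (h1.trans ?_) (abs_nonneg _) zero_le_one
          have := hτ k
          gcongr
      _ ≤ L * δ := by rw [hL]; nlinarith
  have hwr : ∀ k, |w k| ≤ r := by
    intro k
    have := hδ₀.trans (min_le_right _ _)
    rw [le_div_iff₀ (by linarith)] at this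
    linarith [hwδ k]
  have hUw : ∀ k, U k = U₀ * (1 + w k) ^ ((P : ℝ)⁻¹) := by
    intro k
    have e : 1 + w k = (U k / U₀) ^ P := by
      have := hcurve k
      rw [hw, div_pow]
      field_simp
      linarith
    rw [e, Real.pow_rpow_inv_natCast (div_nonneg (hU k) (by linarith)) hP]
    field_simp
  have hsum : PolyApprox (fun k => t k - t₀) (δ ^ S) (∑ m ∈ range S, 3 * (|b m| * (3 * Kw) ^ m))
      (fun k => ∑ m ∈ range S, b m * w k ^ m) :=
    PolyApprox.sum hη _ fun m _ => PolyApprox.mul hη hη1 hτ1 (PolyApprox.const hη _)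
      (PolyApprox.pow hη hη1 hτ1 hwA m)
  have hrem : PolyApprox (fun k => t k - t₀) (δ ^ S) (K * L ^ S)
      (fun k => (1 + w k) ^ ((P : ℝ)⁻¹) - ∑ m ∈ range S, b m * w k ^ m) := by
    refine PolyApprox.of_small (fun k => (hb _ (hwr k)).trans ?_) (by positivity)
    rw [mul_assoc, ← mul_pow]
    have := hwδ k
    gcongr
  have htot := PolyApprox.mul hη hη1 hτ1
    (PolyApprox.mono (K' := 2) hη (PolyApprox.const hη U₀) (by rwa [abs_of_nonneg (by linarith)]))
    (hsum.add hrem)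
  refine PolyApprox.mono hη ?_ (le_max_left _ _)
  convert htot using 2 with k
  rw [hUw k]; ring

/-- Determinants of monomials in points lying on a short arc of `U ^ P + β t ^ Q = const` are
small. -/
theorem exists_abs_det_monomials_le (ι : Type*) [Fintype ι] [DecidableEq ι] {P : ℕ} (hP : P ≠ 0)
    (Q : ℕ) (e₁ e₂ : ι → ℕ) :
    ∃ K δ₀ : ℝ, 0 < δ₀ ∧ δ₀ ≤ 1 ∧ ∀ (β U₀ t₀ δ : ℝ) (U t : ι → ℝ), |β| ≤ 1 →
      1 ≤ U₀ → U₀ ≤ 2 → 0 ≤ t₀ → t₀ ≤ 2 → (∀ k, 0 ≤ U k) → (∀ k, 0 ≤ t k) → (∀ k, t k ≤ 2) →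
      (∀ k, U k ^ P + β * t k ^ Q = U₀ ^ P + β * t₀ ^ Q) → 0 ≤ δ → δ ≤ δ₀ →
      (∀ k, |t k - t₀| ≤ δ) →
      |(Matrix.of fun i k => U k ^ e₁ i * t k ^ e₂ i).det| ≤
        K * δ ^ ∑ i ∈ range (Fintype.card ι), i := by
  obtain ⟨K, δ₀, hδ₀, hδ₀1, H⟩ :=
    exists_polyApprox_of_curve ι hP Q (∑ i ∈ range (Fintype.card ι), i)
  set K' : ℝ := ∑ i, 3 * ((3 * |K|) ^ e₁ i * (3 * |K|) ^ e₂ i) with hK'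
  refine ⟨(Fintype.card ι).factorial * (2 * K') ^ Fintype.card ι, δ₀, hδ₀, hδ₀1, ?_⟩
  intro β U₀ t₀ δ U t hβ hU₀ hU₀' ht₀ ht₀' hU ht ht' hcurve hδ hδδ₀ hτ
  obtain ⟨hUA, htA⟩ := H β U₀ t₀ δ U t hβ hU₀ hU₀' ht₀ ht₀' hU ht ht' hcurve hδ hδδ₀ hτ
  have hδ1 := hδδ₀.trans hδ₀1
  have hη : 0 ≤ δ ^ ∑ i ∈ range (Fintype.card ι), i := by positivity
  have hη1 : δ ^ ∑ i ∈ range (Fintype.card ι), i ≤ 1 := pow_le_one₀ hδ hδ1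
  have hτ1 : ∀ k, |t k - t₀| ≤ 1 := fun k => (hτ k).trans hδ1
  have hUA' := PolyApprox.mono hη hUA (le_abs_self K)
  have htA' := PolyApprox.mono hη htA (le_abs_self K)
  refine abs_det_le_of_polyApprox hδ hδ1 hτ (fun i k => U k ^ e₁ i * t k ^ e₂ i) fun i => ?_
  refine PolyApprox.mono hη (PolyApprox.mul hη hη1 hτ1 (PolyApprox.pow hη hη1 hτ1 hUA' (e₁ i))
    (PolyApprox.pow hη hη1 hτ1 htA' (e₂ i))) ?_
  exact single_le_sum (f := fun i => 3 * ((3 * |K|) ^ e₁ i * (3 * |K|) ^ e₂ i))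
    (fun j _ => by positivity) (mem_univ i)

end LocalEstimate

section Counting
open Polynomial

theorem exists_linear_relation_of_det_eq_zero {ι : Type*} [Fintype ι] [DecidableEq ι]
    (T : Set (ι → ℝ)) (h : ∀ v : ι → ι → ℝ, (∀ k, v k ∈ T) → (Matrix.of v).det = 0) :
    ∃ g : ι → ℝ, g ≠ 0 ∧ ∀ v ∈ T, ∑ i, v i * g i = 0 := by
  have hlt : Submodule.span ℝ T < ⊤ := by
    rw [lt_top_iff_ne_top]
    intro htop
    obtain ⟨b, hbT, hspan, hli⟩ := exists_linearIndependent ℝ T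
    have hB := Module.Basis.mk hli (by rw [Subtype.range_coe, hspan, htop])
    have : Fintype b := FiniteDimensional.fintypeBasisIndex hB
    have hcard : Fintype.card ι = Fintype.card b := by
      rw [← Module.finrank_eq_card_basis hB, Module.finrank_fintype_fun_eq_card]
    have e := Fintype.equivOfCardEq hcard
    have h0 := h (fun k => (e k : ι → ℝ)) fun k => hbT (e k).2
    have hli' : LinearIndependent ℝ (Matrix.of fun k => (e k : ι → ℝ)).row :=
      hli.comp e e.injective
    have := (Matrix.isUnit_iff_isUnit_det _).1 (Matrix.linearIndependent_rows_iff_isUnit.1 hli')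
    rw [h0] at this
    exact not_isUnit_zero this
  obtain ⟨f, hf, hle⟩ := Submodule.exists_le_ker_of_lt_top _ hlt
  refine ⟨fun i => f (Pi.single i 1), fun h0 => hf ?_, fun v hv => ?_⟩
  · refine LinearMap.pi_ext' fun i => LinearMap.ext_ring ?_
    simpa using congrFun h0 i
  · have h1 : f v = 0 := hle (Submodule.subset_span hv)
    rw [LinearMap.pi_apply_eq_sum_univ f v] at h1
    rw [← h1]
    refine sum_congr rfl fun i _ => ?_
    rw [smul_eq_mul]
    refine congrArg _ (congrArg f (funext fun j => ?_))
    simp [Pi.single_apply, eq_comm]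

/-- If all determinants of the monomials `x ^ i y ^ j` with `i ≤ D`, `j < Q` in points of `F`
vanish and `F` lies on `y ^ Q = κ (x ^ P - ν)`, then `F` is boundedly small. -/
theorem card_le_of_det_monomials_eq_zero {P Q D : ℕ} (hP : 0 < P) (hQ : 0 < Q) {κ ν : ℝ}
    (hκ : κ ≠ 0) (hν : ν ≠ 0) (F : Finset (ℕ × ℕ))
    (hF : ∀ z ∈ F, (z.2 : ℝ) ^ Q = κ * ((z.1 : ℝ) ^ P - ν))
    (hdet : ∀ z : Fin (D + 1) × Fin Q → ℕ × ℕ, (∀ k, z k ∈ F) →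
      (Matrix.of fun i k => ((z k).1 : ℝ) ^ (i.1 : ℕ) * ((z k).2 : ℝ) ^ (i.2 : ℕ)).det = 0) :
    F.card ≤ Q * (P + D) := by
  obtain ⟨g, hg, hgF⟩ := exists_linear_relation_of_det_eq_zero
    ((fun z : ℕ × ℕ => fun i : Fin (D + 1) × Fin Q => (z.1 : ℝ) ^ (i.1 : ℕ) * (z.2 : ℝ) ^ (i.2 : ℕ)) ''
      (F : Set (ℕ × ℕ))) (by
    intro v hv
    choose z hz hzv using hv
    rw [← hdet z hz, ← Matrix.det_transpose]
    congr 1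
    ext i k
    simp [← hzv])
  set G : ℕ → ℝ[X] := fun j => if hj : j < Q then
    ∑ i : Fin (D + 1), C (g (i, ⟨j, hj⟩)) * X ^ (i : ℕ) else 0 with hG
  have hdeg : ∀ j, (G j).natDegree ≤ D := by
    intro j
    simp only [hG]
    split_ifs
    · refine natDegree_sum_le_of_forall_le _ _ fun i _ => ?_
      exact (natDegree_C_mul_X_pow_le _ _).trans (Nat.lt_succ_iff.1 i.2)
    · simp
  have hne : ∃ j < Q, G j ≠ 0 := by
    obtain ⟨⟨i, j⟩, hij⟩ := Function.ne_iff.1 hg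
    refine ⟨j, j.2, fun h0 => hij ?_⟩
    have := congrArg (fun p => coeff p i) h0
    simp only [hG, j.2, dif_pos, finsetSum_coeff, coeff_C_mul, coeff_X_pow, coeff_zero] at this
    simpa [Fin.val_inj] using this
  obtain ⟨R, hR, hRdeg, hRz⟩ := exists_eliminant hP hQ hκ hν G hdeg hne
  have hinj : Set.InjOn (fun z : ℕ × ℕ => (z.1 : ℝ)) F := by
    rintro ⟨x, y⟩ hz ⟨x', y'⟩ hz' hxx
    have hxx' : (x : ℝ) = x' := hxx
    have h1 := hF _ hz
    have h2 := hF _ hz'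
    simp only at h1 h2
    rw [hxx', ← h2] at h1
    have hy := (pow_left_inj₀ (Nat.cast_nonneg y) (Nat.cast_nonneg y') hQ.ne').1 h1
    exact Prod.ext (by exact_mod_cast hxx') (by exact_mod_cast hy)
  rw [← card_image_of_injOn hinj]
  refine le_trans ?_ hRdeg
  refine le_trans (card_le_card (t := R.roots.toFinset) ?_)
    ((Multiset.toFinset_card_le _).trans (card_roots' R))
  intro r hr
  obtain ⟨z, hz, rfl⟩ := mem_image.1 hr
  rw [Multiset.mem_toFinset, mem_roots hR, IsRoot.def]
  refine hRz _ _ (hF z hz) ?_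
  have h0 := hgF _ (Set.mem_image_of_mem _ hz)
  rw [Fintype.sum_prod_type, sum_comm] at h0
  rw [← Fin.sum_univ_eq_sum_range (fun j => (G j).eval (z.1 : ℝ) * (z.2 : ℝ) ^ j) Q, ← h0]
  refine sum_congr rfl fun j _ => ?_
  simp only [hG, j.2, dif_pos, eval_finsetSum, sum_mul]
  refine sum_congr rfl fun i _ => ?_
  simp
  ring

/-- The determinant of monomials vanishes at integral points of a short arc of
`a x ^ P + b y ^ Q = n` on which the first term dominates. -/
theorem exists_det_monomials_eq_zero (ι : Type*) [Fintype ι] [DecidableEq ι] [Nonempty ι] {P : ℕ}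
    (hP : P ≠ 0) (Q : ℕ) (e₁ e₂ : ι → ℕ) :
    ∃ K δ₀ : ℝ, 0 < δ₀ ∧ δ₀ ≤ 1 ∧ ∀ (X Y a b n δ : ℝ) (z : ι → ℕ × ℕ), 1 ≤ X → 1 ≤ Y → a ≠ 0 →
      |b| * Y ^ Q ≤ |a| * X ^ P → (∀ k, X ≤ (z k).1 ∧ ((z k).1 : ℝ) < 2 * X) →
      (∀ k, Y ≤ (z k).2 ∧ ((z k).2 : ℝ) < 2 * Y) →
      (∀ k, a * ((z k).1 : ℝ) ^ P + b * ((z k).2 : ℝ) ^ Q = n) → 0 ≤ δ → δ ≤ δ₀ →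
      (∀ k l, |((z k).2 : ℝ) / Y - (z l).2 / Y| ≤ δ) →
      (X ^ ∑ i, e₁ i) * (Y ^ ∑ i, e₂ i) * (K * δ ^ ∑ i ∈ range (Fintype.card ι), i) < 1 →
      (Matrix.of fun i k => ((z k).1 : ℝ) ^ e₁ i * ((z k).2 : ℝ) ^ e₂ i).det = 0 := by
  obtain ⟨K, δ₀, hδ₀, hδ₀1, H⟩ := exists_abs_det_monomials_le ι hP Q e₁ e₂
  refine ⟨K, δ₀, hδ₀, hδ₀1, ?_⟩
  intro X Y a b n δ z hX hY ha hab hzX hzY hcurve hδ hδδ₀ hτ hsmall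
  have hX0 : 0 < X := by linarith
  have hY0 : 0 < Y := by linarith
  have haX : 0 < |a| * X ^ P := by positivity
  obtain ⟨k₀⟩ := ‹Nonempty ι›
  have hU1 : ∀ k, 1 ≤ ((z k).1 : ℝ) / X := fun k => (one_le_div hX0).2 (hzX k).1
  have hU2 : ∀ k, ((z k).1 : ℝ) / X ≤ 2 := fun k => (div_le_iff₀ hX0).2 (hzX k).2.le
  have ht1 : ∀ k, 1 ≤ ((z k).2 : ℝ) / Y := fun k => (one_le_div hY0).2 (hzY k).1
  have ht2 : ∀ k, ((z k).2 : ℝ) / Y ≤ 2 := fun k => (div_le_iff₀ hY0).2 (hzY k).2.le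
  have hnorm : ∀ k, (((z k).1 : ℝ) / X) ^ P + b * Y ^ Q / (a * X ^ P) * (((z k).2 : ℝ) / Y) ^ Q =
      n / (a * X ^ P) := by
    intro k
    rw [← hcurve k, div_pow, div_pow]
    field_simp
  have hβ : |b * Y ^ Q / (a * X ^ P)| ≤ 1 := by
    rw [abs_div, abs_mul, abs_mul, abs_pow, abs_pow, abs_of_pos hX0, abs_of_pos hY0]
    exact (div_le_one haX).2 hab
  have hdet := H _ _ _ δ (fun k => ((z k).1 : ℝ) / X) (fun k => ((z k).2 : ℝ) / Y) hβ (hU1 k₀)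
    (hU2 k₀) (by linarith [ht1 k₀]) (ht2 k₀) (fun k => by linarith [hU1 k])
    (fun k => by linarith [ht1 k]) ht2 (fun k => (hnorm k).trans (hnorm k₀).symm) hδ hδδ₀
    fun k => hτ k k₀
  have hscale : (Matrix.of fun i k => ((z k).1 : ℝ) ^ e₁ i * ((z k).2 : ℝ) ^ e₂ i) =
      Matrix.of fun i k => (X ^ e₁ i * Y ^ e₂ i) * (Matrix.of fun i k =>
        (((z k).1 : ℝ) / X) ^ e₁ i * (((z k).2 : ℝ) / Y) ^ e₂ i) i k := by
    ext i k
    simp only [Matrix.of_apply, div_pow]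
    field_simp
  have hint : (Matrix.of fun i k => ((z k).1 : ℝ) ^ e₁ i * ((z k).2 : ℝ) ^ e₂ i) =
      (Matrix.of fun i k => ((z k).1 : ℤ) ^ e₁ i * ((z k).2 : ℤ) ^ e₂ i).map
        (Int.cast : ℤ → ℝ) := by
    ext i k
    simp
  have habs : |(Matrix.of fun i k => ((z k).1 : ℝ) ^ e₁ i * ((z k).2 : ℝ) ^ e₂ i).det| < 1 := by
    rw [hscale, Matrix.det_mul_column, abs_mul, prod_mul_distrib, prod_pow_eq_pow_sum,
      prod_pow_eq_pow_sum, abs_of_pos (by positivity)]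
    exact (mul_le_mul_of_nonneg_left hdet (by positivity)).trans_lt hsmall
  rw [hint, ← Int.cast_det] at habs ⊢
  rw [← Int.cast_abs] at habs
  have : |(Matrix.of fun i k => ((z k).1 : ℤ) ^ e₁ i * ((z k).2 : ℤ) ^ e₂ i).det| < 1 := by
    exact_mod_cast habs
  rw [Int.abs_lt_one_iff.1 this, Int.cast_zero]

theorem card_le_of_forall_short {α : Type*} (T : Finset α) (φ : α → ℝ) {δ : ℝ} (hδ : 0 < δ)
    (hδ1 : δ ≤ 1) (B : ℕ) (hφ : ∀ z ∈ T, 1 ≤ φ z ∧ φ z ≤ 2)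
    (hB : ∀ F ⊆ T, (∀ z ∈ F, ∀ w ∈ F, |φ z - φ w| ≤ δ) → F.card ≤ B) :
    (T.card : ℝ) ≤ 2 * B * δ⁻¹ := by
  have h1 := card_le_mul_card_image (f := fun z => ⌊(φ z - 1) / δ⌋₊) T B (by
    intro m _
    refine hB _ (filter_subset _ _) fun z hz w hw => ?_
    obtain ⟨hzT, hzm⟩ := mem_filter.1 hz
    obtain ⟨hwT, hwm⟩ := mem_filter.1 hw
    have hz0 : 0 ≤ (φ z - 1) / δ := div_nonneg (by linarith [hφ z hzT]) hδ.le
    have hw0 : 0 ≤ (φ w - 1) / δ := div_nonneg (by linarith [hφ w hwT]) hδ.le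
    have z1 := Nat.floor_le hz0
    have z2 := Nat.lt_floor_add_one ((φ z - 1) / δ)
    have w1 := Nat.floor_le hw0
    have w2 := Nat.lt_floor_add_one ((φ w - 1) / δ)
    rw [hzm] at z1 z2
    rw [hwm] at w1 w2
    have h3 : |(φ z - 1) / δ - (φ w - 1) / δ| ≤ 1 := abs_le.2 ⟨by linarith, by linarith⟩
    rw [← sub_div, abs_div, abs_of_pos hδ, div_le_one hδ] at h3
    simpa using h3)
  have h2 : (T.image fun z => ⌊(φ z - 1) / δ⌋₊).card ≤ ⌊δ⁻¹⌋₊ + 1 := by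
    rw [← card_range (⌊δ⁻¹⌋₊ + 1)]
    refine card_le_card fun m hm => ?_
    obtain ⟨z, hz, rfl⟩ := mem_image.1 hm
    rw [mem_range, Nat.lt_succ_iff]
    refine Nat.floor_le_floor ?_
    rw [div_eq_mul_inv]
    exact mul_le_of_le_one_left (by positivity) (by linarith [hφ z hz])
  have h3 : (1 : ℝ) ≤ δ⁻¹ := (one_le_inv₀ hδ).2 hδ1
  have h4 : ((⌊δ⁻¹⌋₊ : ℕ) : ℝ) ≤ δ⁻¹ := Nat.floor_le (by positivity)
  calc (T.card : ℝ) ≤ B * (⌊δ⁻¹⌋₊ + 1) := by exact_mod_cast h1.trans (Nat.mul_le_mul_left _ h2)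
    _ ≤ B * (2 * δ⁻¹) := by gcongr; linarith
    _ = _ := by ring

end Counting

section CurveCount

theorem sum_fst_mul_le (D Q : ℕ) (hQ : 0 < Q) :
    (∑ i : Fin (D + 1) × Fin Q, (i.1 : ℕ)) * Q ≤
      ∑ i ∈ range (Fintype.card (Fin (D + 1) × Fin Q)), i := by
  have h1 : (∑ i : Fin (D + 1) × Fin Q, (i.1 : ℕ)) * 2 = Q * ((D + 1) * D) := by
    rw [Fintype.sum_prod_type]
    simp only [sum_const, card_univ, Fintype.card_fin, smul_eq_mul]
    rw [← mul_sum, Fin.sum_univ_eq_sum_range (fun i => i) (D + 1), mul_assoc,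
      sum_range_id_mul_two, Nat.add_sub_cancel]
  have h2 := sum_range_id_mul_two (Fintype.card (Fin (D + 1) × Fin Q))
  simp only [Fintype.card_prod, Fintype.card_fin] at h2 ⊢
  obtain ⟨Q, rfl⟩ := Nat.exists_eq_succ_of_ne_zero hQ.ne'
  have e : (D + 1) * Q.succ - 1 = D * Q.succ + Q := by
    rw [Nat.succ_eq_add_one]; ring_nf; omega
  rw [e] at h2
  have : (D + 1) * Q.succ * (D * Q.succ) ≤ (D + 1) * Q.succ * (D * Q.succ + Q) :=
    Nat.mul_le_mul_left _ (Nat.le_add_right _ _)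
  nlinarith

theorem sum_snd_mul_le (D Q : ℕ) (hQ : 0 < Q) :
    (∑ i : Fin (D + 1) × Fin Q, (i.2 : ℕ)) * (D + 1) ≤
      ∑ i ∈ range (Fintype.card (Fin (D + 1) × Fin Q)), i := by
  have h1 : (∑ i : Fin (D + 1) × Fin Q, (i.2 : ℕ)) * 2 = (D + 1) * (Q * (Q - 1)) := by
    rw [Fintype.sum_prod_type]
    simp only [sum_const, card_univ, Fintype.card_fin, smul_eq_mul]
    rw [Fin.sum_univ_eq_sum_range (fun i => i) Q, mul_assoc, sum_range_id_mul_two]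
  have h2 := sum_range_id_mul_two (Fintype.card (Fin (D + 1) × Fin Q))
  simp only [Fintype.card_prod, Fintype.card_fin] at h2 ⊢
  obtain ⟨Q, rfl⟩ := Nat.exists_eq_succ_of_ne_zero hQ.ne'
  have e : (D + 1) * Q.succ - 1 = (D + 1) * Q + D := by
    rw [Nat.succ_eq_add_one]; ring_nf; omega
  rw [e] at h2
  rw [Nat.succ_sub_one] at h1
  have : (D + 1) * Q.succ * ((D + 1) * Q) ≤ (D + 1) * Q.succ * ((D + 1) * Q + D) :=
    Nat.mul_le_mul_left _ (Nat.le_add_right _ _)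
  nlinarith

/-- Integral points on `a x ^ P + b y ^ Q = n` in a dyadic box, by the determinant method. -/
theorem exists_card_curve_points_le {P Q : ℕ} (hP : 0 < P) (hQ : 0 < Q) {ε : ℝ} (hε : 0 < ε) :
    ∃ C : ℝ, 0 ≤ C ∧ ∀ (X Y a b n : ℝ) (T : Finset (ℕ × ℕ)), 1 ≤ X → 1 ≤ Y → a ≠ 0 → b ≠ 0 →
      n ≠ 0 → (∀ z ∈ T, (X ≤ z.1 ∧ (z.1 : ℝ) < 2 * X) ∧ (Y ≤ z.2 ∧ (z.2 : ℝ) < 2 * Y) ∧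
        a * (z.1 : ℝ) ^ P + b * (z.2 : ℝ) ^ Q = n) →
      (T.card : ℝ) ≤ C * X ^ (1 / (Q : ℝ)) * Y ^ ε := by
  obtain ⟨D, hD⟩ : ∃ D : ℕ, 1 / ((D : ℝ) + 1) < ε := exists_nat_one_div_lt hε
  replace hD : 1 / (((D + 1 : ℕ) : ℝ) + 1) < ε := by
    refine lt_of_le_of_lt ?_ hD
    push_cast
    gcongr
    linarith
  set D' := D + 1 with hD'
  let ι := Fin (D' + 1) × Fin Q
  have : Nonempty ι := ⟨(0, ⟨0, hQ⟩)⟩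
  set A := ∑ i : ι, (i.1 : ℕ) with hA
  set B := ∑ i : ι, (i.2 : ℕ) with hB
  set S := ∑ i ∈ range (Fintype.card ι), i with hS
  have hAS : A * Q ≤ S := sum_fst_mul_le D' Q hQ
  have hBS : B * (D' + 1) ≤ S := sum_snd_mul_le D' Q hQ
  have hS1 : 1 ≤ S := by
    have : 1 ∈ range (Fintype.card ι) := by
      simp only [ι, Fintype.card_prod, Fintype.card_fin, mem_range, hD']
      nlinarith
    exact single_le_sum (f := fun i : ℕ => i) (fun _ _ => Nat.zero_le _) this
  have hS0 : (0 : ℝ) < S := by exact_mod_cast hS1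
  obtain ⟨K₁, δ₁, hδ₁, hδ₁1, H₁⟩ := exists_det_monomials_eq_zero ι hP.ne' Q
    (fun i => (i.1 : ℕ)) (fun i => (i.2 : ℕ))
  obtain ⟨K₂, δ₂, hδ₂, hδ₂1, H₂⟩ := exists_det_monomials_eq_zero ι hQ.ne' P
    (fun i => (i.2 : ℕ)) (fun i => (i.1 : ℕ))
  set K := max (max K₁ K₂) 1 with hK
  have hK1 : K₁ ≤ K := (le_max_left _ _).trans (le_max_left _ _)
  have hK2 : K₂ ≤ K := (le_max_right _ _).trans (le_max_left _ _)
  have hK0 : 0 < K := lt_of_lt_of_le one_pos (le_max_right _ _)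
  set δ₀ := min (min δ₁ δ₂) (1 / (2 * K)) with hδ₀
  have hδ₀0 : 0 < δ₀ := lt_min (lt_min hδ₁ hδ₂) (by positivity)
  have hd1 : δ₀ ≤ δ₁ := (min_le_left _ _).trans (min_le_left _ _)
  have hd2 : δ₀ ≤ δ₂ := (min_le_left _ _).trans (min_le_right _ _)
  have hd3 : δ₀ ≤ 1 := hd1.trans hδ₁1
  have hKδ : K * δ₀ ^ S < 1 := by
    have h1 : δ₀ ^ S ≤ δ₀ := pow_le_of_le_one hδ₀0.le hd3 (by omega)
    have h2 : δ₀ ≤ 1 / (2 * K) := min_le_right _ _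
    calc K * δ₀ ^ S ≤ K * (1 / (2 * K)) := by gcongr; exact h1.trans h2
      _ = 1 / 2 := by field_simp
      _ < 1 := by norm_num
  refine ⟨2 * ((Q * (P + D') : ℕ) : ℝ) * δ₀⁻¹, by positivity, ?_⟩
  intro X Y a b n T hX hY ha hb hn hT
  have hX0 : 0 < X := by linarith
  have hY0 : 0 < Y := by linarith
  set W := X ^ A * Y ^ B with hW
  have hW1 : 1 ≤ W := one_le_mul_of_one_le_of_one_le (one_le_pow₀ hX) (one_le_pow₀ hY)
  have hW0 : 0 < W := by linarith
  set ω := W ^ (1 / (S : ℝ)) with hω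
  have hω1 : 1 ≤ ω := Real.one_le_rpow hW1 (by positivity)
  have hω0 : 0 < ω := by linarith
  have hωS : ω ^ S = W := by
    rw [hω, one_div, Real.rpow_inv_natCast_pow hW0.le (by omega)]
  have hωle : ω ≤ X ^ (1 / (Q : ℝ)) * Y ^ ε := by
    rw [hω, hW, Real.mul_rpow (by positivity) (by positivity), ← Real.rpow_natCast,
      ← Real.rpow_natCast, ← Real.rpow_mul hX0.le, ← Real.rpow_mul hY0.le]
    have hQ0 : (0 : ℝ) < Q := by exact_mod_cast hQ
    have hA' : (A : ℝ) * Q ≤ S := by exact_mod_cast hAS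
    have hB' : (B : ℝ) * (D' + 1) ≤ S := by exact_mod_cast hBS
    refine mul_le_mul (Real.rpow_le_rpow_of_exponent_le hX ?_)
      (Real.rpow_le_rpow_of_exponent_le hY (le_trans ?_ hD.le)) (by positivity) (by positivity)
    · rw [mul_one_div, div_le_div_iff₀ hS0 hQ0]; linarith
    · rw [mul_one_div, div_le_div_iff₀ hS0 (by positivity)]; linarith
  set δ := δ₀ / ω with hδ
  have hδ0 : 0 < δ := by positivity
  have hδδ₀ : δ ≤ δ₀ := div_le_self hδ₀0.le hω1
  have hsmall : ∀ K', K' ≤ K → W * (K' * δ ^ S) < 1 := by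
    intro K' hK'
    have : W * (K * δ ^ S) = K * δ₀ ^ S := by
      rw [hδ, div_pow, hωS]; field_simp
    refine lt_of_le_of_lt ?_ (this.trans_lt hKδ)
    gcongr
  have hκ : -a / b ≠ 0 := div_ne_zero (neg_ne_zero.2 ha) hb
  have hν : n / a ≠ 0 := div_ne_zero hn ha
  have hcurve : ∀ z ∈ T, (z.2 : ℝ) ^ Q = -a / b * ((z.1 : ℝ) ^ P - n / a) := by
    intro z hz
    have := (hT z hz).2.2
    field_simp
    linarith
  have hcard : (T.card : ℝ) ≤ 2 * ((Q * (P + D') : ℕ) : ℝ) * δ⁻¹ := by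
    rcases le_total (|b| * Y ^ Q) (|a| * X ^ P) with hab | hab
    · refine card_le_of_forall_short T (fun z => (z.2 : ℝ) / Y) hδ0 (hδδ₀.trans hd3) _ ?_ ?_
      · intro z hz
        exact ⟨(one_le_div hY0).2 (hT z hz).2.1.1, (div_le_iff₀ hY0).2 (hT z hz).2.1.2.le⟩
      · intro F hF hshort
        refine card_le_of_det_monomials_eq_zero hP hQ hκ hν F (fun z hz => hcurve z (hF hz)) ?_
        intro z hz
        exact H₁ X Y a b n δ z hX hY ha hab (fun k => (hT _ (hF (hz k))).1)
          (fun k => (hT _ (hF (hz k))).2.1) (fun k => (hT _ (hF (hz k))).2.2) hδ0.le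
          (hδδ₀.trans hd1) (fun k l => hshort _ (hz k) _ (hz l)) (hsmall _ hK1)
    · refine card_le_of_forall_short T (fun z => (z.1 : ℝ) / X) hδ0 (hδδ₀.trans hd3) _ ?_ ?_
      · intro z hz
        exact ⟨(one_le_div hX0).2 (hT z hz).1.1, (div_le_iff₀ hX0).2 (hT z hz).1.2.le⟩
      · intro F hF hshort
        refine card_le_of_det_monomials_eq_zero hP hQ hκ hν F (fun z hz => hcurve z (hF hz)) ?_
        intro z hz
        have := H₂ Y X b a n δ (fun k => (z k).swap) hY hX hb hab
          (fun k => (hT _ (hF (hz k))).2.1) (fun k => (hT _ (hF (hz k))).1)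
          (fun k => (add_comm _ _).trans (hT _ (hF (hz k))).2.2) hδ0.le
          (hδδ₀.trans hd2) (fun k l => hshort _ (hz k) _ (hz l))
          (by rw [mul_comm (Y ^ _)]; exact hsmall _ hK2)
        rw [← this]
        congr 1
        ext i k
        simp [mul_comm]
  refine hcard.trans ?_
  have : δ⁻¹ = δ₀⁻¹ * ω := by rw [hδ]; field_simp
  rw [this, mul_assoc _ (X ^ _), ← mul_assoc]
  gcongr

end CurveCount

section Assembly

theorem exists_card_curve_points_le_min {P Q : ℕ} (hP : 0 < P) (hQ : 0 < Q) {ε : ℝ}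
    (hε : 0 < ε) :
    ∃ C : ℝ, 0 ≤ C ∧ ∀ (X Y M a b n : ℝ) (T : Finset (ℕ × ℕ)), 1 ≤ X → 1 ≤ Y → X ≤ M → Y ≤ M →
      a ≠ 0 → b ≠ 0 → n ≠ 0 →
      (∀ z ∈ T, (X ≤ z.1 ∧ (z.1 : ℝ) < 2 * X) ∧ (Y ≤ z.2 ∧ (z.2 : ℝ) < 2 * Y) ∧
        a * (z.1 : ℝ) ^ P + b * (z.2 : ℝ) ^ Q = n) →
      (T.card : ℝ) ≤ C * (M ^ ε * min (X ^ (1 / (Q : ℝ))) (Y ^ (1 / (P : ℝ)))) := by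
  obtain ⟨C₁, hC₁, H₁⟩ := exists_card_curve_points_le hP hQ hε
  obtain ⟨C₂, hC₂, H₂⟩ := exists_card_curve_points_le hQ hP hε
  refine ⟨C₁ + C₂, add_nonneg hC₁ hC₂, ?_⟩
  intro X Y M a b n T hX hY hXM hYM ha hb hn hT
  have hX0 : 0 < X := by linarith
  have hY0 : 0 < Y := by linarith
  have hM0 : 0 < M := by linarith
  have h1 : (T.card : ℝ) ≤ (C₁ + C₂) * M ^ ε * X ^ (1 / (Q : ℝ)) := by
    refine (H₁ X Y a b n T hX hY ha hb hn hT).trans ?_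
    rw [mul_right_comm]
    gcongr
    linarith
  have h2 : (T.card : ℝ) ≤ (C₁ + C₂) * M ^ ε * Y ^ (1 / (P : ℝ)) := by
    have := H₂ Y X b a n (T.image Prod.swap) hY hX hb ha hn (by
      intro z hz
      obtain ⟨w, hw, rfl⟩ := mem_image.1 hz
      obtain ⟨h1, h2, h3⟩ := hT w hw
      exact ⟨h2, h1, (add_comm _ _).trans h3⟩)
    rw [card_image_of_injective _ Prod.swap_injective] at this
    refine this.trans ?_
    rw [mul_right_comm]
    gcongr
    linarith
  rw [← mul_assoc]
  rcases min_choice (X ^ (1 / (Q : ℝ))) (Y ^ (1 / (P : ℝ))) with h | h <;> rw [h] <;> assumption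

theorem card_dyadic_le {x : ℝ} (hx : 1 ≤ x) : ((Ico ⌈x⌉₊ ⌈2 * x⌉₊).card : ℝ) ≤ 2 * x := by
  rw [Nat.card_Ico, Nat.cast_sub (Nat.ceil_le_ceil (by linarith))]
  have h1 := Nat.le_ceil x
  have h2 := Nat.ceil_lt_add_one (show 0 ≤ 2 * x by linarith)
  linarith

theorem card_dyadic_box_le {d : ℕ} (X : Fin d → ℝ) (hX : ∀ i, 1 ≤ X i) :
    ((Fintype.piFinset fun i => Ico ⌈X i⌉₊ ⌈2 * X i⌉₊).card : ℝ) ≤ 2 ^ d * ∏ i, X i := by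
  rw [Fintype.card_piFinset, Nat.cast_prod]
  refine (prod_le_prod (fun _ _ => Nat.cast_nonneg _) fun i _ => card_dyadic_le (hX i)).trans ?_
  rw [prod_mul_distrib]
  simp

theorem card_dyadic_box_update_le {d : ℕ} (X : Fin d → ℝ) (hX : ∀ i, 1 ≤ X i) (p : Fin d) :
    ((Fintype.piFinset fun i => if i = p then {0} else Ico ⌈X i⌉₊ ⌈2 * X i⌉₊).card : ℝ) ≤
      2 ^ d * (∏ i, X i) * (X p)⁻¹ := by
  rw [Fintype.card_piFinset, Nat.cast_prod]
  have hp : 0 < X p := by linarith [hX p]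
  have h1 : ∀ i ∈ univ, (((if i = p then {0} else Ico ⌈X i⌉₊ ⌈2 * X i⌉₊ : Finset ℕ).card : ℕ) : ℝ) ≤
      2 * if i = p then 1 else X i := by
    intro i _
    split_ifs
    · simp
    · exact card_dyadic_le (hX i)
  refine (prod_le_prod (fun _ _ => Nat.cast_nonneg _) h1).trans ?_
  rw [prod_mul_distrib, ← mul_prod_erase univ (fun i => if i = p then 1 else X i) (mem_univ p),
    ← mul_prod_erase univ X (mem_univ p)]
  have h2 : ∏ i ∈ univ.erase p, (if i = p then 1 else X i) = ∏ i ∈ univ.erase p, X i :=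
    prod_congr rfl fun i hi => if_neg (ne_of_mem_erase hi)
  rw [h2]
  simp only [prod_const, card_univ, Fintype.card_fin, if_true]
  field_simp
  simp

theorem eq_of_update_eq_update {α β : Type*} [DecidableEq α] {f g : α → β} {p : α} {c : β}
    (h : Function.update f p c = Function.update g p c) {j : α} (hj : j ≠ p) : f j = g j := by
  have := congrFun h j
  rwa [Function.update_of_ne hj, Function.update_of_ne hj] at this

/-- Fixing all variables but `x p` and `y q` leaves a binomial curve in these two variables. -/
theorem card_fibre_le {d : ℕ} {X Y Z : Fin d → ℝ} (hX : ∀ i, 1 ≤ X i) (hY : ∀ i, 1 ≤ Y i)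
    (hZ : ∀ i, 1 ≤ Z i) {c₁ c₂ c₃ : ℤ} (h₁ : c₁ ≠ 0) (h₂ : c₂ ≠ 0) (h₃ : c₃ ≠ 0) (p q : Fin d)
    {E : ℝ} (hE : ∀ (a b n : ℝ) (T : Finset (ℕ × ℕ)), a ≠ 0 → b ≠ 0 → n ≠ 0 →
      (∀ z ∈ T, (X p ≤ z.1 ∧ (z.1 : ℝ) < 2 * X p) ∧ (Y q ≤ z.2 ∧ (z.2 : ℝ) < 2 * Y q) ∧
        a * (z.1 : ℝ) ^ ((p : ℕ) + 1) + b * (z.2 : ℝ) ^ ((q : ℕ) + 1) = n) → (T.card : ℝ) ≤ E)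
    (F : Finset ((Fin d → ℕ) × (Fin d → ℕ) × (Fin d → ℕ)))
    (hFX : ∀ t ∈ F, ∀ i, X i ≤ (t.1 i : ℝ) ∧ (t.1 i : ℝ) < 2 * X i)
    (hFY : ∀ t ∈ F, ∀ i, Y i ≤ (t.2.1 i : ℝ) ∧ (t.2.1 i : ℝ) < 2 * Y i)
    (hFZ : ∀ t ∈ F, ∀ i, Z i ≤ (t.2.2 i : ℝ) ∧ (t.2.2 i : ℝ) < 2 * Z i)
    (hF : ∀ t ∈ F, c₁ * ∏ j, (t.1 j : ℤ) ^ ((j : ℕ) + 1) + c₂ * ∏ j, (t.2.1 j : ℤ) ^ ((j : ℕ) + 1)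
      = c₃ * ∏ j, (t.2.2 j : ℤ) ^ ((j : ℕ) + 1))
    (t₀ : (Fin d → ℕ) × (Fin d → ℕ) × (Fin d → ℕ)) (ht₀ : t₀ ∈ F)
    (hfib : ∀ t ∈ F, (Function.update t.1 p 0, Function.update t.2.1 q 0, t.2.2) =
      (Function.update t₀.1 p 0, Function.update t₀.2.1 q 0, t₀.2.2)) :
    (F.card : ℝ) ≤ E := by
  have hx : ∀ t ∈ F, ∀ j ≠ p, t.1 j = t₀.1 j := fun t ht j hj =>
    eq_of_update_eq_update (congrArg Prod.fst (hfib t ht)) hj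
  have hy : ∀ t ∈ F, ∀ j ≠ q, t.2.1 j = t₀.2.1 j := fun t ht j hj =>
    eq_of_update_eq_update (congrArg (fun u => u.2.1) (hfib t ht)) hj
  have hz : ∀ t ∈ F, t.2.2 = t₀.2.2 := fun t ht => congrArg (fun u => u.2.2) (hfib t ht)
  have hinj : Set.InjOn (fun t : (Fin d → ℕ) × (Fin d → ℕ) × (Fin d → ℕ) => (t.1 p, t.2.1 q))
      F := by
    intro t ht u hu htu
    simp only [Prod.mk.injEq] at htu
    refine Prod.ext (funext fun j => ?_) (Prod.ext (funext fun j => ?_)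
      ((hz t ht).trans (hz u hu).symm))
    · by_cases hj : j = p
      · rw [hj]; exact htu.1
      · exact (hx t ht j hj).trans (hx u hu j hj).symm
    · by_cases hj : j = q
      · rw [hj]; exact htu.2
      · exact (hy t ht j hj).trans (hy u hu j hj).symm
  rw [← card_image_of_injOn hinj]
  have hpos : ∀ {V : Fin d → ℝ} {v : Fin d → ℕ}, (∀ i, 1 ≤ V i) →
      (∀ i, V i ≤ (v i : ℝ) ∧ (v i : ℝ) < 2 * V i) → ∀ i, (v i : ℝ) ≠ 0 := fun hV hv i => by
    have := hV i
    have := (hv i).1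
    intro h0
    linarith
  refine hE (c₁ * ∏ j ∈ univ.erase p, (t₀.1 j : ℝ) ^ ((j : ℕ) + 1))
    (c₂ * ∏ j ∈ univ.erase q, (t₀.2.1 j : ℝ) ^ ((j : ℕ) + 1))
    (c₃ * ∏ j, (t₀.2.2 j : ℝ) ^ ((j : ℕ) + 1)) _ ?_ ?_ ?_ ?_
  · exact mul_ne_zero (by exact_mod_cast h₁)
      (prod_ne_zero_iff.2 fun j _ => pow_ne_zero _ (hpos hX (hFX t₀ ht₀) j))
  · exact mul_ne_zero (by exact_mod_cast h₂)
      (prod_ne_zero_iff.2 fun j _ => pow_ne_zero _ (hpos hY (hFY t₀ ht₀) j))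
  · exact mul_ne_zero (by exact_mod_cast h₃)
      (prod_ne_zero_iff.2 fun j _ => pow_ne_zero _ (hpos hZ (hFZ t₀ ht₀) j))
  · intro w hw
    obtain ⟨t, ht, rfl⟩ := mem_image.1 hw
    refine ⟨hFX t ht p, hFY t ht q, ?_⟩
    have h := congrArg (Int.cast : ℤ → ℝ) (hF t ht)
    push_cast at h
    rw [← mul_prod_erase univ (fun j => (t.1 j : ℝ) ^ ((j : ℕ) + 1)) (mem_univ p),
      ← mul_prod_erase univ (fun j => (t.2.1 j : ℝ) ^ ((j : ℕ) + 1)) (mem_univ q), hz t ht,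
      prod_congr rfl fun j hj => by rw [hx t ht j (ne_of_mem_erase hj)],
      prod_congr (s₁ := univ.erase q) rfl fun j hj => by
        rw [hy t ht j (ne_of_mem_erase hj)]] at h
    rw [← h]
    ring

end Assembly

theorem Bcount_determinant_bound (d : ℕ) (hd : 1 ≤ d) (ε : ℝ) (hε : 0 < ε) :
    ∃ C : ℝ, ∀ X Y Z : Fin d → ℝ,
      (∀ i, 1 ≤ X i) → (∀ i, 1 ≤ Y i) → (∀ i, 1 ≤ Z i) →
      ∀ c₁ c₂ c₃ : ℤ, c₁ ≠ 0 → c₂ ≠ 0 → c₃ ≠ 0 →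
      ∀ p q : Fin d,
        (Bcount d c₁ c₂ c₃ X Y Z : ℝ) ≤
          C * (⨆ i, X i * Y i * Z i) ^ ε * (∏ i, X i * Y i * Z i) * (X p * Y q)⁻¹ *
            min (X p ^ ((1 : ℝ) / ((q : ℕ) + 1))) (Y q ^ ((1 : ℝ) / ((p : ℕ) + 1))) := by
  classical
  choose C hC HC using fun pq : Fin d × Fin d =>
    exists_card_curve_points_le_min (P := (pq.1 : ℕ) + 1) (Q := (pq.2 : ℕ) + 1)
      (Nat.succ_pos _) (Nat.succ_pos _) hε
  refine ⟨(∑ pq, C pq) * (2 ^ d * 2 ^ d * 2 ^ d), ?_⟩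
  intro X Y Z hX hY hZ c₁ c₂ c₃ h₁ h₂ h₃ p q
  set M := ⨆ i, X i * Y i * Z i with hM
  have hleM : ∀ i, X i * Y i * Z i ≤ M := le_ciSup (Set.finite_range _).bddAbove
  have hXM : X p ≤ M := by
    refine le_trans ?_ (hleM p)
    rw [mul_assoc]
    exact le_mul_of_one_le_right (by linarith [hX p])
      (one_le_mul_of_one_le_of_one_le (hY p) (hZ p))
  have hYM : Y q ≤ M := by
    refine le_trans ?_ (hleM q)
    rw [mul_comm (X q), mul_assoc]
    exact le_mul_of_one_le_right (by linarith [hY q])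
      (one_le_mul_of_one_le_of_one_le (hX q) (hZ q))
  have hXp : 0 < X p := by linarith [hX p]
  have hYq : 0 < Y q := by linarith [hY q]
  have hM0 : 0 < M := by linarith
  set m := min (X p ^ ((1 : ℝ) / ((q : ℕ) + 1))) (Y q ^ ((1 : ℝ) / ((p : ℕ) + 1))) with hm
  have hm0 : 0 ≤ m := le_min (by positivity) (by positivity)
  set E := (∑ pq, C pq) * (M ^ ε * m) with hE
  have hE0 : 0 ≤ E := mul_nonneg (sum_nonneg fun _ _ => hC _) (by positivity)
  set box : (Fin d → ℝ) → Finset (Fin d → ℕ) := fun V =>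
    Fintype.piFinset fun i => Ico ⌈V i⌉₊ ⌈2 * V i⌉₊ with hbox
  have mem_box : ∀ V v, v ∈ box V ↔ ∀ i, V i ≤ (v i : ℝ) ∧ (v i : ℝ) < 2 * V i := by
    intro V v
    simp only [hbox, Fintype.mem_piFinset, mem_Ico, Nat.ceil_le, Nat.lt_ceil]
  set box' : (Fin d → ℝ) → Fin d → Finset (Fin d → ℕ) := fun V p =>
    Fintype.piFinset fun i => if i = p then {0} else Ico ⌈V i⌉₊ ⌈2 * V i⌉₊ with hbox'
  have mem_box' : ∀ V v p, v ∈ box V → Function.update v p 0 ∈ box' V p := by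
    intro V v p hv
    rw [hbox', Fintype.mem_piFinset]
    intro i
    by_cases hi : i = p
    · simp [hi]
    · rw [if_neg hi, Function.update_of_ne hi]
      exact Fintype.mem_piFinset.1 hv i
  set T := (box X ×ˢ box Y ×ˢ box Z).filter
    fun t : (Fin d → ℕ) × (Fin d → ℕ) × (Fin d → ℕ) =>
    c₁ * ∏ j, (t.1 j : ℤ) ^ ((j : ℕ) + 1) + c₂ * ∏ j, (t.2.1 j : ℤ) ^ ((j : ℕ) + 1)
      = c₃ * ∏ j, (t.2.2 j : ℤ) ^ ((j : ℕ) + 1) with hT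
  have hBT : Bcount d c₁ c₂ c₃ X Y Z ≤ T.card := by
    rw [Bcount, ← Set.ncard_coe_finset]
    refine Set.ncard_le_ncard ?_ (Finset.finite_toSet _)
    rintro t ⟨h1, h2, h3, h4, -⟩
    simp only [hT, coe_filter, mem_product, mem_box, Set.mem_ofPred_eq]
    exact ⟨⟨h1, h2, h3⟩, h4⟩
  set f : (Fin d → ℕ) × (Fin d → ℕ) × (Fin d → ℕ) → (Fin d → ℕ) × (Fin d → ℕ) × (Fin d → ℕ) :=
    fun t => (Function.update t.1 p 0, Function.update t.2.1 q 0, t.2.2) with hf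
  have hTmem : ∀ t ∈ T, (t.1 ∈ box X ∧ t.2.1 ∈ box Y ∧ t.2.2 ∈ box Z) ∧ _ := fun t ht => by
    have := mem_filter.1 ht
    rw [mem_product, mem_product] at this
    exact this
  have hfib := card_le_mul_card_image (f := f) T ⌊E⌋₊ (by
    intro u hu
    obtain ⟨t₀, ht₀, rfl⟩ := mem_image.1 hu
    refine Nat.le_floor ?_
    refine card_fibre_le hX hY hZ h₁ h₂ h₃ p q ?_ _
      (fun t ht => (mem_box X _).1 (hTmem t (mem_filter.1 ht).1).1.1)
      (fun t ht => (mem_box Y _).1 (hTmem t (mem_filter.1 ht).1).1.2.1)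
      (fun t ht => (mem_box Z _).1 (hTmem t (mem_filter.1 ht).1).1.2.2)
      (fun t ht => (hTmem t (mem_filter.1 ht).1).2) t₀ (mem_filter.2 ⟨ht₀, rfl⟩)
      (fun t ht => (mem_filter.1 ht).2)
    intro a b n T' ha hb hn hT'
    have := HC (p, q) (X p) (Y q) M a b n T' (hX p) (hY q) hXM hYM ha hb hn hT'
    push_cast at this
    refine this.trans (mul_le_mul_of_nonneg_right ?_ (by positivity))
    exact single_le_sum (f := C) (fun _ _ => hC _) (mem_univ (p, q)))
  have himage : ((T.image f).card : ℝ) ≤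
      (2 ^ d * (∏ i, X i) * (X p)⁻¹) * ((2 ^ d * (∏ i, Y i) * (Y q)⁻¹) * (2 ^ d * ∏ i, Z i)) := by
    have hsub : T.image f ⊆ box' X p ×ˢ box' Y q ×ˢ box Z := by
      intro u hu
      obtain ⟨t, ht, rfl⟩ := mem_image.1 hu
      obtain ⟨⟨h1, h2, h3⟩, -⟩ := hTmem t ht
      rw [mem_product, mem_product]
      exact ⟨mem_box' _ _ _ h1, mem_box' _ _ _ h2, h3⟩
    have hc : ((T.image f).card : ℝ) ≤
        ((box' X p).card : ℝ) * (((box' Y q).card : ℝ) * ((box Z).card : ℝ)) := by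
      have := card_le_card hsub
      rw [card_product, card_product] at this
      exact_mod_cast this
    have hYprod : 0 ≤ ∏ i, Y i := prod_nonneg fun i _ => by linarith [hY i]
    have hXprod : 0 ≤ ∏ i, X i := prod_nonneg fun i _ => by linarith [hX i]
    refine hc.trans (mul_le_mul (card_dyadic_box_update_le X hX p)
      (mul_le_mul (card_dyadic_box_update_le Y hY q) (card_dyadic_box_le Z hZ)
        (by positivity) (by positivity)) (by positivity) (by positivity))
  calc (Bcount d c₁ c₂ c₃ X Y Z : ℝ) ≤ (T.card : ℝ) := by exact_mod_cast hBT
    _ ≤ (⌊E⌋₊ : ℝ) * ((T.image f).card : ℝ) := by exact_mod_cast hfib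
    _ ≤ E * ((2 ^ d * (∏ i, X i) * (X p)⁻¹) *
        ((2 ^ d * (∏ i, Y i) * (Y q)⁻¹) * (2 ^ d * ∏ i, Z i))) :=
      mul_le_mul (Nat.floor_le hE0) himage (Nat.cast_nonneg _) hE0
    _ = _ := by
      rw [hE, prod_mul_distrib, prod_mul_distrib, mul_inv]
      ring
end
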